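/- Let G be a connected reduced graph with minimum degree at least 3, let uvzwu be a 4-cycle in G, and let G/π be the graph obtained from G by the π-reduction on this 4-cycle, with the new edge e_π = xy. If H₀ is a nontrivial maximal collapsible subgraph of G/π, then either H₀ is isomorphic to Φ(v, t) for some t ≥ 1 with v ∈ {x, y}, in which case 2|V(H₀)| − |E(H₀)| = 2, or 2|V(H₀)| − |E(H₀)| ≥ 3. In particular, 2|V(H₀)| − |E(H₀)| ≥ 2. -/

import Mathlib

open scoped Classical

/-- A finite loopless multigraph on vertex type `V`, given by a multiset of edges. -/
structure Multigraph (V : Type) where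
  edges : Multiset (Sym2 V)
  loopless : ∀ e ∈ edges, ¬ e.IsDiag

namespace Multigraph

variable {V W : Type}

/-- The degree of a vertex with respect to a multiset of edges. -/
noncomputable def degIn (E : Multiset (Sym2 V)) (v : V) : ℕ :=
  Multiset.card (E.filter fun e => v ∈ e)

/-- The degree of a vertex in a multigraph. -/
noncomputable def deg (G : Multigraph V) (v : V) : ℕ :=
  degIn G.edges v

/-- All endpoints of the edges in `E` lie in `S`. -/
def Within (S : Set V) (E : Multiset (Sym2 V)) : Prop :=
  ∀ e ∈ E, ∀ v ∈ e, v ∈ S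

/-- The graph with vertex set `S` and edge multiset `E` is connected (and spans `S`). -/
def ConnOn (S : Set V) (E : Multiset (Sym2 V)) : Prop :=
  S.Nonempty ∧ Within S E ∧
    ∀ u ∈ S, ∀ v ∈ S, Relation.ReflTransGen (fun a b => s(a, b) ∈ E) u v

/-- The graph with vertex set `S` and edge multiset `E` is collapsible: for every even subset
`R` of `S` there is a spanning connected subgraph whose set of odd-degree vertices is `R`. -/
def CollapsiblePair (S : Set V) (E : Multiset (Sym2 V)) : Prop :=
  S.Nonempty ∧ Within S E ∧
    ∀ R : Set V, R ⊆ S → R.Finite → Even R.ncard →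
      ∃ E' ≤ E, ConnOn S E' ∧ ∀ x ∈ S, (Odd (degIn E' x) ↔ x ∈ R)

/-- `(S, E)` is a subgraph of `G`. -/
def IsSubpair (G : Multigraph V) (S : Set V) (E : Multiset (Sym2 V)) : Prop :=
  E ≤ G.edges ∧ Within S E

/-- A multigraph is reduced if it has no collapsible subgraph with more than one vertex. -/
def Reduced (G : Multigraph V) : Prop :=
  ∀ S E, G.IsSubpair S E → CollapsiblePair S E → S.ncard ≤ 1

/-- `(S, E)` is a maximal collapsible subgraph of `G`. -/
def MaxCollapsibleSub (G : Multigraph V) (S : Set V) (E : Multiset (Sym2 V)) : Prop :=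
  G.IsSubpair S E ∧ CollapsiblePair S E ∧
    ∀ S' E', G.IsSubpair S' E' → CollapsiblePair S' E' → S ⊆ S' → E ≤ E' → S' = S ∧ E' = E

/-- `(S, E)` is a nontrivial maximal collapsible subgraph of `G`. -/
def NontrivMaxCollapsible (G : Multigraph V) (S : Set V) (E : Multiset (Sym2 V)) : Prop :=
  G.MaxCollapsibleSub S E ∧ 1 < S.ncard

/-- The multiset of edges of `G` with both ends in `S`. -/
noncomputable def inducedEdges (G : Multigraph V) (S : Set V) : Multiset (Sym2 V) :=
  G.edges.filter fun e => ∀ v ∈ e, v ∈ S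

/-- `S` is the vertex set of a maximal collapsible subgraph of `G`. -/
def IsMaxCollapsibleSet (G : Multigraph V) (S : Set V) : Prop :=
  CollapsiblePair S (G.inducedEdges S) ∧
    ∀ T : Set V, S ⊆ T → CollapsiblePair T (G.inducedEdges T) → T = S

/-- `G'` (on vertex type `W`) is the reduction of `G`, witnessed by the contraction map `f`:
the fibres of `f` are exactly the (vertex sets of the) maximal collapsible subgraphs of `G`,
and the edges of `G'` are obtained by contracting each fibre to a point and deleting the
resulting loops. -/
def IsReduction (G : Multigraph V) (f : V → W) (G' : Multigraph W) : Prop :=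
  Function.Surjective f ∧ (∀ w : W, G.IsMaxCollapsibleSet (f ⁻¹' {w})) ∧
    G'.edges = (G.edges.map (Sym2.map f)).filter fun e => ¬ e.IsDiag

/-- A multigraph is supereulerian if it has a spanning connected subgraph in which every
vertex has even degree. -/
def Supereulerian (G : Multigraph V) : Prop :=
  ∃ E' ≤ G.edges, ConnOn Set.univ E' ∧ ∀ x : V, Even (degIn E' x)

/-- A multigraph is connected. -/
def Connected (G : Multigraph V) : Prop :=
  ConnOn Set.univ G.edges

/-- A multigraph is 3-edge-connected (edge connectivity at least 3): removing any at most two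
edges leaves a spanning connected graph. -/
def ThreeEdgeConnected (G : Multigraph V) : Prop :=
  ∀ F : Multiset (Sym2 V), F ≤ G.edges → Multiset.card F ≤ 2 →
    ConnOn Set.univ (G.edges - F)

/-- A spanning tree: spanning connected with `|V| - 1` edges. -/
def IsSpanningTree [Fintype V] (E : Multiset (Sym2 V)) : Prop :=
  ConnOn Set.univ E ∧ Multiset.card E = Fintype.card V - 1

/-- The edge multiset `E` contains two edge-disjoint spanning trees. -/
def HasTwoDisjointSpanningTrees [Fintype V] (E : Multiset (Sym2 V)) : Prop :=
  ∃ T₁ T₂ : Multiset (Sym2 V), T₁ + T₂ ≤ E ∧ IsSpanningTree T₁ ∧ IsSpanningTree T₂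

/-- `F(G)`: the minimum number of extra (loopless) edges whose addition to `G` produces a
spanning supergraph having two edge-disjoint spanning trees. -/
noncomputable def FVal [Fintype V] (G : Multigraph V) : ℕ :=
  sInf {k : ℕ | ∃ Eadd : Multiset (Sym2 V), (∀ e ∈ Eadd, ¬ e.IsDiag) ∧
    Multiset.card Eadd = k ∧ HasTwoDisjointSpanningTrees (G.edges + Eadd)}

/-- `σ̄₂(G)`: the minimum of `deg u + deg v` over edges `uv` of `G`. -/
noncomputable def sigma2bar (G : Multigraph V) : ℕ :=
  sInf {k : ℕ | ∃ u v : V, s(u, v) ∈ G.edges ∧ G.deg u + G.deg v = k}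

/-- `G` contains a cycle of length four. -/
def HasFourCycle (G : Multigraph V) : Prop :=
  ∃ a b c d : V, a ≠ b ∧ a ≠ c ∧ a ≠ d ∧ b ≠ c ∧ b ≠ d ∧ c ≠ d ∧
    s(a, b) ∈ G.edges ∧ s(b, c) ∈ G.edges ∧ s(c, d) ∈ G.edges ∧ s(d, a) ∈ G.edges

/-- `M` is a matching: distinct edges share no endpoint. -/
def IsMatching (M : Multiset (Sym2 V)) : Prop :=
  M.Nodup ∧ ∀ e ∈ M, ∀ f ∈ M, e ≠ f → ∀ x : V, x ∈ e → x ∉ f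

/-- `{X, Y}` is a bipartition (of the full vertex set) for the edge multiset `E`:
every edge has one end in `X` and one end in `Y`. -/
def IsBipartition [Fintype V] (X Y : Finset V) (E : Multiset (Sym2 V)) : Prop :=
  Disjoint X Y ∧ X ∪ Y = Finset.univ ∧
    ∀ e ∈ E, (∃ a ∈ e, a ∈ X) ∧ (∃ b ∈ e, b ∈ Y)

/-- The edge multiset of Catlin's π-reduction `G/π` obtained from the induced four-cycle
`u v z w`: remove the four cycle edges, identify `z` with `u` (forming `x = u`) and `w` with
`v` (forming `y = v`), and add the new edge `e_π = xy = s(u, v)`. -/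
noncomputable def piEdges (G : Multigraph V) (u v z w : V) : Multiset (Sym2 V) :=
  ((G.edges - {s(u, v), s(v, z), s(z, w), s(w, u)}).map
      (Sym2.map fun a => if a = z then u else if a = w then v else a)) + {s(u, v)}

/-- `(S, E)` is the multigraph `Φ(c, t)`: a star `K_{1,t}` with centre `c` in which every
edge is doubled. -/
def IsPhi (S : Set V) (E : Multiset (Sym2 V)) (c : V) (t : ℕ) : Prop :=
  ∃ A : Finset V, c ∉ A ∧ A.card = t ∧ S = insert c (↑A : Set V) ∧
    E = A.val.map (fun a => s(c, a)) + A.val.map (fun a => s(c, a))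

/-- The multigraph associated with a simple graph. -/
noncomputable def ofSimple [Fintype V] (G : SimpleGraph V) : Multigraph V where
  edges := G.edgeSet.toFinset.val
  loopless := by
    intro e he
    have he' : e ∈ G.edgeSet := by simpa using he
    exact G.not_isDiag_of_mem_edgeSet he'

/-- Isomorphism of multigraphs. -/
def MIso {A B : Type} (G : Multigraph A) (H : Multigraph B) : Prop :=
  ∃ φ : A ≃ B, H.edges = G.edges.map (Sym2.map φ)

end Multigraph

/-- Vertices of the Petersen graph: the 2-element subsets of a 5-element set. -/
abbrev PetersenVert : Type := {s : Finset (Fin 5) // s.card = 2}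

/-- The Petersen graph (as the Kneser graph on 2-subsets of a 5-set). -/
def petersenSimple : SimpleGraph PetersenVert :=
  SimpleGraph.fromRel fun a b => Disjoint a.1 b.1

noncomputable def petersen : Multigraph PetersenVert :=
  Multigraph.ofSimple petersenSimple

/-- The graph `P₁₄`: obtained from the Petersen graph (outer cycle `0 1 2 3 4`, spokes
`i — i+5`, inner cycle `5 7 9 6 8 5`) by replacing the vertex `9` (whose neighbours were
`4`, `7`, `6`) by a copy of `K_{2,3}` with degree-three vertices `9`, `10` and degree-two
vertices `11`, `12`, `13`, joined to `4`, `7`, `6` respectively. -/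
def p14Simple : SimpleGraph (Fin 14) :=
  SimpleGraph.fromRel fun a b =>
    (a, b) ∈ ([(0, 1), (1, 2), (2, 3), (3, 4), (4, 0), (0, 5), (1, 6), (2, 7), (3, 8),
      (5, 7), (6, 8), (8, 5), (9, 11), (9, 12), (9, 13), (10, 11), (10, 12), (10, 13),
      (11, 4), (12, 7), (13, 6)] : List (Fin 14 × Fin 14))

noncomputable def p14 : Multigraph (Fin 14) :=
  Multigraph.ofSimple p14Simple

namespace MG

variable {V : Type}

/-- The edge `e` crosses the cut `B`. -/
def cr (B : Finset V) (e : Sym2 V) : Prop := ∃ a ∈ B, ∃ b, b ∉ B ∧ e = s(a, b)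

theorem cr_mk (B : Finset V) (a b : V) :
    cr B s(a, b) ↔ ((a ∈ B ∧ b ∉ B) ∨ (a ∉ B ∧ b ∈ B)) := by
  unfold cr
  constructor
  · rintro ⟨x, hx, y, hy, h⟩
    rw [Sym2.eq_iff] at h
    grind
  · rintro (⟨h1, h2⟩ | ⟨h1, h2⟩)
    · exact ⟨a, h1, b, h2, rfl⟩
    · exact ⟨b, h2, a, h1, Sym2.eq_swap⟩

/-- Cut-connectivity. -/
def Cn (A : Finset V) (F : Finset (Sym2 V)) : Prop :=
  ∀ B ⊆ A, B.Nonempty → B ≠ A → ∃ e ∈ F, cr B e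

theorem Cn.mono {A : Finset V} {F F' : Finset (Sym2 V)} (h : Cn A F) (hs : F ⊆ F') : Cn A F' := by
  intro B hB hn hne
  obtain ⟨e, he, hc⟩ := h B hB hn hne
  exact ⟨e, hs he, hc⟩

/-- All edges lie within `A`. -/
def Wi (A : Finset V) (F : Finset (Sym2 V)) : Prop := ∀ e ∈ F, ∀ x ∈ e, x ∈ A

/-- `D` is a side of the edge `g` in `T`. -/
def Sd (A : Finset V) (T : Finset (Sym2 V)) (g : Sym2 V) (D : Finset V) : Prop :=
  D ⊆ A ∧ cr D g ∧ ∀ e ∈ T, cr D e → e = g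

/-- Trees. -/
structure Tr (A : Finset V) (T : Finset (Sym2 V)) : Prop where
  wi : Wi A T
  cn : Cn A T
  br : ∀ g ∈ T, ∃ D, Sd A T g D

theorem Sd.compl {A : Finset V} {T : Finset (Sym2 V)} {g : Sym2 V} {D : Finset V}
    (hw : Wi A T) (hg : g ∈ T) (h : Sd A T g D) : Sd A T g (A \ D) := by
  have key : ∀ e ∈ T, (cr (A \ D) e ↔ cr D e) := by
    intro e he
    have := hw e he
    induction e using Sym2.ind with
    | _ a b =>
      have ha := this a (by simp)
      have hb := this b (by simp)
      rw [cr_mk, cr_mk]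
      simp only [Finset.mem_sdiff]
      tauto
  refine ⟨Finset.sdiff_subset, (key g hg).2 h.2.1, fun e he hc => h.2.2 e he ((key e he).1 hc)⟩

theorem Tr.side {A : Finset V} {T : Finset (Sym2 V)} (h : Tr A T) {g : Sym2 V} (hg : g ∈ T)
    (r : V) : ∃ D, Sd A T g D ∧ r ∉ D := by
  obtain ⟨D, hD⟩ := h.br g hg
  by_cases hr : r ∈ D
  · exact ⟨A \ D, hD.compl h.wi hg, by simp [hr]⟩
  · exact ⟨D, hD, hr⟩

/-- An uncrossed set avoiding a vertex of `A` is empty. -/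
theorem Tr.empty_of {A : Finset V} {T : Finset (Sym2 V)} (h : Tr A T) {B : Finset V} (hB : B ⊆ A)
    {r : V} (hr : r ∈ A) (hrB : r ∉ B) (hc : ∀ e ∈ T, ¬ cr B e) : B = ∅ := by
  by_contra hne
  obtain ⟨e, he, hce⟩ := h.cn B hB (Finset.nonempty_iff_ne_empty.2 hne) (by rintro rfl; exact hrB hr)
  exact hc e he hce

theorem cr_inter {B C : Finset V} {e : Sym2 V} (h : cr (B ∩ C) e) : cr B e ∨ cr C e := by
  induction e using Sym2.ind with
  | _ a b => simp only [cr_mk, Finset.mem_inter] at *; tauto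

theorem cr_sdiff {B C : Finset V} {e : Sym2 V} (h : cr (B \ C) e) : cr B e ∨ cr C e := by
  induction e using Sym2.ind with
  | _ a b => simp only [cr_mk, Finset.mem_sdiff] at *; tauto

theorem cr_symm {B C : Finset V} {e : Sym2 V} :
    cr (symmDiff B C) e ↔ ((cr B e ∧ ¬ cr C e) ∨ (¬ cr B e ∧ cr C e)) := by
  induction e using Sym2.ind with
  | _ a b =>
    simp only [cr_mk, Finset.mem_symmDiff]
    by_cases h1 : a ∈ B <;> by_cases h2 : b ∈ B <;> by_cases h3 : a ∈ C <;> by_cases h4 : b ∈ C <;>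
      simp [h1, h2, h3, h4]

theorem cr_aux1 {B C : Finset V} {e : Sym2 V} (h : cr B e) (h' : ¬ cr C e) :
    (cr (B ∩ C) e ∧ ¬ cr (B ∪ C) e ∧ ¬ cr (B \ C) e ∧ cr (C \ B) e) ∨
    (¬ cr (B ∩ C) e ∧ cr (B ∪ C) e ∧ cr (B \ C) e ∧ ¬ cr (C \ B) e) := by
  induction e using Sym2.ind with
  | _ a b =>
    simp only [cr_mk, Finset.mem_inter, Finset.mem_union, Finset.mem_sdiff] at *
    by_cases h1 : a ∈ B <;> by_cases h2 : b ∈ B <;> by_cases h3 : a ∈ C <;> by_cases h4 : b ∈ C <;>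
      simp_all

theorem cr_union {B C : Finset V} {e : Sym2 V} (h : cr (B ∪ C) e) : cr B e ∨ cr C e := by
  induction e using Sym2.ind with
  | _ a b => simp only [cr_mk, Finset.mem_union] at *; tauto

theorem symmDiff_sub {A B C : Finset V} (h1 : B ⊆ A) (h2 : C ⊆ A) : symmDiff B C ⊆ A := by
  intro x hx
  rw [Finset.mem_symmDiff] at hx
  rcases hx with hx | hx
  · exact h1 hx.1
  · exact h2 hx.1

/-- uniqueness of rooted sides -/
theorem Sd.unique {A : Finset V} {T : Finset (Sym2 V)} (h : Tr A T) {g : Sym2 V}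
    {D D' : Finset V} (h1 : Sd A T g D) (h2 : Sd A T g D') {r : V} (hr : r ∈ A)
    (hD : r ∉ D) (hD' : r ∉ D') : D = D' := by
  have : symmDiff D D' = ∅ := by
    apply h.empty_of (r := r) (symmDiff_sub h1.1 h2.1) hr
    · simp [Finset.mem_symmDiff, hD, hD']
    · intro e he hc
      rw [cr_symm] at hc
      rcases hc with ⟨c1, c2⟩ | ⟨c1, c2⟩
      · rw [h1.2.2 e he c1] at c2
        exact c2 h2.2.1
      · rw [h2.2.2 e he c2] at c1
        exact c1 h1.2.1
  exact symmDiff_eq_bot.1 this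

/-- laminarity -/
theorem Sd.laminar {A : Finset V} {T : Finset (Sym2 V)} (h : Tr A T) {e f : Sym2 V}
    {D D' : Finset V} (h1 : Sd A T e D) (h2 : Sd A T f D') (he : e ∈ T) (hf : f ∈ T)
    (hne : e ≠ f) {r : V} (hr : r ∈ A)
    (hD : r ∉ D) (hD' : r ∉ D') : D ⊆ D' ∨ D' ⊆ D ∨ D ∩ D' = ∅ := by
  have e1 : ¬ cr D' e := fun hc => hne (h2.2.2 e he hc)
  have f1 : ¬ cr D f := fun hc => hne (h1.2.2 f hf hc).symm
  have ec := cr_aux1 h1.2.1 e1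
  have fc := cr_aux1 h2.2.1 f1
  have gen : ∀ X : Finset V, X ⊆ A → r ∉ X → (∀ x, cr X x → cr D x ∨ cr D' x) → ¬ cr X e →
      ¬ cr X f → X = ∅ := by
    intro X hX hrX hor hXe hXf
    apply h.empty_of (r := r) hX hr hrX
    intro x hx hc
    rcases hor x hc with k | k
    · rw [h1.2.2 x hx k] at hc; exact hXe hc
    · rw [h2.2.2 x hx k] at hc; exact hXf hc
  rw [Finset.inter_comm D' D, Finset.union_comm D' D] at fc
  rcases ec with ⟨a1, a2, a3, a4⟩ | ⟨a1, a2, a3, a4⟩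
  · rcases fc with ⟨b1, b2, b3, b4⟩ | ⟨b1, b2, b3, b4⟩
    · exfalso
      have := gen (D ∪ D') (Finset.union_subset h1.1 h2.1) (by simp [hD, hD'])
        (fun x hx => cr_union hx) a2 b2
      obtain ⟨t, ht, _⟩ := h1.2.1
      have : t ∈ D ∪ D' := by simp [ht]
      simp_all
    · left
      rw [← Finset.sdiff_eq_empty_iff_subset]
      exact gen (D \ D') (Finset.sdiff_subset.trans h1.1) (by simp [hD])
        (fun x hx => cr_sdiff hx) a3 b4
  · rcases fc with ⟨b1, b2, b3, b4⟩ | ⟨b1, b2, b3, b4⟩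
    · right; left
      rw [← Finset.sdiff_eq_empty_iff_subset]
      exact gen (D' \ D) (Finset.sdiff_subset.trans h2.1) (by simp [hD'])
        (fun x hx => (cr_sdiff hx).symm) a4 b3
    · right; right
      exact gen (D ∩ D') (Finset.inter_subset_left.trans h1.1) (by simp [hD])
        (fun x hx => cr_inter hx) a1 b1

theorem Tr.exchange {A : Finset V} {T : Finset (Sym2 V)} (h : Tr A T) {g f : Sym2 V} {D : Finset V}
    (hg : g ∈ T) (hD : Sd A T g D) (hfA : ∀ x ∈ f, x ∈ A) (hf : cr D f) :
    Tr A (insert f (T.erase g)) := by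
  refine ⟨?_, ?_, ?_⟩
  · intro e he
    rw [Finset.mem_insert, Finset.mem_erase] at he
    rcases he with rfl | ⟨_, he⟩
    · exact hfA
    · exact h.wi e he
  · intro B hB hn hne
    by_contra hcon
    push Not at hcon
    have hgB : ∀ e ∈ T, cr B e → e = g := by
      intro e he hc
      by_contra hne
      exact hcon e (by simp [he, hne]) hc
    obtain ⟨e, he, hc⟩ := h.cn B hB hn hne
    have := hgB e he hc
    subst this
    have hS : Sd A T e B := ⟨hB, hc, hgB⟩
    have hfB : ¬ cr B f := hcon f (by simp)
    obtain ⟨r, hr, hrB⟩ : ∃ r ∈ A, r ∉ B := by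
      by_contra hx
      push Not at hx
      exact hne (Finset.Subset.antisymm hB hx)
    by_cases hrD : r ∈ D
    · have := Sd.unique h hS (hD.compl h.wi he) hr hrB (by simp [hrD])
      subst this
      induction f using Sym2.ind with
      | _ a b =>
        have ha := hfA a (by simp)
        have hb := hfA b (by simp)
        simp only [cr_mk, Finset.mem_sdiff] at *
        tauto
    · have := Sd.unique h hS hD hr hrB hrD
      subst this
      exact hfB hf
  · intro e he
    rw [Finset.mem_insert, Finset.mem_erase] at he
    by_cases hef : e = f
    · subst hef
      refine ⟨D, hD.1, hf, ?_⟩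
      intro x hx hc
      rw [Finset.mem_insert, Finset.mem_erase] at hx
      rcases hx with rfl | ⟨hx1, hx⟩
      · rfl
      · exact absurd (hD.2.2 x hx hc) hx1
    · have ⟨heg, heT⟩ : e ≠ g ∧ e ∈ T := by tauto
      obtain ⟨C, hC⟩ := h.br e heT
      by_cases hfC : cr C f
      · refine ⟨symmDiff C D, symmDiff_sub hC.1 hD.1, ?_, ?_⟩
        · rw [cr_symm]
          exact Or.inl ⟨hC.2.1, fun hc => heg (hD.2.2 e heT hc)⟩
        · intro x hx hc
          rw [Finset.mem_insert, Finset.mem_erase] at hx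
          rw [cr_symm] at hc
          rcases hx with rfl | ⟨hx1, hx⟩
          · tauto
          · rcases hc with ⟨c1, c2⟩ | ⟨c1, c2⟩
            · exact hC.2.2 x hx c1
            · exact absurd (hD.2.2 x hx c2) hx1
      · refine ⟨C, hC.1, hC.2.1, ?_⟩
        intro x hx hc
        rw [Finset.mem_insert, Finset.mem_erase] at hx
        rcases hx with rfl | ⟨hx1, hx⟩
        · exact absurd hc hfC
        · exact hC.2.2 x hx hc

theorem Tr.addLeaf {A : Finset V} {T : Finset (Sym2 V)} (h : Tr A T) {u c : V} (hu : u ∉ A)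
    (hc : c ∈ A) : Tr (insert u A) (insert s(u, c) T) := by
  have huc : u ≠ c := by rintro rfl; exact hu hc
  have hT : ∀ e ∈ T, ¬ u ∈ e := fun e he hue => hu (h.wi e he u hue)
  refine ⟨?_, ?_, ?_⟩
  · intro e he x hx
    rw [Finset.mem_insert] at he
    rcases he with rfl | he
    · simp only [Sym2.mem_iff] at hx
      rcases hx with rfl | rfl <;> simp [hc]
    · exact Finset.mem_insert_of_mem (h.wi e he x hx)
  · intro B hB hn hne
    by_cases hcr : cr B s(u, c)
    · exact ⟨_, by simp, hcr⟩
    · have hiff : u ∈ B ↔ c ∈ B := by rw [cr_mk] at hcr; tauto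
      have hB' : B.erase u ⊆ A := by
        intro x hx
        rw [Finset.mem_erase] at hx
        have := hB hx.2
        rw [Finset.mem_insert] at this
        tauto
      have hn' : (B.erase u).Nonempty := by
        by_cases hub : u ∈ B
        · exact ⟨c, by simp [hiff.1 hub, huc.symm]⟩
        · rwa [Finset.erase_eq_of_notMem hub]
      have hne' : B.erase u ≠ A := by
        intro hh
        have hcB : c ∈ B := by
          have : c ∈ B.erase u := by rw [hh]; exact hc
          exact (Finset.mem_erase.1 this).2
        apply hne
        rw [← hh, Finset.insert_erase (hiff.2 hcB)]
      obtain ⟨e, he, hce⟩ := h.cn _ hB' hn' hne'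
      refine ⟨e, by simp [he], ?_⟩
      have := hT e he
      clear he
      induction e using Sym2.ind with
      | _ a b =>
        simp only [cr_mk, Finset.mem_erase, Sym2.mem_iff] at *
        grind
  · intro g hg
    rw [Finset.mem_insert] at hg
    rcases hg with rfl | hg
    · refine ⟨{u}, by simp, ?_, ?_⟩
      · rw [cr_mk]; simp [huc.symm]
      · intro e he hce
        rw [Finset.mem_insert] at he
        rcases he with he | he
        · exact he
        · exfalso
          have := hT e he
          clear he
          induction e using Sym2.ind with
          | _ a b =>
            simp only [cr_mk, Finset.mem_singleton, Sym2.mem_iff] at *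
            grind
    · obtain ⟨D, hD, hcD⟩ := h.side hg c
      refine ⟨D, hD.1.trans (Finset.subset_insert _ _), hD.2.1, ?_⟩
      intro e he hce
      rw [Finset.mem_insert] at he
      rcases he with rfl | he
      · exfalso
        rw [cr_mk] at hce
        have : u ∉ D := fun hh => hu (hD.1 hh)
        tauto
      · exact hD.2.2 e he hce

/-- restriction to a set -/
noncomputable def res (A : Finset V) (T : Finset (Sym2 V)) : Finset (Sym2 V) :=
  T.filter fun e => ∀ x ∈ e, x ∈ A

theorem mem_res {A : Finset V} {T : Finset (Sym2 V)} {e : Sym2 V} :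
    e ∈ res A T ↔ e ∈ T ∧ ∀ x ∈ e, x ∈ A := by simp [res]

theorem res_br {A C : Finset V} {T : Finset (Sym2 V)} (h : Tr A T) :
    ∀ g ∈ res C T, ∃ D, Sd C (res C T) g D := by
  intro g hg
  have hgT := (mem_res.1 hg).1
  obtain ⟨D, hD⟩ := h.br g hgT
  have key : ∀ e ∈ res C T, (cr (D ∩ C) e ↔ cr D e) := by
    intro e he
    have := (mem_res.1 he).2
    clear he
    induction e using Sym2.ind with
    | _ a b =>
      have ha := this a (by simp)
      have hb := this b (by simp)
      simp only [cr_mk, Finset.mem_inter]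
      tauto
  exact ⟨D ∩ C, Finset.inter_subset_right, (key g hg).2 hD.2.1, fun e he hc =>
    hD.2.2 e (mem_res.1 he).1 ((key e he).1 hc)⟩

theorem Tr.ofRes {A C : Finset V} {T : Finset (Sym2 V)} (h : Tr A T) (hc : Cn C (res C T)) :
    Tr C (res C T) :=
  ⟨fun e he => (mem_res.1 he).2, hc, res_br h⟩

/-- connectivity can be checked on cuts avoiding a root -/
theorem Cn.ofRoot {C : Finset V} {T : Finset (Sym2 V)} (hw : Wi C T) (r : V)
    (h : ∀ B ⊆ C, B.Nonempty → B ≠ C → r ∉ B → ∃ e ∈ T, cr B e) : Cn C T := by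
  intro B hB hn hne
  by_cases hr : r ∈ B
  · obtain ⟨x, hx, hxB⟩ : ∃ r ∈ C, r ∉ B := by
      by_contra hx
      push Not at hx
      exact hne (Finset.Subset.antisymm hB hx)
    obtain ⟨y, hy⟩ := hn
    obtain ⟨e, he, hce⟩ := h (C \ B) Finset.sdiff_subset ⟨x, by simp [hx, hxB]⟩
      (by intro hh; have : y ∈ C \ B := by rw [hh]; exact hB hy
          simp [hy] at this) (by simp [hr])
    refine ⟨e, he, ?_⟩
    have := hw e he
    clear he
    induction e using Sym2.ind with
    | _ a b =>
      have ha := this a (by simp)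
      have hb := this b (by simp)
      simp only [cr_mk, Finset.mem_sdiff] at *
      tauto
  · exact h B hB hn hne hr

theorem Tr.sideTree {A D : Finset V} {T : Finset (Sym2 V)} (h : Tr A T) {g : Sym2 V}
    (hD : Sd A T g D) : Tr D (res D T) := by
  apply h.ofRes
  -- endpoint of g in D
  obtain ⟨t, ht, t', ht', rfl⟩ := hD.2.1
  apply Cn.ofRoot (fun e he => (mem_res.1 he).2) t
  intro B hB hn hne htB
  obtain ⟨e, he, hce⟩ := h.cn B (hB.trans hD.1) hn (by
    rintro rfl
    exact htB (hD.1 ht))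
  refine ⟨e, mem_res.2 ⟨he, ?_⟩, hce⟩
  have hne : ¬ cr D e := by
    intro hc
    have := hD.2.2 e he hc
    subst this
    rw [cr_mk] at hce
    have : t' ∉ B := fun hh => ht' (hB hh)
    tauto
  clear he
  induction e using Sym2.ind with
  | _ a b =>
    simp only [cr_mk, Sym2.mem_iff] at *
    have h1 : a ∈ B → a ∈ D := fun k => hB k
    have h2 : b ∈ B → b ∈ D := fun k => hB k
    rintro x (rfl | rfl) <;> tauto

end MG
namespace MG

variable {V : Type}

theorem cr.nd {B : Finset V} {e : Sym2 V} (h : cr B e) : ¬ e.IsDiag := by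
  obtain ⟨a, ha, b, hb, rfl⟩ := h
  rw [Sym2.mk_isDiag_iff]
  rintro rfl
  exact hb ha

/-- no loops -/
def Nd (F : Finset (Sym2 V)) : Prop := ∀ e ∈ F, ¬ e.IsDiag

theorem Tr.nd {A : Finset V} {T : Finset (Sym2 V)} (h : Tr A T) : Nd T := by
  intro e he
  obtain ⟨D, hD⟩ := h.br e he
  exact hD.2.1.nd

/-- degree parity -/
noncomputable def dg (J : Finset (Sym2 V)) (x : V) : ZMod 2 := ∑ e ∈ J, if x ∈ e then 1 else 0

/-- indicator of a vertex -/
noncomputable def dl (x : V) : V → ZMod 2 := fun y => if y = x then 1 else 0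

theorem sum_dl (B : Finset V) (x : V) : ∑ y ∈ B, dl x y = if x ∈ B then 1 else 0 := by
  simp [dl]

theorem z2 (a : ZMod 2) : a + a = 0 := CharTwo.add_self_eq_zero a

theorem z2or (a : ZMod 2) : a = 0 ∨ a = 1 := by
  revert a; decide

theorem sum_symm {α : Type} [DecidableEq α] (J K : Finset α) (f : α → ZMod 2) :
    ∑ e ∈ symmDiff J K, f e = ∑ e ∈ J, f e + ∑ e ∈ K, f e := by
  have h1 : ∑ e ∈ J, f e = ∑ e ∈ J \ K, f e + ∑ e ∈ J ∩ K, f e := by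
    rw [add_comm, Finset.sum_inter_add_sum_sdiff]
  have h2 : ∑ e ∈ K, f e = ∑ e ∈ K \ J, f e + ∑ e ∈ J ∩ K, f e := by
    rw [add_comm, Finset.inter_comm, Finset.sum_inter_add_sum_sdiff]
  have h3 : ∑ e ∈ symmDiff J K, f e = ∑ e ∈ J \ K, f e + ∑ e ∈ K \ J, f e := by
    rw [← Finset.sum_union]
    · rfl
    · rw [Finset.disjoint_left]
      intro a ha hb
      simp only [Finset.mem_sdiff] at *
      tauto
  rw [h1, h2, h3]
  have := z2 (∑ e ∈ J ∩ K, f e)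
  linear_combination -this

theorem dg_symm (J K : Finset (Sym2 V)) (x : V) : dg (symmDiff J K) x = dg J x + dg K x :=
  sum_symm J K _

theorem dg_empty (x : V) : dg (∅ : Finset (Sym2 V)) x = 0 := by simp [dg]

theorem dg_mk {a b : V} (h : a ≠ b) (x : V) : dg {s(a, b)} x = dl a x + dl b x := by
  simp only [dg, dl, Finset.sum_singleton, Sym2.mem_iff]
  by_cases h1 : x = a
  · subst h1; simp [h]
  · simp [h1]

theorem dg_insert {J : Finset (Sym2 V)} {e : Sym2 V} (h : e ∉ J) (x : V) :
    dg (insert e J) x = dg {e} x + dg J x := by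
  simp only [dg, Finset.sum_insert h, Finset.sum_singleton]

theorem dg_union {J K : Finset (Sym2 V)} (h : Disjoint J K) (x : V) :
    dg (J ∪ K) x = dg J x + dg K x := by
  simp only [dg, Finset.sum_union h]

theorem hs1 (B : Finset V) {e : Sym2 V} (he : ¬ e.IsDiag) :
    ∑ x ∈ B, (if x ∈ e then (1 : ZMod 2) else 0) = if cr B e then 1 else 0 := by
  induction e using Sym2.ind with
  | _ a b =>
    rw [Sym2.mk_isDiag_iff] at he
    have : ∀ x, (if x ∈ s(a, b) then (1 : ZMod 2) else 0) = dl a x + dl b x := by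
      intro x
      simp only [dl, Sym2.mem_iff]
      by_cases h1 : x = a
      · subst h1; simp [he]
      · simp [h1]
    simp only [this, Finset.sum_add_distrib, sum_dl, cr_mk]
    by_cases h1 : a ∈ B <;> by_cases h2 : b ∈ B <;> simp [h1, h2, z2]

theorem dg_sum {J : Finset (Sym2 V)} (hJ : Nd J) (B : Finset V) :
    ∑ x ∈ B, dg J x = ∑ e ∈ J, if cr B e then 1 else 0 := by
  unfold dg
  rw [Finset.sum_comm]
  exact Finset.sum_congr rfl fun e he => hs1 B (hJ e he)

theorem symm_sub {α : Type} [DecidableEq α] {J K F : Finset α} (h1 : J ⊆ F) (h2 : K ⊆ F) : symmDiff J K ⊆ F := by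
  intro x hx
  rw [Finset.mem_symmDiff] at hx
  rcases hx with hx | hx
  · exact h1 hx.1
  · exact h2 hx.1

theorem exists_path {A : Finset V} {F : Finset (Sym2 V)} (hw : Wi A F) (hc : Cn A F)
    {x r : V} (hx : x ∈ A) (hr : r ∈ A) : ∃ J ⊆ F, ∀ y, dg J y = dl x y + dl r y := by
  set P := A.filter (fun y => ∃ J ⊆ F, ∀ t, dg J t = dl y t + dl r t) with hP
  have hrP : r ∈ P := by
    rw [hP, Finset.mem_filter]
    exact ⟨hr, ∅, by simp, fun t => by rw [dg_empty, z2]⟩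
  by_cases hPA : P = A
  · rw [← hPA, hP, Finset.mem_filter] at hx
    exact hx.2
  · exfalso
    obtain ⟨e, he, hce⟩ := hc P (Finset.filter_subset _ _) ⟨r, hrP⟩ hPA
    obtain ⟨a, ha, b, hb, rfl⟩ := hce
    have hab : a ≠ b := by rintro rfl; exact hb ha
    apply hb
    rw [hP, Finset.mem_filter] at ha ⊢
    obtain ⟨_, J, hJ, hJd⟩ := ha
    refine ⟨hw _ he b (by simp), symmDiff J {s(a, b)}, symm_sub hJ (by simpa using he), ?_⟩
    intro t
    rw [dg_symm, hJd, dg_mk hab]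
    have := z2 (dl a t)
    linear_combination this

theorem exists_join {A : Finset V} {F : Finset (Sym2 V)} (hw : Wi A F) (hc : Cn A F)
    (ω : V → ZMod 2) (h0 : ∑ x ∈ A, ω x = 0) : ∃ J ⊆ F, ∀ x ∈ A, dg J x = ω x := by
  rcases A.eq_empty_or_nonempty with rfl | ⟨r, hr⟩
  · exact ⟨∅, by simp, by simp⟩
  have key : ∀ B : Finset V, B ⊆ A → ∃ J ⊆ F, ∀ y, dg J y =
      (if y ∈ B then ω y else 0) + (∑ x ∈ B, ω x) * dl r y := by
    intro B
    induction B using Finset.induction_on with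
    | empty => intro _; exact ⟨∅, by simp, fun y => by simp [dg_empty]⟩
    | insert a B ha ih =>
      intro hB
      obtain ⟨J, hJ, hJd⟩ := ih (fun x hx => hB (by simp [hx]))
      obtain ⟨K, hK, hKd⟩ := exists_path hw hc (hB (Finset.mem_insert_self a B)) hr
      rcases z2or (ω a) with h | h
      · refine ⟨J, hJ, fun y => ?_⟩
        rw [hJd, Finset.sum_insert ha, h, zero_add]
        congr 1
        by_cases hy : y = a
        · subst hy; simp [ha, h]
        · simp [hy]
      · refine ⟨symmDiff J K, symm_sub hJ hK, fun y => ?_⟩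
        rw [dg_symm, hJd, hKd, Finset.sum_insert ha, h]
        by_cases hy : y = a
        · subst hy; simp [ha, h, dl]; split_ifs <;> ring
        · simp [hy, dl]; split_ifs <;> ring
  obtain ⟨J, hJ, hJd⟩ := key A (Finset.Subset.refl _)
  refine ⟨J, hJ, fun x hx => ?_⟩
  rw [hJd, h0]
  simp [hx]

theorem Tr.join {A : Finset V} {T : Finset (Sym2 V)} (h : Tr A T) (ω : V → ZMod 2)
    (h0 : ∑ x ∈ A, ω x = 0) : ∃ J ⊆ T, ∀ x ∈ A, dg J x = ω x :=
  exists_join h.wi h.cn ω h0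

theorem join_side {A : Finset V} {T J : Finset (Sym2 V)} (h : Tr A T) {g : Sym2 V} {D : Finset V}
    (hD : Sd A T g D) (hJ : J ⊆ T) {ω : V → ZMod 2} (hω : ∀ x ∈ A, dg J x = ω x) :
    ∑ x ∈ D, ω x = if g ∈ J then 1 else 0 := by
  rw [← Finset.sum_congr rfl (fun x hx => hω x (hD.1 hx)), dg_sum (fun e he => h.nd e (hJ he))]
  have : ∀ e ∈ J, (if cr D e then (1 : ZMod 2) else 0) = if e = g then 1 else 0 := by
    intro e he
    by_cases hc : e = g
    · subst hc; simp [hD.2.1]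
    · have : ¬ cr D e := fun k => hc (hD.2.2 e (hJ he) k)
      simp [hc, this]
  rw [Finset.sum_congr rfl this]
  simp

theorem Tr.path {A P : Finset V} {T : Finset (Sym2 V)} (h : Tr A T) {x r : V} (hx : x ∈ A)
    (hr : r ∈ A) (hxP : x ∈ P) (hrP : r ∉ P) :
    ∃ g ∈ T, cr P g ∧ ∃ S, Sd A T g S ∧ x ∈ S ∧ r ∉ S := by
  obtain ⟨J, hJ, hJd⟩ := exists_path h.wi h.cn hx hr
  have h1 := dg_sum (fun e he => h.nd e (hJ he)) P
  simp only [hJd, Finset.sum_add_distrib, sum_dl, hxP, hrP, if_true, if_false, add_zero] at h1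
  have : ∃ g ∈ J, cr P g := by
    by_contra hcon
    push Not at hcon
    rw [Finset.sum_eq_zero] at h1
    · exact one_ne_zero h1
    · intro e he; simp [hcon e he]
  obtain ⟨g, hg, hcg⟩ := this
  obtain ⟨S, hS, hrS⟩ := h.side (hJ hg) r
  refine ⟨g, hJ hg, hcg, S, hS, ?_, hrS⟩
  have h2 := join_side h hS hJ (ω := fun y => dl x y + dl r y) (fun y _ => hJd y)
  simp only [Finset.sum_add_distrib, sum_dl, hrS, hg, if_true, if_false, add_zero] at h2
  by_contra hxS
  simp [hxS] at h2

theorem Tr.firstExit {A B : Finset V} {T : Finset (Sym2 V)} (h : Tr A T) {x r : V} (hx : x ∈ A)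
    (hr : r ∈ A) (hxB : x ∈ B) (hrB : r ∉ B) :
    ∃ p q, s(p, q) ∈ T ∧ p ∈ A ∧ q ∈ A ∧ p ∈ B ∧ q ∉ B ∧ ∃ S, Sd A T s(p, q) S ∧ x ∈ S ∧ p ∈ S ∧
      r ∉ S ∧ q ∉ S ∧ ∀ e ∈ T, ∀ D, Sd A T e D → ¬ (x ∈ D ↔ p ∈ D) → ∀ y ∈ e, y ∈ B := by
  set P := A.filter (fun y => y ∈ B ∧ ∀ e ∈ T, ∀ D, Sd A T e D → ¬ (x ∈ D ↔ y ∈ D) →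
    ∀ y ∈ e, y ∈ B) with hP
  have hxP : x ∈ P := by
    rw [hP, Finset.mem_filter]
    exact ⟨hx, hxB, fun e he D hD hn => absurd Iff.rfl hn⟩
  have hrP : r ∉ P := by
    rw [hP, Finset.mem_filter]
    tauto
  obtain ⟨g, hg, hcg, S, hS, hxS, hrS⟩ := h.path hx hr hxP hrP
  obtain ⟨p, hp, q, hq, rfl⟩ := hcg
  have hpA := h.wi _ hg p (by simp)
  have hqA := h.wi _ hg q (by simp)
  rw [hP, Finset.mem_filter] at hp hq
  obtain ⟨_, hpB, hpe⟩ := hp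
  have hqB : q ∉ B := by
    intro hqB
    apply hq
    refine ⟨hqA, hqB, ?_⟩
    intro e he D hD hn
    by_cases heg : s(p, q) = e
    · subst heg
      intro y hy
      rw [Sym2.mem_iff] at hy
      rcases hy with rfl | rfl <;> assumption
    · apply hpe e he D hD
      have : ¬ cr D s(p, q) := fun hc => heg (hD.2.2 _ hg hc)
      rw [cr_mk] at this
      tauto
  have hpS : p ∈ S := by
    by_contra hpS
    exact hqB (hpe _ hg S hS (by tauto) q (by simp))
  have hqS : q ∉ S := by
    have := hS.2.1
    rw [cr_mk] at this
    tauto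
  exact ⟨p, q, hg, hpA, hqA, hpB, hqB, S, hS, hxS, hpS, hrS, hqS, hpe⟩

/-- collapsibility, in terms of complements -/
def Coll (A : Finset V) (F : Finset (Sym2 V)) : Prop :=
  ∀ ω : V → ZMod 2, ∑ x ∈ A, ω x = 0 → ∃ J ⊆ F, (∀ x ∈ A, dg J x = ω x) ∧ Cn A (F \ J)

/-- reducedness -/
def Red (E : Finset (Sym2 V)) : Prop :=
  ∀ A F, F ⊆ E → Wi A F → 2 ≤ A.card → ¬ Coll A F

theorem two_trees {E : Finset (Sym2 V)} (hE : Red E) {B : Finset V} {T₁ T₂ : Finset (Sym2 V)}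
    (h1 : Tr B T₁) (h2 : Tr B T₂) (hd : Disjoint T₁ T₂) (hs1 : T₁ ⊆ E) (hs2 : T₂ ⊆ E)
    (hB : 2 ≤ B.card) : False := by
  apply hE B (T₁ ∪ T₂) (Finset.union_subset hs1 hs2) _ hB
  · intro ω hω
    obtain ⟨J, hJ, hJd⟩ := h1.join ω hω
    refine ⟨J, hJ.trans Finset.subset_union_left, hJd, h2.cn.mono ?_⟩
    intro e he
    rw [Finset.mem_sdiff, Finset.mem_union]
    exact ⟨Or.inr he, fun hh => (Finset.disjoint_left.1 hd) (hJ hh) he⟩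
  · intro e he
    rw [Finset.mem_union] at he
    rcases he with he | he
    · exact h1.wi e he
    · exact h2.wi e he

end MG
namespace MG

variable {V : Type}

theorem max_card {A : Finset V} (P : Finset V → Prop) (h : ∃ C, P C) (hb : ∀ C, P C → C ⊆ A) :
    ∃ C, P C ∧ ∀ C', P C' → C'.card ≤ C.card := by
  obtain ⟨C₀, hC₀⟩ := h
  obtain ⟨C, hC, hmax⟩ := Finset.exists_max_image (A.powerset.filter P) Finset.card
    ⟨C₀, by simp [hb C₀ hC₀, hC₀]⟩
  rw [Finset.mem_filter] at hC
  exact ⟨C, hC.2, fun C' hC' => hmax C' (by simp [hb C' hC', hC'])⟩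

theorem dg_zero {J : Finset (Sym2 V)} {x : V} (h : ∀ e ∈ J, x ∉ e) : dg J x = 0 := by
  unfold dg
  exact Finset.sum_eq_zero fun e he => by simp [h e he]

/-- a decomposition of an edge set into two trees -/
structure Dec (A₁ A₂ : Finset V) (Hs T₁ T₂ : Finset (Sym2 V)) : Prop where
  t1 : Tr A₁ T₁
  t2 : Tr A₂ T₂
  dj : Disjoint T₁ T₂
  un : T₁ ∪ T₂ = Hs

theorem Dec.symm {A₁ A₂ : Finset V} {Hs T₁ T₂ : Finset (Sym2 V)} (h : Dec A₁ A₂ Hs T₁ T₂) :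
    Dec A₂ A₁ Hs T₂ T₁ := ⟨h.t2, h.t1, h.dj.symm, by rw [Finset.union_comm]; exact h.un⟩

theorem Dec.sub1 {A₁ A₂ : Finset V} {Hs T₁ T₂ : Finset (Sym2 V)} (h : Dec A₁ A₂ Hs T₁ T₂) :
    T₁ ⊆ Hs := by rw [← h.un]; exact Finset.subset_union_left

theorem Dec.sub2 {A₁ A₂ : Finset V} {Hs T₁ T₂ : Finset (Sym2 V)} (h : Dec A₁ A₂ Hs T₁ T₂) :
    T₂ ⊆ Hs := by rw [← h.un]; exact Finset.subset_union_right

theorem Dec.swap {A₁ A₂ : Finset V} {Hs T₁ T₂ : Finset (Sym2 V)} (H : Dec A₁ A₂ Hs T₁ T₂)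
    {h g : Sym2 V} {S D : Finset V} (hh : h ∈ T₁) (hS : Sd A₁ T₁ h S) (hg : g ∈ T₂)
    (hD : Sd A₂ T₂ g D) (hSg : cr S g) (hDh : cr D h) (hgw : ∀ x ∈ g, x ∈ A₁)
    (hhw : ∀ x ∈ h, x ∈ A₂) :
    Dec A₁ A₂ Hs (insert g (T₁.erase h)) (insert h (T₂.erase g)) := by
  have hdj := Finset.disjoint_left.1 H.dj
  refine ⟨H.t1.exchange hh hS hgw hSg, H.t2.exchange hg hD hhw hDh, ?_, ?_⟩
  · rw [Finset.disjoint_left]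
    intro e he he'
    simp only [Finset.mem_insert, Finset.mem_erase] at he he'
    have := @hdj e
    grind
  · rw [← H.un]
    ext e
    simp only [Finset.mem_insert, Finset.mem_erase, Finset.mem_union]
    grind

theorem Sd.exch_no {A : Finset V} {T : Finset (Sym2 V)} {e h f : Sym2 V} {C : Finset V}
    (hC : Sd A T e C) (hf : ¬ cr C f) : Sd A (insert f (T.erase h)) e C := by
  refine ⟨hC.1, hC.2.1, ?_⟩
  intro x hx hc
  rw [Finset.mem_insert, Finset.mem_erase] at hx
  rcases hx with rfl | hx
  · exact absurd hc hf
  · exact hC.2.2 x hx.2 hc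

theorem Sd.exch_yes {A : Finset V} {T : Finset (Sym2 V)} {e h f : Sym2 V} {C D : Finset V}
    (hC : Sd A T e C) (he : e ∈ T) (heh : e ≠ h) (hD : Sd A T h D) (hf : cr C f) (hfD : cr D f) :
    Sd A (insert f (T.erase h)) e (symmDiff C D) := by
  refine ⟨symmDiff_sub hC.1 hD.1, ?_, ?_⟩
  · rw [cr_symm]
    exact Or.inl ⟨hC.2.1, fun hc => heh (hD.2.2 e he hc)⟩
  · intro x hx hc
    rw [Finset.mem_insert, Finset.mem_erase] at hx
    rw [cr_symm] at hc
    rcases hx with rfl | ⟨hx1, hx⟩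
    · tauto
    · rcases hc with ⟨c1, c2⟩ | ⟨c1, c2⟩
      · exact hC.2.2 x hx c1
      · exact absurd (hD.2.2 x hx c2) hx1

theorem symmDiff_disj {C D : Finset V} (h : C ∩ D = ∅) : symmDiff C D = C ∪ D := by
  ext x
  have : ¬ (x ∈ C ∧ x ∈ D) := by
    rw [← Finset.mem_inter, h]; simp
  simp only [Finset.mem_symmDiff, Finset.mem_union]
  tauto

theorem Sd.mem_root {A : Finset V} {T : Finset (Sym2 V)} {u c : V} {C : Finset V}
    (hC : Sd A T s(u, c) C) (hu : u ∉ C) : c ∈ C := by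
  have := hC.2.1
  rw [cr_mk] at this
  tauto

theorem s_ne {u c c' : V} (h : c ≠ c') : s(u, c) ≠ s(u, c') := by
  intro hh
  rw [Sym2.congr_right] at hh
  exact h hh

theorem root_disj {A : Finset V} {T : Finset (Sym2 V)} (h : Tr A T) {u c c' : V}
    {C C' : Finset V} (hc : s(u, c) ∈ T) (hc' : s(u, c') ∈ T) (hC : Sd A T s(u, c) C)
    (hC' : Sd A T s(u, c') C') (hu : u ∉ C) (hu' : u ∉ C') (hne : c ≠ c') : C ∩ C' = ∅ := by
  have huA : u ∈ A := h.wi _ hc u (by simp)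
  rcases Sd.laminar h hC hC' hc hc' (s_ne hne) huA hu hu' with k | k | k
  · exfalso
    have : c ∈ C' := k (hC.mem_root hu)
    exact s_ne hne (hC'.2.2 _ hc (by rw [cr_mk]; tauto))
  · exfalso
    have : c' ∈ C := k (hC'.mem_root hu')
    exact s_ne hne (hC.2.2 _ hc' (by rw [cr_mk]; tauto)).symm
  · exact k

/-- a side meeting a root side lies in it -/
theorem root_sub {A : Finset V} {T : Finset (Sym2 V)} (h : Tr A T) {u c : V} {e : Sym2 V}
    {C S : Finset V} (hc : s(u, c) ∈ T) (he : e ∈ T) (hC : Sd A T s(u, c) C)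
    (hS : Sd A T e S) (hu : u ∉ C) (hu' : u ∉ S) (hne : e ≠ s(u, c)) (hx : C ∩ S ≠ ∅) :
    S ⊆ C ∧ u ∉ e := by
  have huA : u ∈ A := h.wi _ hc u (by simp)
  have h1 : S ⊆ C := by
    rcases Sd.laminar h hC hS hc he hne.symm huA hu hu' with k | k | k
    · exfalso
      have : c ∈ S := k (hC.mem_root hu)
      exact hne.symm (hS.2.2 _ hc (by rw [cr_mk]; tauto))
    · exact k
    · exact absurd k hx
  refine ⟨h1, ?_⟩
  intro hue
  obtain ⟨t, rfl⟩ := hue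
  have := h1 (hS.mem_root hu')
  exact hne (hC.2.2 _ he (by rw [cr_mk]; tauto))

/-- every non-root vertex lies in a root side -/
theorem Tr.rootSide {M : Finset V} {T : Finset (Sym2 V)} {u : V} (h : Tr (insert u M) T)
    (hu : u ∉ M) {q : V} (hq : q ∈ M) :
    ∃ c ∈ M, s(u, c) ∈ T ∧ ∃ C, Sd (insert u M) T s(u, c) C ∧ u ∉ C ∧ q ∈ C := by
  obtain ⟨g, hg, hcg, C, hC, hqC, huC⟩ := h.path (x := q) (r := u) (P := M) (by simp [hq])
    (by simp) hq hu
  obtain ⟨a, ha, b, hb, rfl⟩ := hcg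
  have := h.wi _ hg b (by simp)
  rw [Finset.mem_insert] at this
  have hbu : b = u := by tauto
  subst hbu
  rw [Sym2.eq_swap] at hg hC
  exact ⟨a, ha, hg, C, hC, huC, hqC⟩

/-- non-separation property -/
def NS (A₁ A₂ : Finset V) (Hs : Finset (Sym2 V)) (u : V) : Prop :=
  ∀ T₁ T₂, Dec A₁ A₂ Hs T₁ T₂ → ∀ c₁ c₂ C₁ C₂ g D, c₁ ≠ c₂ → s(u, c₁) ∈ T₁ → s(u, c₂) ∈ T₁ →
    Sd A₁ T₁ s(u, c₁) C₁ → u ∉ C₁ → Sd A₁ T₁ s(u, c₂) C₂ → u ∉ C₂ → g ∈ T₂ → cr C₁ g → cr C₂ g →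
    Sd A₂ T₂ g D → c₁ ∈ D → c₂ ∈ D

theorem growth {M N : Finset V} {Hs : Finset (Sym2 V)} {u : V} (huM : u ∉ M) (hMN : M ⊆ N)
    (huN : u ∉ N) (hNS : NS (insert u M) N Hs u) {T₁ T₂ : Finset (Sym2 V)}
    (H : Dec (insert u M) N Hs T₁ T₂) {c₁ : V} {C₁ : Finset V} (hc₁ : s(u, c₁) ∈ T₁)
    (hC₁ : Sd (insert u M) T₁ s(u, c₁) C₁) (huC₁ : u ∉ C₁)
    (hmax : ∀ T₁' T₂' C', Dec (insert u M) N Hs T₁' T₂' → s(u, c₁) ∈ T₁' →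
      Sd (insert u M) T₁' s(u, c₁) C' → u ∉ C' → C'.card ≤ C₁.card)
    {p q : V} (hp : p ∈ C₁) (hqM : q ∈ M) (hq : q ∉ C₁) (hg : s(p, q) ∈ T₂) {D : Finset V}
    (hD : Sd N T₂ s(p, q) D) (hqD : q ∈ D) (hpD : p ∉ D) : c₁ ∈ D := by
  by_contra hc₁D
  obtain ⟨c₂, hc₂M, hc₂, C₂, hC₂, huC₂, hqC₂⟩ := H.t1.rootSide huM hqM
  have hne : c₁ ≠ c₂ := by
    rintro rfl
    have := Sd.unique H.t1 hC₁ hC₂ (r := u) (by simp) huC₁ huC₂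
    subst this
    exact hq hqC₂
  have hdis := root_disj H.t1 hc₁ hc₂ hC₁ hC₂ huC₁ huC₂ hne
  have hpC₂ : p ∉ C₂ := by
    intro hh
    have : p ∈ C₁ ∩ C₂ := by simp [hp, hh]
    rw [hdis] at this
    simp at this
  have hcr1 : cr C₁ s(p, q) := by rw [cr_mk]; tauto
  have hcr2 : cr C₂ s(p, q) := by rw [cr_mk]; tauto
  have hc₂D : c₂ ∉ D := fun hh => hc₁D
    (hNS T₁ T₂ H c₂ c₁ C₂ C₁ _ D hne.symm hc₂ hc₁ hC₂ huC₂ hC₁ huC₁ hg hcr2 hcr1 hD hh)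
  have huD : u ∉ D := fun hh => huN (hD.1 hh)
  obtain ⟨h, hh, hhD, S, hS, hqS, huS⟩ := H.t1.path (x := q) (r := u) (P := D) (by simp [hqM])
    (by simp) hqD huD
  have hh1 : s(u, c₁) ≠ h := by
    rintro rfl
    rw [cr_mk] at hhD
    tauto
  have hh2 : h ≠ s(u, c₂) := by
    rintro rfl
    rw [cr_mk] at hhD
    tauto
  obtain ⟨hSC, huh⟩ := root_sub H.t1 hc₂ hh hC₂ hS huC₂ huS hh2
    (Finset.nonempty_iff_ne_empty.1 ⟨q, by simp [hqC₂, hqS]⟩)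
  have hSg : cr S s(p, q) := by
    rw [cr_mk]
    exact Or.inr ⟨fun k => hpC₂ (hSC k), hqS⟩
  have hgw : ∀ x ∈ s(p, q), x ∈ insert u M := by
    intro x hx
    rw [Sym2.mem_iff] at hx
    rcases hx with rfl | rfl
    · exact hC₁.1 hp
    · simp [hqM]
  have hhw : ∀ x ∈ h, x ∈ N := by
    intro x hx
    have := H.t1.wi h hh x hx
    rw [Finset.mem_insert] at this
    rcases this with rfl | this
    · exact absurd hx huh
    · exact hMN this
  have hsw := H.swap hh hS hg hD hSg hhD hgw hhw
  have hnew := hC₁.exch_yes hc₁ hh1 hS hcr1 hSg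
  have hdis2 : C₁ ∩ S = ∅ := by
    rw [← Finset.subset_empty, ← hdis]
    exact Finset.inter_subset_inter_left hSC
  rw [symmDiff_disj hdis2] at hnew
  have := hmax _ _ _ hsw (by simp [hc₁, hh1]) hnew (by simp [huC₁, huS])
  rw [Finset.card_union_of_disjoint (Finset.disjoint_iff_inter_eq_empty.2 hdis2)] at this
  have : 0 < S.card := Finset.card_pos.2 ⟨q, hqS⟩
  omega

theorem Sd.leaf_in {A : Finset V} {T : Finset (Sym2 V)} {g : Sym2 V} {D : Finset V} {a c : V}
    (hw : Wi A T) (hg : g ∈ T) (hD : Sd A T g D) (ha : a ∉ A) (hc : c ∈ D) :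
    Sd (insert a A) (insert s(a, c) T) g (insert a D) := by
  have key : ∀ e ∈ T, (cr (insert a D) e ↔ cr D e) := by
    intro e he
    have := hw e he
    clear he
    induction e using Sym2.ind with
    | _ x y =>
      have hx := this x (by simp)
      have hy := this y (by simp)
      have hx' : x ≠ a := by rintro rfl; exact ha hx
      have hy' : y ≠ a := by rintro rfl; exact ha hy
      simp [cr_mk, hx', hy']
  refine ⟨Finset.insert_subset_insert _ hD.1, (key g hg).2 hD.2.1, ?_⟩
  intro e he hce
  rw [Finset.mem_insert] at he
  rcases he with rfl | he
  · rw [cr_mk] at hce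
    simp [hc] at hce
  · exact hD.2.2 e he ((key e he).1 hce)

theorem Sd.leaf_out {A : Finset V} {T : Finset (Sym2 V)} {g : Sym2 V} {D : Finset V} {a c : V}
    (hD : Sd A T g D) (ha : a ∉ A) (hc : c ∉ D) :
    Sd (insert a A) (insert s(a, c) T) g D := by
  refine ⟨hD.1.trans (Finset.subset_insert _ _), hD.2.1, ?_⟩
  intro e he hce
  rw [Finset.mem_insert] at he
  rcases he with rfl | he
  · rw [cr_mk] at hce
    have := fun h => ha (hD.1 h)
    tauto
  · exact hD.2.2 e he hce

theorem exists_max_dec {A₁ A₂ : Finset V} {Hs T₁ T₂ : Finset (Sym2 V)} (H : Dec A₁ A₂ Hs T₁ T₂)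
    {u c : V} (hc : s(u, c) ∈ T₁) : ∃ T₁ T₂ C, Dec A₁ A₂ Hs T₁ T₂ ∧ s(u, c) ∈ T₁ ∧
      Sd A₁ T₁ s(u, c) C ∧ u ∉ C ∧ ∀ T₁' T₂' C', Dec A₁ A₂ Hs T₁' T₂' → s(u, c) ∈ T₁' →
      Sd A₁ T₁' s(u, c) C' → u ∉ C' → C'.card ≤ C.card := by
  obtain ⟨C, ⟨T₁', T₂', h1, h2, h3, h4⟩, hmax⟩ := max_card (A := A₁)
    (fun C => ∃ T₁ T₂, Dec A₁ A₂ Hs T₁ T₂ ∧ s(u, c) ∈ T₁ ∧ Sd A₁ T₁ s(u, c) C ∧ u ∉ C)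
    (by
      obtain ⟨D, hD, hu⟩ := H.t1.side hc u
      exact ⟨D, T₁, T₂, H, hc, hD, hu⟩)
    (by
      rintro C ⟨_, _, _, _, hS, _⟩
      exact hS.1)
  exact ⟨T₁', T₂', C, h1, h2, h3, h4, fun a b C' k1 k2 k3 k4 => hmax C' ⟨a, b, k1, k2, k3, k4⟩⟩

theorem thm1 {E : Finset (Sym2 V)} (hE : Red E) {B : Finset V} {a : V} (ha : a ∉ B)
    {T₁ T₂ : Finset (Sym2 V)} (h1 : Tr (insert a B) T₁) (h2 : Tr B T₂) (hd : Disjoint T₁ T₂)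
    (hs1 : T₁ ⊆ E) (hs2 : T₂ ⊆ E) (hB : 2 ≤ B.card) : False := by
  set Hs := T₁ ∪ T₂ with hHs
  have hHsE : Hs ⊆ E := Finset.union_subset hs1 hs2
  have H : Dec (insert a B) B Hs T₁ T₂ := ⟨h1, h2, hd, rfl⟩
  have hW : Wi (insert a B) Hs := by
    intro e he x hx
    rw [hHs, Finset.mem_union] at he
    rcases he with he | he
    · exact h1.wi e he x hx
    · simp [h2.wi e he x hx]
  have hnc := hE (insert a B) Hs hHsE hW (by rw [Finset.card_insert_of_notMem ha]; omega)
  unfold Coll at hnc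
  push Not at hnc
  obtain ⟨ω, hω, hbad⟩ := hnc
  rw [Finset.sum_insert ha] at hω
  have hωa : ω a = 1 := by
    rcases z2or (ω a) with h0 | h0
    · exfalso
      obtain ⟨J, hJ, hJd⟩ := h2.join ω (by rw [h0] at hω; simpa using hω)
      refine hbad J (hJ.trans H.sub2) ?_ (h1.cn.mono ?_)
      · intro x hx
        rw [Finset.mem_insert] at hx
        rcases hx with rfl | hx
        · rw [h0]
          exact dg_zero fun e he hxe => ha (h2.wi e (hJ he) x hxe)
        · exact hJd x hx
      · intro e he
        rw [Finset.mem_sdiff]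
        exact ⟨H.sub1 he, fun hh => Finset.disjoint_left.1 hd he (hJ hh)⟩
    · exact h0
  have bad1 : ∀ T₁ T₂, Dec (insert a B) B Hs T₁ T₂ → ∀ c C g D, s(a, c) ∈ T₁ →
      Sd (insert a B) T₁ s(a, c) C → a ∉ C → g ∈ T₂ → cr C g →
      Sd (insert a B) (insert s(a, c) T₂) g D → ∑ x ∈ D, ω x = 0 → False := by
    intro T₁ T₂ H c C g D hc hC haC hg hCg hD hsum
    have hcB : c ∈ B := by
      have h1 := H.t1.wi _ hc c (by simp)
      have : c ≠ a := by
        rintro rfl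
        exact hC.2.1.nd (by simp)
      rw [Finset.mem_insert] at h1
      tauto
    have ht := H.t2.addLeaf ha hcB
    obtain ⟨J, hJ, hJd⟩ := ht.join ω (by rw [Finset.sum_insert ha]; exact hω)
    have hgJ : g ∉ J := by
      intro hh
      have := join_side ht hD hJ hJd
      rw [hsum] at this
      simp [hh] at this
    have hgw : ∀ x ∈ g, x ∈ insert a B := fun x hx => by simp [H.t2.wi g hg x hx]
    refine hbad J ?_ hJd ((H.t1.exchange hc hC hgw hCg).cn.mono ?_)
    · intro e he
      have := hJ he
      rw [Finset.mem_insert] at this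
      rcases this with rfl | this
      · exact H.sub1 hc
      · exact H.sub2 this
    · intro e he
      rw [Finset.mem_insert, Finset.mem_erase] at he
      rw [Finset.mem_sdiff]
      rcases he with rfl | ⟨he1, he⟩
      · exact ⟨H.sub2 hg, hgJ⟩
      · refine ⟨H.sub1 he, fun hh => ?_⟩
        have := hJ hh
        rw [Finset.mem_insert] at this
        rcases this with this | this
        · exact he1 this
        · exact Finset.disjoint_left.1 H.dj he this
  have hNS : NS (insert a B) B Hs a := by
    intro T₁ T₂ H c₁ c₂ C₁ C₂ g D hne hc₁ hc₂ hC₁ hu₁ hC₂ hu₂ hg hg1 hg2 hD hc₁D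
    by_contra hc₂D
    have haD : a ∉ D := fun hh => ha (hD.1 hh)
    rcases z2or (∑ x ∈ D, ω x) with h0 | h0
    · exact bad1 T₁ T₂ H c₂ C₂ g D hc₂ hC₂ hu₂ hg hg2 (hD.leaf_out ha hc₂D) h0
    · refine bad1 T₁ T₂ H c₁ C₁ g _ hc₁ hC₁ hu₁ hg hg1 (hD.leaf_in H.t2.wi hg ha hc₁D) ?_
      rw [Finset.sum_insert haD, h0, hωa]
      exact z2 1
  obtain ⟨b, hb⟩ : B.Nonempty := Finset.card_pos.1 (by omega)
  obtain ⟨c₁, hc₁B, hc₁, -⟩ := h1.rootSide ha hb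
  obtain ⟨T₁', T₂', C, H', hc₁', hC, haC, hmax⟩ := exists_max_dec H hc₁
  have hc₁C := hC.mem_root haC
  have hCB : C ⊆ B := by
    intro x hx
    have := hC.1 hx
    rw [Finset.mem_insert] at this
    rcases this with rfl | this
    · exact absurd hx haC
    · exact this
  by_cases hCB' : C = B
  · subst hCB'
    refine two_trees hE (H'.t1.sideTree hC) H'.t2 ?_ ?_ (H'.sub2.trans hHsE) hB
    · exact Finset.disjoint_of_subset_left (Finset.filter_subset _ _) H'.dj
    · exact (Finset.filter_subset _ _).trans (H'.sub1.trans hHsE)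
  · obtain ⟨r, hr, hrC⟩ : ∃ r ∈ B, r ∉ C := by
      by_contra hx
      push Not at hx
      exact hCB' (Finset.Subset.antisymm hCB hx)
    obtain ⟨p, q, hpq, hpB, hqB, hpC, hqC, S, hS, hc₁S, hpS, -, hqS, -⟩ :=
      H'.t2.firstExit (hCB hc₁C) hr hc₁C hrC
    have := growth ha (Finset.Subset.refl B) ha hNS H' hc₁' hC haC hmax hpC hqB hqC hpq
      (hS.compl H'.t2.wi hpq) (by simp [hqB, hqS]) (by simp [hpS])
    simp [hc₁S] at this

end MG
namespace MG

section MU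
variable {α : Type} [DecidableEq α]

theorem mu (S : Finset α) : ∀ f₁ f₂ : Finset α → ℤ,
    f₁ ∅ = 0 → f₂ ∅ = 0 →
    (∀ X Y, f₁ (X ∪ Y) + f₁ (X ∩ Y) ≤ f₁ X + f₁ Y) →
    (∀ X Y, f₂ (X ∪ Y) + f₂ (X ∩ Y) ≤ f₂ X + f₂ Y) →
    (∀ e X, f₁ (insert e X) ≤ f₁ X + 1) → (∀ e X, f₂ (insert e X) ≤ f₂ X + 1) →
    (∀ X ⊆ S, (X.card : ℤ) ≤ f₁ X + f₂ X) →
    ∃ I₁ I₂, Disjoint I₁ I₂ ∧ I₁ ∪ I₂ = S ∧ (∀ X ⊆ I₁, (X.card : ℤ) ≤ f₁ X) ∧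
      (∀ X ⊆ I₂, (X.card : ℤ) ≤ f₂ X) := by
  induction S using Finset.induction_on with
  | empty =>
    intro f₁ f₂ z1 z2 _ _ _ _ _
    refine ⟨∅, ∅, by simp, by simp, ?_, ?_⟩ <;>
    · intro X hX
      rw [Finset.subset_empty] at hX
      subst hX
      simp [z1, z2]
  | insert e S he ih =>
    -- one-sided step
    have step : ∀ f₁ f₂ : Finset α → ℤ, f₁ ∅ = 0 → f₂ ∅ = 0 →
        (∀ X Y, f₁ (X ∪ Y) + f₁ (X ∩ Y) ≤ f₁ X + f₁ Y) →
        (∀ X Y, f₂ (X ∪ Y) + f₂ (X ∩ Y) ≤ f₂ X + f₂ Y) →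
        (∀ e X, f₁ (insert e X) ≤ f₁ X + 1) → (∀ e X, f₂ (insert e X) ≤ f₂ X + 1) →
        (∀ X ⊆ S, (X.card : ℤ) ≤ f₁ (insert e X) - 1 + f₂ X) →
        ∃ I₁ I₂, Disjoint I₁ I₂ ∧ I₁ ∪ I₂ = insert e S ∧ (∀ X ⊆ I₁, (X.card : ℤ) ≤ f₁ X) ∧
        (∀ X ⊆ I₂, (X.card : ℤ) ≤ f₂ X) := by
      intro f₁ f₂ z1 z2 s1 s2 u1 u2 hX
      have hz : f₁ (insert e ∅) - 1 = 0 := by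
        have a1 := hX ∅ (by simp)
        have a2 := u1 e ∅
        simp only [Finset.card_empty, Nat.cast_zero] at a1
        omega
      obtain ⟨I₁, I₂, hd, hu, h1, h2⟩ := ih (fun X => f₁ (insert e X) - 1) f₂ hz z2
        (by
          intro X Y
          have := s1 (insert e X) (insert e Y)
          rw [← Finset.insert_union_distrib, ← Finset.insert_inter_distrib] at this
          omega) s2
        (by
          intro a X
          have := u1 a (insert e X)
          rw [Finset.insert_comm] at this
          omega) u2 hX
      have heI : e ∉ I₁ ∧ e ∉ I₂ := by
        rw [← hu, Finset.mem_union] at he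
        tauto
      refine ⟨insert e I₁, I₂, ?_, ?_, ?_, h2⟩
      · rw [Finset.disjoint_insert_left]
        exact ⟨heI.2, hd⟩
      · rw [Finset.insert_union, hu]
      · intro X hXI
        have := h1 (X.erase e) (by
          intro x hx
          rw [Finset.mem_erase] at hx
          have := hXI hx.2
          rw [Finset.mem_insert] at this
          tauto)
        by_cases heX : e ∈ X
        · simp only [Finset.insert_erase heX, Finset.card_erase_of_mem heX] at this
          have : 0 < X.card := Finset.card_pos.2 ⟨e, heX⟩
          omega
        · simp only [Finset.erase_eq_of_notMem heX] at this
          have := u1 e X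
          omega
    intro f₁ f₂ z1 z2 s1 s2 u1 u2 hX
    by_cases ha : ∀ X ⊆ S, (X.card : ℤ) ≤ f₁ (insert e X) - 1 + f₂ X
    · exact step f₁ f₂ z1 z2 s1 s2 u1 u2 ha
    by_cases hb : ∀ X ⊆ S, (X.card : ℤ) ≤ f₂ (insert e X) - 1 + f₁ X
    · obtain ⟨I₂, I₁, hd, hu, h2, h1⟩ := step f₂ f₁ z2 z1 s2 s1 u2 u1 hb
      exact ⟨I₁, I₂, hd.symm, by rw [Finset.union_comm, hu], h1, h2⟩
    exfalso
    push Not at ha hb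
    obtain ⟨X, hXS, hX1⟩ := ha
    obtain ⟨Y, hYS, hY1⟩ := hb
    have heX : e ∉ X := fun h => he (hXS h)
    have heY : e ∉ Y := fun h => he (hYS h)
    have a1 := s1 (insert e X) Y
    have a2 := s2 X (insert e Y)
    rw [Finset.insert_union, Finset.insert_inter_of_notMem heY] at a1
    rw [Finset.union_insert, Finset.inter_insert_of_notMem heX] at a2
    have b1 := hX (insert e (X ∪ Y)) (Finset.insert_subset_insert _ (Finset.union_subset hXS hYS))
    have b2 := hX (X ∩ Y) ((Finset.inter_subset_left.trans hXS).trans (Finset.subset_insert _ _))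
    rw [Finset.card_insert_of_notMem (by simp [heX, heY])] at b1
    have c := Finset.card_union_add_card_inter X Y
    push_cast at b1
    have c' : ((X ∪ Y).card : ℤ) + (X ∩ Y).card = X.card + Y.card := by exact_mod_cast c
    omega

end MU

variable {V : Type}

/-- functions constant along the edges of `X` -/
def K (X : Finset (Sym2 V)) : Submodule (ZMod 2) (V → ZMod 2) where
  carrier := {φ | ∀ a b, s(a, b) ∈ X → φ a = φ b}
  add_mem' := by
    intro φ ψ h1 h2 a b hab
    simp [h1 a b hab, h2 a b hab]
  zero_mem' := by intro a b _; rfl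
  smul_mem' := by
    intro c φ h a b hab
    simp [h a b hab]

theorem mem_K {X : Finset (Sym2 V)} {φ : V → ZMod 2} :
    φ ∈ K X ↔ ∀ a b, s(a, b) ∈ X → φ a = φ b := Iff.rfl

theorem K_union (X Y : Finset (Sym2 V)) : K (X ∪ Y) = K X ⊓ K Y := by
  ext φ
  simp only [Submodule.mem_inf, mem_K, Finset.mem_union]
  constructor
  · intro h
    exact ⟨fun a b hab => h a b (Or.inl hab), fun a b hab => h a b (Or.inr hab)⟩
  · rintro ⟨h1, h2⟩ a b (h | h)
    · exact h1 a b h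
    · exact h2 a b h

theorem K_anti {X Y : Finset (Sym2 V)} (h : X ⊆ Y) : K Y ≤ K X :=
  fun _ hφ a b hab => hφ a b (h hab)

/-- rank of an edge set -/
noncomputable def rk [Fintype V] (X : Finset (Sym2 V)) : ℤ :=
  (Fintype.card V : ℤ) - Module.finrank (ZMod 2) (K X)

theorem rk_empty [Fintype V] : rk (∅ : Finset (Sym2 V)) = 0 := by
  have : K (∅ : Finset (Sym2 V)) = ⊤ := by
    ext φ; simp [mem_K]
  unfold rk
  rw [this, finrank_top, Module.finrank_fintype_fun_eq_card]
  simp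

theorem rk_sub [Fintype V] (X Y : Finset (Sym2 V)) : rk (X ∪ Y) + rk (X ∩ Y) ≤ rk X + rk Y := by
  have h1 := Submodule.finrank_sup_add_finrank_inf_eq (K X) (K Y)
  have h2 : Module.finrank (ZMod 2) ↥(K X ⊔ K Y) ≤ Module.finrank (ZMod 2) ↥(K (X ∩ Y)) :=
    Submodule.finrank_mono (sup_le (K_anti Finset.inter_subset_left)
      (K_anti Finset.inter_subset_right))
  rw [← K_union] at h1
  unfold rk
  omega

theorem rk_insert [Fintype V] (e : Sym2 V) (X : Finset (Sym2 V)) : rk (insert e X) ≤ rk X + 1 := by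
  induction e using Sym2.ind with
  | _ a b =>
    set f : (V → ZMod 2) →ₗ[ZMod 2] ZMod 2 :=
      LinearMap.proj (R := ZMod 2) (φ := fun _ : V => ZMod 2) a -
      LinearMap.proj (R := ZMod 2) (φ := fun _ : V => ZMod 2) b with hf
    have hle : K X ⊓ LinearMap.ker f ≤ K (insert s(a, b) X) := by
      rintro φ ⟨h1, h2⟩ c d hcd
      have h3 : φ a = φ b := by
        have : f φ = 0 := h2
        simpa [hf, sub_eq_zero] using this
      rw [Finset.mem_insert] at hcd
      rcases hcd with hcd | hcd
      · rw [Sym2.eq_iff] at hcd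
        rcases hcd with ⟨rfl, rfl⟩ | ⟨rfl, rfl⟩
        · exact h3
        · exact h3.symm
      · exact h1 c d hcd
    have h1 := Submodule.finrank_sup_add_finrank_inf_eq (K X) (LinearMap.ker f)
    have h2 := Submodule.finrank_mono hle
    have h3 := LinearMap.finrank_range_add_finrank_ker f
    have h4 := Submodule.finrank_le (LinearMap.range f)
    have h5 := Submodule.finrank_le (K X ⊔ LinearMap.ker f)
    simp only [Module.finrank_self, Module.finrank_fintype_fun_eq_card] at h3 h4 h5
    unfold rk
    omega

theorem rk_le_card [Fintype V] (X : Finset (Sym2 V)) : rk X ≤ X.card := by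
  induction X using Finset.induction_on with
  | empty => simp [rk_empty]
  | insert e X he ih =>
    rw [Finset.card_insert_of_notMem he]
    have := rk_insert e X
    push_cast
    omega

theorem finrank_K_ge [Fintype V] {X : Finset (Sym2 V)} (ψ : V → V)
    (h : ∀ a b, s(a, b) ∈ X → ψ a = ψ b) :
    (Finset.univ.image ψ).card ≤ Module.finrank (ZMod 2) (K X) := by
  set R := Finset.univ.image ψ with hR
  let L : (R → ZMod 2) →ₗ[ZMod 2] K X :=
    { toFun := fun f => ⟨fun x => f ⟨ψ x, by simp [hR]⟩, fun a b hab => by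
        have := h a b hab
        simp only [this]⟩
      map_add' := fun f g => rfl
      map_smul' := fun c f => rfl }
  have hL : Function.Injective L := by
    intro f g hfg
    funext ⟨y, hy⟩
    have hy' := hy
    rw [hR, Finset.mem_image] at hy'
    obtain ⟨x, -, rfl⟩ := hy'
    exact congrFun (congrArg Subtype.val hfg) x
  have := LinearMap.finrank_le_finrank_of_injective hL
  simpa using this

theorem finrank_K_le [Fintype V] {X : Finset (Sym2 V)} (R : Finset V)
    (h : ∀ φ ∈ K X, (∀ x ∈ R, φ x = 0) → φ = 0) :
    Module.finrank (ZMod 2) (K X) ≤ R.card := by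
  let L : K X →ₗ[ZMod 2] (R → ZMod 2) :=
    { toFun := fun f x => f.1 x.1
      map_add' := fun f g => rfl
      map_smul' := fun c f => rfl }
  have hL : Function.Injective L := by
    rw [injective_iff_map_eq_zero]
    intro f hf
    apply Subtype.ext
    apply h f.1 f.2
    intro x hx
    exact congrFun hf ⟨x, hx⟩
  have := LinearMap.finrank_le_finrank_of_injective hL
  simpa using this

/-- independent sets of the right size are trees -/
theorem tree_of_indep [Fintype V] {N : Finset V} {I : Finset (Sym2 V)} (hw : Wi N I)
    (hI : ∀ X ⊆ I, (X.card : ℤ) ≤ rk X) (hc : N.card ≤ I.card + 1) : Tr N I := by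
  refine ⟨hw, ?_, ?_⟩
  · intro B hB hn hne
    by_contra hcon
    push Not at hcon
    obtain ⟨b, hb⟩ := hn
    obtain ⟨n, hnN, hnB⟩ : ∃ r ∈ N, r ∉ B := by
      by_contra hx
      push Not at hx
      exact hne (Finset.Subset.antisymm hB hx)
    have h1 := finrank_K_ge (X := I) (fun x => if x ∈ B then b else if x ∈ N then n else x) (by
      intro x y hxy
      have hx := hw _ hxy x (by simp)
      have hy := hw _ hxy y (by simp)
      have := hcon _ hxy
      rw [cr_mk] at this
      by_cases hxB : x ∈ B
      · have : y ∈ B := by tauto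
        simp [hxB, this]
      · have : y ∉ B := by tauto
        simp [hxB, this, hx, hy])
    have h2 : insert b (insert n (Finset.univ \ N)) ⊆ Finset.univ.image
        (fun x => if x ∈ B then b else if x ∈ N then n else x) := by
      intro x hx
      simp only [Finset.mem_insert, Finset.mem_sdiff, Finset.mem_univ, true_and] at hx
      rw [Finset.mem_image]
      rcases hx with rfl | rfl | hx
      · exact ⟨x, by simp, by simp [hb]⟩
      · exact ⟨x, by simp, by simp [hnB, hnN]⟩
      · exact ⟨x, by simp, by
          have : x ∉ B := fun h => hx (hB h)
          simp [hx, this]⟩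
    have h3 := Finset.card_le_card h2
    rw [Finset.card_insert_of_notMem (by
        simp only [Finset.mem_insert, Finset.mem_sdiff, Finset.mem_univ, true_and, not_or]
        exact ⟨by rintro rfl; exact hnB hb, fun h => h (hB hb)⟩),
      Finset.card_insert_of_notMem (by simp [hnN]), Finset.card_univ_sdiff] at h3
    have h4 := hI I (Finset.Subset.refl _)
    have h5 := Finset.card_le_univ N
    unfold rk at h4
    omega
  · intro g hg
    by_contra hcon
    push Not at hcon
    have hle : K (I.erase g) ≤ K I := by
      intro φ hφ a b hab
      by_cases hne : s(a, b) = g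
      · subst hne
        by_contra hab'
        apply hcon (N.filter fun x => φ x = 1)
        refine ⟨Finset.filter_subset _ _, ?_, ?_⟩
        · have ha := hw _ hab a (by simp)
          have hb := hw _ hab b (by simp)
          rw [cr_mk]
          simp only [Finset.mem_filter, ha, hb, true_and]
          rcases z2or (φ a) with h | h <;> rcases z2or (φ b) with h' | h' <;> simp_all
        · intro e he hce
          by_contra hne'
          induction e using Sym2.ind with
          | _ c d =>
            have hcd := hφ c d (by simp [he, hne'])
            have hc := hw _ he c (by simp)
            have hd := hw _ he d (by simp)
            rw [cr_mk] at hce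
            simp only [Finset.mem_filter, hc, hd, hcd, true_and] at hce
            tauto
      · exact hφ a b (by simp [hab, hne])
    have h1 := Submodule.finrank_mono hle
    have h2 := hI I (Finset.Subset.refl _)
    have h3 := rk_le_card (I.erase g)
    rw [Finset.card_erase_of_mem hg] at h3
    have h4 : 0 < I.card := Finset.card_pos.2 ⟨g, hg⟩
    unfold rk at h2 h3
    omega

theorem indep_card [Fintype V] {N : Finset V} {I : Finset (Sym2 V)} (hN : N.Nonempty) (hw : Wi N I)
    (hI : (I.card : ℤ) ≤ rk I) : I.card + 1 ≤ N.card := by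
  obtain ⟨b, hb⟩ := hN
  have h1 := finrank_K_ge (X := I) (fun x => if x ∈ N then b else x) (by
    intro x y hxy
    have hx := hw _ hxy x (by simp)
    have hy := hw _ hxy y (by simp)
    simp [hx, hy])
  have h2 : insert b (Finset.univ \ N) ⊆ Finset.univ.image (fun x => if x ∈ N then b else x) := by
    intro x hx
    simp only [Finset.mem_insert, Finset.mem_sdiff, Finset.mem_univ, true_and] at hx
    rw [Finset.mem_image]
    rcases hx with rfl | hx
    · exact ⟨x, by simp, by simp [hb]⟩
    · exact ⟨x, by simp, by simp [hx]⟩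
  have h3 := Finset.card_le_card h2
  rw [Finset.card_insert_of_notMem (by simp [hb]), Finset.card_univ_sdiff] at h3
  have h5 := Finset.card_le_univ N
  unfold rk at hI
  omega

/-- edges meeting `κ` -/
noncomputable def mt (X : Finset (Sym2 V)) (κ : Finset V) : Finset (Sym2 V) :=
  X.filter fun e => ∃ x ∈ e, x ∈ κ

theorem mem_mt {X : Finset (Sym2 V)} {κ : Finset V} {e : Sym2 V} :
    e ∈ mt X κ ↔ e ∈ X ∧ ∃ x ∈ e, x ∈ κ := by simp [mt]

/-- some edge of `Y` inside `N` leaves `κ` -/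
def Lk (Y : Finset (Sym2 V)) (N κ : Finset V) : Prop :=
  ∃ e ∈ Y, (∀ x ∈ e, x ∈ N) ∧ cr κ e

/-- label fibres -/
noncomputable def fb {Q : Type} (M : Finset V) (lab : V → Q) (q : Q) : Finset V :=
  M.filter fun y => lab y = q

theorem mem_fb {Q : Type} {M : Finset V} {lab : V → Q} {q : Q} {x : V} :
    x ∈ fb M lab q ↔ x ∈ M ∧ lab x = q := by simp [fb]

/-- lower bound for the rank of the part of `X` inside `N` -/
theorem rk_lower [Fintype V] {M N : Finset V} (hMN : M ⊆ N) (X : Finset (Sym2 V)) {Q : Type}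
    (lab : V → Q)
    (hlab : ∀ φ ∈ K (res M X), ∀ x y, lab x = lab y → φ x = φ y)
    (hlab' : ∀ a b, s(a, b) ∈ res M X → lab a = lab b) :
    (M.card : ℤ) - ((M.image lab).filter fun q =>
      ¬ Lk (mt X (fb M lab q)) N (fb M lab q)).card ≤ rk (res N X) := by
  set Q' := (M.image lab).filter fun q =>
      ¬ Lk (mt X (fb M lab q)) N (fb M lab q) with hQ'
  have hex : ∀ q : Q', ∃ x, x ∈ M ∧ lab x = q.1 := by
    rintro ⟨q, hq⟩
    rw [hQ', Finset.mem_filter, Finset.mem_image] at hq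
    obtain ⟨⟨x, hx, hxq⟩, -⟩ := hq
    exact ⟨x, hx, hxq⟩
  choose rep hrepM hrep using hex
  have h1 := finrank_K_le (X := res N X) ((Finset.univ \ M) ∪ Finset.univ.image rep) (by
    intro φ hφ h0
    have hφM : φ ∈ K (res M X) := K_anti (by
      intro e he
      rw [mem_res] at he ⊢
      exact ⟨he.1, fun x hx => hMN (he.2 x hx)⟩) hφ
    have hout : ∀ x, x ∉ M → φ x = 0 := fun x hx => h0 x (by simp [hx])
    funext x
    by_cases hx : x ∈ M
    · by_cases hq : lab x ∈ Q'
      · have := h0 (rep ⟨_, hq⟩) (by simp)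
        rw [← hlab φ hφM (rep ⟨_, hq⟩) x (hrep _)]
        exact this
      · rw [hQ', Finset.mem_filter] at hq
        have hx' : lab x ∈ M.image lab := Finset.mem_image_of_mem _ hx
        have : Lk (mt X (fb M lab (lab x))) N (fb M lab (lab x)) := by tauto
        obtain ⟨e, he, heN, a, ha, b, hb, rfl⟩ := this
        replace he := (mem_mt.1 he).1
        rw [mem_fb] at ha hb
        have hbM : b ∉ M := by
          intro hbM
          apply hb
          refine ⟨hbM, ?_⟩
          rw [← ha.2]
          refine (hlab' a b (mem_res.2 ⟨he, ?_⟩)).symm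
          intro y hy
          rw [Sym2.mem_iff] at hy
          rcases hy with rfl | rfl
          · exact ha.1
          · exact hbM
        rw [← hlab φ hφM a x ha.2, hφ a b (mem_res.2 ⟨he, heN⟩)]
        exact hout b hbM
    · exact hout x hx)
  have h2 := Finset.card_union_le (Finset.univ \ M) (Finset.univ.image rep)
  have h3 : (Finset.univ.image rep).card ≤ Q'.card := by
    have := Finset.card_image_le (s := (Finset.univ : Finset Q')) (f := rep)
    simpa using this
  rw [Finset.card_univ_sdiff] at h2
  have h5 := Finset.card_le_univ M
  unfold rk
  omega

theorem mu_cond [Fintype V] {M N₁ N₂ : Finset V} {F : Finset (Sym2 V)}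
    (h1 : M ⊆ N₁) (h2 : M ⊆ N₂) (hmeet : ∀ e ∈ F, ∃ x ∈ e, x ∈ M)
    (hloc : ∀ κ ⊆ M, κ.Nonempty → ∀ Y ⊆ F, (∀ e ∈ Y, ∃ x ∈ e, x ∈ κ) →
      (∀ e ∈ Y, (∀ x ∈ e, x ∈ M) → ∀ x ∈ e, x ∈ κ) →
      Y.card + (if Lk Y N₁ κ then 0 else 1) + (if Lk Y N₂ κ then 0 else 1) ≤ 2 * κ.card)
    (X : Finset (Sym2 V)) (hX : X ⊆ F) {Q : Type} (lab : V → Q)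
    (hlab : ∀ φ ∈ K (res M X), ∀ x y, lab x = lab y → φ x = φ y)
    (hlab' : ∀ a b, s(a, b) ∈ res M X → lab a = lab b) :
    (X.card : ℤ) ≤ rk (res N₁ X) + rk (res N₂ X) := by
  have r1 := rk_lower h1 X lab hlab hlab'
  have r2 := rk_lower h2 X lab hlab hlab'
  rw [Finset.card_filter] at r1 r2
  have hfib := Finset.card_eq_sum_card_image lab M
  have hXle : X.card ≤ ∑ q ∈ M.image lab, (mt X (fb M lab q)).card := by
    refine le_trans (Finset.card_le_card ?_) Finset.card_biUnion_le
    intro e he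
    obtain ⟨x, hxe, hxM⟩ := hmeet e (hX he)
    rw [Finset.mem_biUnion]
    exact ⟨lab x, Finset.mem_image_of_mem _ hxM, by
      rw [mem_mt]
      exact ⟨he, x, hxe, mem_fb.2 ⟨hxM, rfl⟩⟩⟩
  have hsum : ∑ q ∈ M.image lab, ((mt X (fb M lab q)).card +
        (if ¬ Lk (mt X (fb M lab q)) N₁ (fb M lab q) then 1 else 0) +
        (if ¬ Lk (mt X (fb M lab q)) N₂ (fb M lab q) then 1 else 0))
      ≤ ∑ q ∈ M.image lab, 2 * (fb M lab q).card := by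
    apply Finset.sum_le_sum
    intro q hq
    rw [Finset.mem_image] at hq
    obtain ⟨x, hx, hxq⟩ := hq
    have := hloc (fb M lab q) (fun x hx => (mem_fb.1 hx).1)
      ⟨x, mem_fb.2 ⟨hx, hxq⟩⟩ (mt X (fb M lab q))
      (fun e he => hX (mem_mt.1 he).1) (fun e he => (mem_mt.1 he).2) (by
        intro e he hew
        obtain ⟨heX, y, hye, hy⟩ := mem_mt.1 he
        obtain ⟨t, rfl⟩ := hye
        intro a ha
        rw [mem_fb] at hy ⊢
        refine ⟨hew a ha, ?_⟩
        rw [Sym2.mem_iff] at ha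
        rcases ha with rfl | rfl
        · exact hy.2
        · rw [← hlab' y a (mem_res.2 ⟨heX, hew⟩)]
          exact hy.2)
    refine le_trans (le_of_eq ?_) this
    rw [ite_not, ite_not]
  have hfib' : ∑ q ∈ M.image lab, (fb M lab q).card = M.card := hfib.symm
  rw [Finset.sum_add_distrib, Finset.sum_add_distrib, ← Finset.mul_sum, hfib'] at hsum
  push_cast at r1 r2
  zify at hsum hXle
  linarith

theorem decomp [Fintype V] {M N₁ N₂ : Finset V} {F : Finset (Sym2 V)} (hM : M.Nonempty)
    (h1 : M ⊆ N₁) (h2 : M ⊆ N₂) (hmeet : ∀ e ∈ F, ∃ x ∈ e, x ∈ M)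
    (hcard : F.card + 2 = N₁.card + N₂.card)
    (hloc : ∀ κ ⊆ M, κ.Nonempty → ∀ Y ⊆ F, (∀ e ∈ Y, ∃ x ∈ e, x ∈ κ) →
      (∀ e ∈ Y, (∀ x ∈ e, x ∈ M) → ∀ x ∈ e, x ∈ κ) →
      Y.card + (if Lk Y N₁ κ then 0 else 1) +
        (if Lk Y N₂ κ then 0 else 1) ≤ 2 * κ.card) :
    ∃ T₁ T₂, Dec N₁ N₂ F T₁ T₂ := by
  have res_un : ∀ (N : Finset V) (X Y : Finset (Sym2 V)), res N (X ∪ Y) = res N X ∪ res N Y :=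
    fun N X Y => by
      ext e
      simp only [mem_res, Finset.mem_union]
      tauto
  have res_in : ∀ (N : Finset V) (X Y : Finset (Sym2 V)), res N (X ∩ Y) = res N X ∩ res N Y :=
    fun N X Y => by
      ext e
      simp only [mem_res, Finset.mem_inter]
      tauto
  have hz : ∀ N : Finset V, rk (res N ∅) = 0 := fun N => by
    have : res N (∅ : Finset (Sym2 V)) = ∅ := rfl
    rw [this, rk_empty]
  have hsub : ∀ (N : Finset V) (X Y : Finset (Sym2 V)),
      rk (res N (X ∪ Y)) + rk (res N (X ∩ Y)) ≤ rk (res N X) + rk (res N Y) := by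
    intro N X Y
    rw [res_un, res_in]
    exact rk_sub _ _
  have hunit : ∀ (N : Finset V) (e : Sym2 V) (X : Finset (Sym2 V)),
      rk (res N (insert e X)) ≤ rk (res N X) + 1 := by
    intro N e X
    by_cases he : ∀ x ∈ e, x ∈ N
    · have : res N (insert e X) = insert e (res N X) := by
        ext f
        simp only [mem_res, Finset.mem_insert]
        constructor
        · tauto
        · rintro (rfl | h)
          · exact ⟨Or.inl rfl, he⟩
          · tauto
      rw [this]
      exact rk_insert _ _
    · have : res N (insert e X) = res N X := by
        ext f
        simp only [mem_res, Finset.mem_insert]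
        constructor
        · rintro ⟨rfl | h, h'⟩
          · exact absurd h' he
          · exact ⟨h, h'⟩
        · tauto
      rw [this]
      omega
  obtain ⟨I₁, I₂, hd, hu, hI₁, hI₂⟩ := mu F (fun X => rk (res N₁ X)) (fun X => rk (res N₂ X))
    (hz _) (hz _) (hsub _) (hsub _) (hunit _) (hunit _) (by
      intro X hX
      let lab : V → (K (res M X) → ZMod 2) := fun x φ => φ.1 x
      have hlab : ∀ φ ∈ K (res M X), ∀ x y, lab x = lab y → φ x = φ y := by
        intro φ hφ x y hxy
        exact congrFun hxy ⟨φ, hφ⟩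
      have hlab' : ∀ a b, s(a, b) ∈ res M X → lab a = lab b := by
        intro a b hab
        funext φ
        exact φ.2 a b hab
      exact mu_cond h1 h2 hmeet hloc X hX lab hlab hlab')
  have hw : ∀ (N : Finset V) (I : Finset (Sym2 V)), (∀ X ⊆ I, (X.card : ℤ) ≤ rk (res N X)) →
      Wi N I := by
    intro N I hI e he
    by_contra hcon
    have := hI {e} (by simpa using he)
    have h0 : res N {e} = ∅ := by
      ext f
      simp only [mem_res, Finset.mem_singleton, Finset.notMem_empty, iff_false]
      rintro ⟨rfl, h⟩
      exact hcon h
    rw [h0, rk_empty] at this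
    simp at this
  have hres : ∀ (N : Finset V) (I : Finset (Sym2 V)), Wi N I → ∀ X ⊆ I, res N X = X := by
    intro N I hI X hX
    ext e
    rw [mem_res]
    exact ⟨fun h => h.1, fun h => ⟨h, hI e (hX h)⟩⟩
  have hw1 := hw _ _ hI₁
  have hw2 := hw _ _ hI₂
  have hI₁' : ∀ X ⊆ I₁, (X.card : ℤ) ≤ rk X := fun X hX => by
    have := hI₁ X hX
    simp only [hres _ _ hw1 X hX] at this
    exact this
  have hI₂' : ∀ X ⊆ I₂, (X.card : ℤ) ≤ rk X := fun X hX => by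
    have := hI₂ X hX
    simp only [hres _ _ hw2 X hX] at this
    exact this
  have c1 := indep_card (hM.mono h1) hw1 (hI₁' _ (Finset.Subset.refl _))
  have c2 := indep_card (hM.mono h2) hw2 (hI₂' _ (Finset.Subset.refl _))
  have c3 : I₁.card + I₂.card = F.card := by
    rw [← hu, Finset.card_union_of_disjoint hd]
  exact ⟨I₁, I₂, tree_of_indep hw1 hI₁' (by omega), tree_of_indep hw2 hI₂' (by omega), hd, hu⟩

end MG
namespace MG

variable {V : Type}

theorem ec_all [Fintype V] {E : Finset (Sym2 V)} (hE : Red E) (hN : Nd E) (A : Finset V) :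
    (1 ≤ A.card → (res A E).card + 2 ≤ 2 * A.card) ∧
    (2 ≤ A.card → (res A E).card + 3 ≤ 2 * A.card) ∧
    (3 ≤ A.card → (res A E).card + 4 ≤ 2 * A.card) := by
  induction A using Finset.strongInduction with
  | H A ih =>
    have h3 : 3 ≤ A.card → (res A E).card + 4 ≤ 2 * A.card := by
      intro hA
      by_contra hcon
      obtain ⟨F, hF, hFc⟩ := Finset.exists_subset_card_eq
        (show 2 * A.card - 3 ≤ (res A E).card by omega)
      obtain ⟨a, ha⟩ : A.Nonempty := Finset.card_pos.1 (by omega)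
      have hFE : F ⊆ E := fun e he => (mem_res.1 (hF he)).1
      have hFA : Wi A F := fun e he => (mem_res.1 (hF he)).2
      have hMc : (A.erase a).card = A.card - 1 := Finset.card_erase_of_mem ha
      obtain ⟨T₁, T₂, H⟩ := decomp (M := A.erase a) (N₁ := A) (N₂ := A.erase a) (F := F)
        (Finset.card_pos.1 (by omega)) (Finset.erase_subset _ _) (Finset.Subset.refl _)
        (by
          intro e he
          have h1 := hFA e he
          have h2 := hN e (hFE he)
          induction e using Sym2.ind with
          | _ x y =>
            rw [Sym2.mk_isDiag_iff] at h2
            by_cases hx : x = a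
            · exact ⟨y, by simp, Finset.mem_erase.2 ⟨fun h => h2 (hx.trans h.symm), h1 y (by simp)⟩⟩
            · exact ⟨x, by simp, Finset.mem_erase.2 ⟨hx, h1 x (by simp)⟩⟩)
        (by omega)
        (by
          intro κ hκ hκn Y hY hmeet hin
          have hκ1 : 1 ≤ κ.card := Finset.card_pos.2 hκn
          have haκ : a ∉ κ := fun h => by simpa using hκ h
          have hκA : κ ⊂ A := by
            refine ⟨hκ.trans (Finset.erase_subset _ _), fun h => haκ (h ha)⟩
          have hn2 : ¬ Lk Y (A.erase a) κ := by
            rintro ⟨e, he, heM, x, hx, y, hy, rfl⟩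
            exact hy (hin _ he heM y (by simp))
          rw [if_neg hn2]
          by_cases hl : Lk Y A κ
          · rw [if_pos hl]
            have hYs : Y ⊆ res (insert a κ) E := by
              intro e he
              refine mem_res.2 ⟨hFE (hY he), ?_⟩
              intro y hy
              rw [Finset.mem_insert]
              by_cases hya : y = a
              · exact Or.inl hya
              right
              have hw := hFA e (hY he)
              by_cases hae : a ∈ e
              · obtain ⟨x, hxe, hx⟩ := hmeet e he
                have hxa : x ≠ a := by rintro rfl; exact haκ hx
                obtain ⟨t, rfl⟩ := hae
                rw [Sym2.mem_iff] at hy hxe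
                rcases hy with rfl | rfl
                · exact absurd rfl hya
                · rcases hxe with rfl | rfl
                  · exact absurd rfl hxa
                  · exact hx
              · exact hin e he (fun x hx => Finset.mem_erase.2
                  ⟨by rintro rfl; exact hae hx, hw x hx⟩) y hy
            have hc := Finset.card_insert_of_notMem haκ
            by_cases hiA : insert a κ = A
            · have := Finset.card_le_card hY
              rw [hiA] at hc
              omega
            · have h1 := (ih (insert a κ) (Finset.ssubset_iff_subset_ne.2
                ⟨Finset.insert_subset ha hκA.1, hiA⟩)).2.1 (by omega)
              have := Finset.card_le_card hYs
              omega
          · rw [if_neg hl]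
            have hYs : Y ⊆ res κ E := by
              intro e he
              refine mem_res.2 ⟨hFE (hY he), ?_⟩
              intro y hy
              by_contra hyκ
              apply hl
              obtain ⟨x, hxe, hx⟩ := hmeet e he
              refine ⟨e, he, hFA e (hY he), x, hx, y, hyκ, ?_⟩
              obtain ⟨t, rfl⟩ := hxe
              rw [Sym2.mem_iff] at hy
              rcases hy with rfl | rfl
              · exact absurd hx hyκ
              · rfl
            have h1 := (ih κ hκA).1 hκ1
            have := Finset.card_le_card hYs
            omega)
      have H' : Dec (insert a (A.erase a)) (A.erase a) F T₁ T₂ := by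
        rw [Finset.insert_erase ha]; exact H
      exact thm1 hE (Finset.notMem_erase a A) H'.t1 H'.t2 H'.dj (H'.sub1.trans hFE)
        (H'.sub2.trans hFE) (by omega)
    have h2 : A.card = 2 → (res A E).card ≤ 1 := by
      intro hA
      obtain ⟨x, y, hxy, rfl⟩ := Finset.card_eq_two.1 hA
      have : res {x, y} E ⊆ {s(x, y)} := by
        intro e he
        rw [mem_res] at he
        have h1 := he.2
        have h2 := hN e he.1
        clear he
        induction e using Sym2.ind with
        | _ p q =>
          have hp := h1 p (by simp)
          have hq := h1 q (by simp)
          simp only [Finset.mem_insert, Finset.mem_singleton, Sym2.mk_isDiag_iff, Sym2.eq_iff] at *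
          grind
      simpa using Finset.card_le_card this
    have h1 : A.card = 1 → (res A E).card = 0 := by
      intro hA
      obtain ⟨x, rfl⟩ := Finset.card_eq_one.1 hA
      rw [Finset.card_eq_zero, Finset.eq_empty_iff_forall_notMem]
      intro e he
      rw [mem_res] at he
      have h1 := he.2
      have h2 := hN e he.1
      clear he
      induction e using Sym2.ind with
      | _ p q =>
        have hp := h1 p (by simp)
        have hq := h1 q (by simp)
        simp only [Finset.mem_singleton, Sym2.mk_isDiag_iff] at *
        exact h2 (hp.trans hq.symm)
    refine ⟨fun _ => ?_, fun _ => ?_, h3⟩ <;>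
    · by_cases k1 : A.card = 1
      · have := h1 k1; omega
      by_cases k2 : A.card = 2
      · have := h2 k2; omega
      have := h3 (by omega)
      omega

theorem dec_two [Fintype V] {E : Finset (Sym2 V)} (hE : Red E) (hN : Nd E) {M : Finset V} {u z : V}
    (huz : u ≠ z) (hu : u ∉ M) (hz : z ∉ M) (hM : M.Nonempty) (huzE : s(u, z) ∉ E)
    (hc : (res (insert u (insert z M)) E).card = 2 * M.card) :
    ∃ T₁ T₂, Dec (insert u M) (insert z M) (res (insert u (insert z M)) E) T₁ T₂ := by
  have hcu := Finset.card_insert_of_notMem hu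
  have hcz := Finset.card_insert_of_notMem hz
  set F := res (insert u (insert z M)) E with hF
  have hFw : ∀ a b, s(a, b) ∈ F → a ∈ M → b = u ∨ b = z ∨ b ∈ M := by
    intro a b hab ha
    have := (mem_res.1 hab).2 b (by simp)
    simpa using this
  refine decomp hM (Finset.subset_insert _ _) (Finset.subset_insert _ _) ?_ (by omega) ?_
  · intro e he
    have h1 := (mem_res.1 he).2
    have h2 := hN e (mem_res.1 he).1
    have h3 : e ≠ s(u, z) := by rintro rfl; exact huzE (mem_res.1 he).1
    clear he
    induction e using Sym2.ind with
    | _ x y =>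
      have hx := h1 x (by simp)
      have hy := h1 y (by simp)
      simp only [Finset.mem_insert, Sym2.mk_isDiag_iff, ne_eq, Sym2.eq_iff] at hx hy h2 h3
      by_cases hxM : x ∈ M
      · exact ⟨x, by simp, hxM⟩
      · refine ⟨y, by simp, ?_⟩
        grind
  · intro κ hκ hκn Y hY hmeet hin
    have hκ1 : 1 ≤ κ.card := Finset.card_pos.2 hκn
    have huκ : u ∉ κ := fun h => hu (hκ h)
    have hzκ : z ∉ κ := fun h => hz (hκ h)
    have hYE : ∀ e ∈ Y, e ∈ E := fun e he => (mem_res.1 (hY he)).1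
    -- shape of edges
    have hsh : ∀ e ∈ Y, ∃ a ∈ κ, ∃ b, e = s(a, b) ∧ (b = u ∨ b = z ∨ b ∈ κ) := by
      intro e he
      obtain ⟨x, hxe, hx⟩ := hmeet e he
      obtain ⟨t, rfl⟩ := hxe
      refine ⟨x, hx, t, rfl, ?_⟩
      rcases hFw x t (hY he) (hκ hx) with h | h | h
      · exact Or.inl h
      · exact Or.inr (Or.inl h)
      · right; right
        refine hin _ he ?_ t (by simp)
        intro y hy
        rw [Sym2.mem_iff] at hy
        rcases hy with rfl | rfl
        · exact hκ hx
        · exact h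
    have gen : ∀ A : Finset V, κ ⊆ A → (u ∈ A ∨ ¬ Lk Y (insert u M) κ) →
        (z ∈ A ∨ ¬ Lk Y (insert z M) κ) → Y.card ≤ (res A E).card := by
      intro A hA h1 h2
      apply Finset.card_le_card
      intro e he
      refine mem_res.2 ⟨hYE e he, ?_⟩
      obtain ⟨a, ha, b, rfl, hb⟩ := hsh e he
      have hb' : b ∈ A := by
        rcases hb with rfl | rfl | hb
        · rcases h1 with h1 | h1
          · exact h1
          · refine absurd ⟨_, he, ?_, a, ha, b, huκ, rfl⟩ h1
            intro y hy
            rw [Sym2.mem_iff] at hy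
            rcases hy with rfl | rfl
            · simp [hκ ha]
            · simp
        · rcases h2 with h2 | h2
          · exact h2
          · refine absurd ⟨_, he, ?_, a, ha, b, hzκ, rfl⟩ h2
            intro y hy
            rw [Sym2.mem_iff] at hy
            rcases hy with rfl | rfl
            · simp [hκ ha]
            · simp
        · exact hA hb
      intro y hy
      rw [Sym2.mem_iff] at hy
      rcases hy with rfl | rfl
      · exact hA ha
      · exact hb'
    have c0 := ec_all hE hN κ
    have c1 := ec_all hE hN (insert u κ)
    have c2 := ec_all hE hN (insert z κ)
    have c3 := ec_all hE hN (insert u (insert z κ))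
    have k1 := Finset.card_insert_of_notMem huκ
    have k2 := Finset.card_insert_of_notMem hzκ
    have k3 := Finset.card_insert_of_notMem (show u ∉ insert z κ by simp [huz, huκ])
    by_cases l1 : Lk Y (insert u M) κ <;> by_cases l2 : Lk Y (insert z M) κ
    · rw [if_pos l1, if_pos l2]
      have := gen (insert u (insert z κ)) (by intro x hx; simp [hx]) (by simp) (by simp)
      have := c3.2.2 (by omega)
      omega
    · rw [if_pos l1, if_neg l2]
      have := gen (insert u κ) (by intro x hx; simp [hx]) (by simp) (Or.inr l2)
      have := c1.2.1 (by omega)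
      omega
    · rw [if_neg l1, if_pos l2]
      have := gen (insert z κ) (by intro x hx; simp [hx]) (Or.inr l1) (by simp)
      have := c2.2.1 (by omega)
      omega
    · rw [if_neg l1, if_neg l2]
      have := gen κ (by intro x hx; simp [hx]) (Or.inr l1) (Or.inr l2)
      have := c0.1 (by omega)
      omega

end MG
namespace MG

variable {V : Type}

theorem res_sub {A : Finset V} {T : Finset (Sym2 V)} : res A T ⊆ T := fun _ he => (mem_res.1 he).1

theorem sub_of_insert {A M : Finset V} {u : V} (h : A ⊆ insert u M) (hu : u ∉ A) : A ⊆ M := by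
  intro x hx
  have := h hx
  rw [Finset.mem_insert] at this
  rcases this with rfl | this
  · exact absurd hx hu
  · exact this

/-- the conclusion of theorem 2 -/
def Stars (E : Finset (Sym2 V)) (u z : V) (M : Finset V) : Prop :=
  ∀ T₁ T₂, Tr (insert u M) T₁ → Tr (insert z M) T₂ → Disjoint T₁ T₂ → T₁ ⊆ E → T₂ ⊆ E →
    ∀ s ∈ M, s(u, s) ∈ T₁ ∧ s(z, s) ∈ T₂

theorem stage1 {E : Finset (Sym2 V)} (hE : Red E) {M : Finset V} {Hs : Finset (Sym2 V)} {u z : V}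
    (huz : u ≠ z) (huM : u ∉ M) (hzM : z ∉ M) (hM : 2 ≤ M.card) (hHs : Hs ⊆ E)
    (hNS : NS (insert u M) (insert z M) Hs u)
    (IH : ∀ M', M' ⊆ M → M'.card < M.card → Stars E u z M')
    {T₁ T₂ : Finset (Sym2 V)}
    (H : Dec (insert u M) (insert z M) Hs T₁ T₂) {c₁ : V} {C₁ : Finset V} (hc₁ : s(u, c₁) ∈ T₁)
    (hC₁ : Sd (insert u M) T₁ s(u, c₁) C₁) (huC₁ : u ∉ C₁)
    (hmax : ∀ T₁' T₂' C', Dec (insert u M) (insert z M) Hs T₁' T₂' → s(u, c₁) ∈ T₁' →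
      Sd (insert u M) T₁' s(u, c₁) C' → u ∉ C' → C'.card ≤ C₁.card) :
    (M \ C₁).Nonempty ∧ ∀ s ∈ M \ C₁, s(u, s) ∈ T₁ ∧ s(z, s) ∈ T₂ := by
  have hCM : C₁ ⊆ M := sub_of_insert hC₁.1 huC₁
  have hc₁C := hC₁.mem_root huC₁
  have hzC : z ∉ C₁ := fun hh => hzM (hCM hh)
  have huN : u ∉ insert z M := by simp [huz, huM]
  have hgr : ∀ p q, p ∈ C₁ → q ∈ M → q ∉ C₁ → s(p, q) ∈ T₂ → ∀ D, Sd (insert z M) T₂ s(p, q) D →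
      q ∈ D → p ∉ D → c₁ ∈ D := fun p q h1 h2 h3 h4 D h5 h6 h7 =>
    growth huM (Finset.subset_insert _ _) huN hNS H hc₁ hC₁ huC₁ hmax h1 h2 h3 h4 h5 h6 h7
  have hne : (M \ C₁).Nonempty := by
    rw [Finset.sdiff_nonempty]
    intro hMC
    have : C₁ = M := Finset.Subset.antisymm hCM hMC
    subst this
    exact thm1 hE hzM H.t2 (H.t1.sideTree hC₁) (Finset.disjoint_of_subset_right res_sub H.dj.symm)
      (H.sub2.trans hHs) (res_sub.trans (H.sub1.trans hHs)) hM
  refine ⟨hne, ?_⟩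
  -- R2
  have R2 : ∀ p q, p ∈ C₁ → q ∈ M → q ∉ C₁ → s(p, q) ∈ T₂ → ∀ S, Sd (insert z M) T₂ s(p, q) S →
      z ∉ S → q ∉ S := by
    intro p q hp hqM hq hpq S hS hzS hqS
    have hpS : p ∉ S := by
      have := hS.2.1
      rw [cr_mk] at this
      tauto
    have hcS := hgr p q hp hqM hq hpq S hS hqS hpS
    obtain ⟨p', q', hpq', hp'A, hq'A, hp'C, hq'C, S', hS', hcS', hpS2p, hzS', hqS2p, hprop⟩ :=
      H.t2.firstExit (x := c₁) (r := z) (B := C₁) (by simp [hCM hc₁C]) (by simp) hc₁C hzC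
    have hq'z : q' = z := by
      by_contra hqz
      have hq'M : q' ∈ M := by
        rw [Finset.mem_insert] at hq'A; tauto
      have := hgr p' q' hp'C hq'M hq'C hpq' _ (hS'.compl H.t2.wi hpq') (by simp [hq'M, hqS2p])
        (by simp [hpS2p])
      simp [hcS'] at this
    subst hq'z
    by_cases hp'S : p' ∈ S
    · have := hS.2.2 _ hpq' (by rw [cr_mk]; tauto)
      have hm : q' ∈ s(p, q) := by rw [← this]; simp
      rw [Sym2.mem_iff] at hm
      rcases hm with rfl | rfl
      · exact hzC hp
      · exact hzM hqM
    · exact hq (hprop _ hpq S hS (by tauto) q (by simp))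
  have hlt : (M \ C₁).card < M.card :=
    Finset.card_lt_card (Finset.sdiff_ssubset hCM ⟨c₁, hc₁C⟩)
  have ht1 : Tr (insert u (M \ C₁)) (res (insert u (M \ C₁)) T₁) := by
    have := H.t1.sideTree (hC₁.compl H.t1.wi hc₁)
    rwa [Finset.insert_sdiff_of_notMem _ huC₁] at this
  have ht2 : Tr (insert z (M \ C₁)) (res (insert z (M \ C₁)) T₂) := by
    apply H.t2.ofRes
    apply Cn.ofRoot (fun e he => (mem_res.1 he).2) z
    rintro B hB ⟨x, hx⟩ - hzB
    have hBM : B ⊆ M \ C₁ := sub_of_insert hB hzB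
    have hxM : x ∈ M := (Finset.mem_sdiff.1 (hBM hx)).1
    obtain ⟨p, q, hpq, hpA, hqA, hpB, hqB, S, hS, hxS, hpS, hzS, hqS, -⟩ :=
      H.t2.firstExit (x := x) (r := z) (B := B) (by simp [hxM]) (by simp) hx hzB
    have hpM := Finset.mem_sdiff.1 (hBM hpB)
    have hqC : q ∉ C₁ := by
      intro hqC
      rw [Sym2.eq_swap] at hpq hS
      exact R2 q p hqC hpM.1 hpM.2 hpq S hS hzS hpS
    refine ⟨s(p, q), mem_res.2 ⟨hpq, ?_⟩, by rw [cr_mk]; tauto⟩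
    intro y hy
    rw [Sym2.mem_iff] at hy
    rcases hy with rfl | rfl
    · exact hB hpB
    · rw [Finset.mem_insert] at hqA ⊢
      rw [Finset.mem_sdiff]
      tauto
  intro s hs
  have := IH (M \ C₁) Finset.sdiff_subset hlt _ _ ht1 ht2
    (Finset.disjoint_of_subset_left res_sub (Finset.disjoint_of_subset_right res_sub H.dj))
    (res_sub.trans (H.sub1.trans hHs)) (res_sub.trans (H.sub2.trans hHs)) s hs
  exact ⟨res_sub this.1, res_sub this.2⟩

/-- consequences of badness -/
structure Sit (M : Finset V) (u z : V) (Hs : Finset (Sym2 V)) (ω : V → ZMod 2) (κ : ZMod 2) :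
    Prop where
  ns1 : NS (insert u M) (insert z M) Hs u
  ns2 : NS (insert z M) (insert u M) Hs z
  kap : ∀ T₁ T₂, Dec (insert u M) (insert z M) Hs T₁ T₂ → ∀ s D, s(u, s) ∈ T₁ → s(z, s) ∈ T₂ →
    Sd (insert z M) T₂ s(z, s) D → z ∉ D → ∑ x ∈ D, ω x = κ
  fin : ∀ T₁ T₂, Dec (insert u M) (insert z M) Hs T₁ T₂ → ∀ c C h D', s(u, c) ∈ T₁ → s(z, c) ∈ T₂ →
    Sd (insert u M) T₁ s(u, c) C → u ∉ C → h ∈ T₂ → z ∉ h → cr C h → Sd (insert z M) T₂ h D' →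
    z ∉ D' → c ∉ D' → ∑ x ∈ D', ω x = 0 → False

set_option maxHeartbeats 2000000 in
theorem core {E : Finset (Sym2 V)} (hE : Red E) {M : Finset V} {Hs : Finset (Sym2 V)} {u z : V}
    (huz : u ≠ z) (huM : u ∉ M) (hzM : z ∉ M) (hM : 2 ≤ M.card) (hHs : Hs ⊆ E)
    {ω : V → ZMod 2} {κ : ZMod 2} (sit : Sit M u z Hs ω κ)
    (IH : ∀ M', M' ⊆ M → M'.card < M.card → Stars E u z M')
    {T₁ T₂ : Finset (Sym2 V)}
    (H : Dec (insert u M) (insert z M) Hs T₁ T₂) : ∀ s ∈ M, s(u, s) ∈ T₁ ∧ s(z, s) ∈ T₂ := by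
  have huN : u ∉ insert z M := by simp [huz, huM]
  have hzN : z ∉ insert u M := by simp [huz.symm, hzM]
  have hu1 : ∀ T₁ T₂, Dec (insert u M) (insert z M) Hs T₁ T₂ → ∀ x, s(u, x) ∈ Hs → s(u, x) ∈ T₁ := by
    intro T₁ T₂ H x hx
    rw [← H.un, Finset.mem_union] at hx
    rcases hx with hx | hx
    · exact hx
    · exact absurd (H.t2.wi _ hx u (by simp)) huN
  have hz2 : ∀ T₁ T₂, Dec (insert u M) (insert z M) Hs T₁ T₂ → ∀ x, s(z, x) ∈ Hs → s(z, x) ∈ T₂ := by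
    intro T₁ T₂ H x hx
    rw [← H.un, Finset.mem_union] at hx
    rcases hx with hx | hx
    · exact absurd (H.t1.wi _ hx z (by simp)) hzN
    · exact hx
  have st : ∀ {T₁ T₂ : Finset (Sym2 V)}
    (_ : Dec (insert u M) (insert z M) Hs T₁ T₂) {c₁ : V} {C₁ : Finset V} (_ : s(u, c₁) ∈ T₁)
    (_ : Sd (insert u M) T₁ s(u, c₁) C₁) (_ : u ∉ C₁)
    (_ : ∀ T₁' T₂' C', Dec (insert u M) (insert z M) Hs T₁' T₂' → s(u, c₁) ∈ T₁' →
      Sd (insert u M) T₁' s(u, c₁) C' → u ∉ C' → C'.card ≤ C₁.card),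
    (M \ C₁).Nonempty ∧ ∀ s ∈ M \ C₁, s(u, s) ∈ T₁ ∧ s(z, s) ∈ T₂ :=
    fun H _ _ h1 h2 h3 h4 => stage1 hE huz huM hzM hM hHs sit.ns1 IH H h1 h2 h3 h4
  obtain ⟨m, hm⟩ : M.Nonempty := Finset.card_pos.1 (by omega)
  obtain ⟨c₁, hc₁M, hc₁, -⟩ := H.t1.rootSide huM hm
  have hc₁Hs := H.sub1 hc₁
  obtain ⟨Ta, Tb, C₀, H₀, hc₀, hC₀, huC₀, hmax⟩ := exists_max_dec H hc₁
  have hzc₁ : s(z, c₁) ∈ Hs := by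
    obtain ⟨⟨s, hs⟩, hst⟩ := st H₀ hc₀ hC₀ huC₀ hmax
    have hsC : s ∉ C₀ := (Finset.mem_sdiff.1 hs).2
    have hsc : s ≠ c₁ := by
      rintro rfl
      exact hsC (hC₀.mem_root huC₀)
    obtain ⟨Tc, Td, Cs, H₁, hc, hCs, huCs, hmax'⟩ := exists_max_dec H₀ (hst s hs).1
    have hc1 := hu1 _ _ H₁ _ hc₁Hs
    obtain ⟨C', hC', huC'⟩ := H₁.t1.side hc1 u
    have hdis := root_disj H₁.t1 hc hc1 hCs hC' huCs huC' hsc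
    have hn : c₁ ∉ Cs := by
      intro hh
      have : c₁ ∈ Cs ∩ C' := by simp [hh, hC'.mem_root huC']
      rw [hdis] at this
      simp at this
    exact H₁.sub2 ((st H₁ hc hCs huCs hmax').2 c₁ (by simp [hn, hc₁M])).2
  obtain ⟨D, ⟨T₁', T₂', C, H', hC, huC, hCcard, hD, hzD⟩, hDmax⟩ := max_card (A := insert z M)
    (fun D => ∃ T₁ T₂ C, Dec (insert u M) (insert z M) Hs T₁ T₂ ∧ Sd (insert u M) T₁ s(u, c₁) C ∧
      u ∉ C ∧ C.card = C₀.card ∧ Sd (insert z M) T₂ s(z, c₁) D ∧ z ∉ D)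
    (by
      obtain ⟨D, hD, hz⟩ := H₀.t2.side (hz2 _ _ H₀ _ hzc₁) z
      exact ⟨D, Ta, Tb, C₀, H₀, hC₀, huC₀, rfl, hD, hz⟩)
    (by
      rintro D ⟨_, _, _, _, _, _, _, hS, _⟩
      exact hS.1)
  have huc := hu1 _ _ H' _ hc₁Hs
  have hzc := hz2 _ _ H' _ hzc₁
  obtain ⟨-, hst⟩ := st H' huc hC huC (by rw [hCcard]; exact hmax)
  have hc₁C := hC.mem_root huC
  have hc₁D := hD.mem_root hzD
  have hCM : C ⊆ M := sub_of_insert hC.1 huC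
  have hDM : D ⊆ M := sub_of_insert hD.1 hzD
  suffices hCc : ∀ x ∈ C, x = c₁ by
    intro s hs
    by_cases hsC : s ∈ C
    · rw [hCc s hsC]
      exact ⟨hu1 _ _ H _ hc₁Hs, hz2 _ _ H _ hzc₁⟩
    · have := hst s (by simp [hs, hsC])
      exact ⟨hu1 _ _ H _ (H'.sub1 this.1), hz2 _ _ H _ (H'.sub2 this.2)⟩
  by_contra hCc
  push Not at hCc
  obtain ⟨y₀, hy₀, hy₀c⟩ := hCc
  have hDC : D ⊆ C := by
    intro x hx
    by_contra hxC
    have := hst x (by simp [hDM hx, hxC])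
    have h2 := hD.2.2 _ this.2 (by rw [cr_mk]; tauto)
    rw [Sym2.congr_right] at h2
    subst h2
    exact hxC hc₁C
  have hC2 : 2 ≤ C.card := Finset.one_lt_card.2 ⟨y₀, hy₀, c₁, hc₁C, hy₀c⟩
  obtain ⟨r, hrC, hrD⟩ : ∃ r ∈ C, r ∉ D := by
    by_contra hx
    push Not at hx
    have : D = C := Finset.Subset.antisymm hDC hx
    subst this
    exact two_trees hE (H'.t1.sideTree hC) (H'.t2.sideTree hD)
      (Finset.disjoint_of_subset_left res_sub (Finset.disjoint_of_subset_right res_sub H'.dj))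
      (res_sub.trans (H'.sub1.trans hHs)) (res_sub.trans (H'.sub2.trans hHs)) hC2
  obtain ⟨a, b, hf, haA, hbA, haD, hbD, S₀, hS₀, hcS₀, haS₀, hrS₀, hbS₀, -⟩ :=
    H'.t1.firstExit (x := c₁) (r := r) (B := D) (hC.1 hc₁C) (hC.1 hrC) hc₁D hrD
  have haC := hDC haD
  have hau : a ≠ u := by rintro rfl; exact huC haC
  have hbu : b ≠ u := by
    rintro rfl
    have h1 := hC.2.2 _ hf (by rw [cr_mk]; tauto)
    rw [h1] at hS₀
    have := Sd.unique H'.t1 hS₀ hC (r := b) (by simp) hbS₀ huC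
    subst this
    exact hrS₀ hrC
  have huf : u ∉ s(a, b) := by
    rw [Sym2.mem_iff]
    rintro (h | h)
    · exact hau h.symm
    · exact hbu h.symm
  have hfne : s(u, c₁) ≠ s(a, b) := by
    intro h
    rw [← h] at huf
    simp at huf
  have hbC : b ∈ C := by
    by_contra hbC
    exact hfne (hC.2.2 _ hf (by rw [cr_mk]; tauto)).symm
  have huS₀ : u ∈ S₀ := by
    by_contra hh
    exact hfne (hS₀.2.2 _ huc (by rw [cr_mk]; tauto))
  have hS := hS₀.compl H'.t1.wi hf
  have hSu : u ∉ insert u M \ S₀ := by simp [huS₀]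
  have hSc : c₁ ∉ insert u M \ S₀ := by simp [hcS₀]
  have hSa : a ∉ insert u M \ S₀ := by simp [haS₀]
  have hSb : b ∈ insert u M \ S₀ := Finset.mem_sdiff.2 ⟨hbA, hbS₀⟩
  generalize insert u M \ S₀ = S at hS hSu hSc hSa hSb
  have hSC : S ⊆ C := (root_sub H'.t1 huc hf hC hS huC hSu hfne.symm
    (Finset.nonempty_iff_ne_empty.1 ⟨b, by simp [hbC, hSb]⟩)).1
  have hzS : z ∉ S := fun hh => hzM (hCM (hSC hh))
  obtain ⟨h, hh, hSh, D', hD', hbD', hzD'⟩ := H'.t2.path (x := b) (r := z) (P := S)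
    (by simp [hCM hbC]) (by simp) hSb hzS
  have hDf : cr D s(a, b) := by rw [cr_mk]; tauto
  by_cases hzh : z ∈ h
  · obtain ⟨y, rfl⟩ := hzh
    change s(z, y) ∈ T₂' at hh
    change cr S s(z, y) at hSh
    change Sd _ _ s(z, y) _ at hD'
    have hyS : y ∈ S := by
      rw [cr_mk] at hSh
      tauto
    have hyc : y ≠ c₁ := by rintro rfl; exact hSc hyS
    have hdis := root_disj H'.t2 hh hzc hD' hD hzD' hzD hyc
    have haD' : a ∉ D' := by
      intro k
      have : a ∈ D' ∩ D := by simp [k, haD]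
      rw [hdis] at this
      simp at this
    exact hSc (sit.ns2 _ _ H'.symm y c₁ D' D s(a, b) S hyc hh hzc hD' hzD' hD hzD hf
      (by rw [cr_mk]; tauto) hDf hS hyS)
  have hhne : h ≠ s(z, c₁) := by rintro rfl; simp at hzh
  have hcD' : c₁ ∉ D' := fun k => hhne (hD'.2.2 _ hzc (by rw [cr_mk]; tauto)).symm
  have hdis : D ∩ D' = ∅ := by
    by_contra k
    exact hbD ((root_sub H'.t2 hzc hh hD hD' hzD hzD' hhne k).1 hbD')
  have haD' : a ∉ D' := by
    intro k
    have : a ∈ D ∩ D' := by simp [k, haD]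
    rw [hdis] at this
    simp at this
  have hD'f : cr D' s(a, b) := by rw [cr_mk]; tauto
  have hhM : ∀ x ∈ h, x ∈ M := by
    intro x hx
    have := H'.t2.wi h hh x hx
    rw [Finset.mem_insert] at this
    rcases this with rfl | this
    · exact absurd hx hzh
    · exact this
  have hfM : ∀ x ∈ s(a, b), x ∈ M := by
    intro x hx
    rw [Sym2.mem_iff] at hx
    rcases hx with rfl | rfl
    · exact hCM haC
    · exact hCM hbC
  have hsw := H'.swap hf hS hh hD' hSh hD'f (fun x hx => by simp [hhM x hx])
    (fun x hx => by simp [hfM x hx])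
  by_cases hCh : cr C h
  · obtain ⟨p, hp, s, hs, rfl⟩ := hCh
    have hsM : s ∈ M := hhM s (by simp)
    obtain ⟨hus, hzs⟩ := hst s (by simp [hs, hsM])
    have hsc : c₁ ≠ s := by rintro rfl; exact hs hc₁C
    obtain ⟨Ds, hDs, hzDs⟩ := H'.t2.side hzs z
    have hsDs := hDs.mem_root hzDs
    have hhne2 : s(p, s) ≠ s(z, s) := by
      intro k
      rw [k] at hzh
      simp at hzh
    have hpDs : p ∈ Ds := by
      by_contra k
      exact hhne2 (hDs.2.2 _ hh (by rw [cr_mk]; tauto))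
    have hnemp : Ds ∩ D' ≠ ∅ := by
      rw [← Finset.nonempty_iff_ne_empty]
      have := hD'.2.1
      rw [cr_mk] at this
      rcases this with k | k
      · exact ⟨p, by simp [hpDs, k.1]⟩
      · exact ⟨s, by simp [hsDs, k.2]⟩
    have hsub := (root_sub H'.t2 hzs hh hDs hD' hzDs hzD' hhne2 hnemp).1
    have hdis2 := root_disj H'.t2 hzc hzs hD hDs hzD hzDs hsc
    have haDs : a ∉ Ds := by
      intro k
      have : a ∈ D ∩ Ds := by simp [k, haD]
      rw [hdis2] at this
      simp at this
    have hDsf : cr Ds s(a, b) := by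
      have := hsub hbD'
      rw [cr_mk]; tauto
    have hnew := hDs.exch_yes hzs hhne2.symm hD' hDsf hD'f
    have k1 := sit.kap _ _ H' s Ds hus hzs hDs hzDs
    have k2 := sit.kap _ _ hsw s _ (by
      rw [Finset.mem_insert, Finset.mem_erase]
      refine Or.inr ⟨?_, hus⟩
      intro k
      rw [← k] at huf
      simp at huf) (by
      rw [Finset.mem_insert, Finset.mem_erase]
      exact Or.inr ⟨hhne2.symm, hzs⟩) hnew (by simp [Finset.mem_symmDiff, hzDs, hzD'])
    rw [sum_symm, k1] at k2
    exact sit.fin _ _ H' c₁ C _ D' huc hzc hC huC hh hzh (by rw [cr_mk]; tauto) hD' hzD' hcD'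
      (by simpa using k2)
  · have hnew := hD.exch_yes hzc hhne.symm hD' hDf hD'f
    rw [symmDiff_disj hdis] at hnew
    have := hDmax (D ∪ D') ⟨_, _, C, hsw, hC.exch_no hCh, huC, hCcard, hnew, by simp [hzD, hzD']⟩
    rw [Finset.card_union_of_disjoint (Finset.disjoint_iff_inter_eq_empty.2 hdis)] at this
    have : 0 < D'.card := Finset.card_pos.2 ⟨b, hbD'⟩
    omega

end MG
namespace MG

variable {V : Type}

def Bad1 (M : Finset V) (u z : V) (Hs : Finset (Sym2 V)) (ω : V → ZMod 2) : Prop :=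
  ω u = 1 ∧ ω z = 1 ∧ ∑ x ∈ M, ω x = 0 ∧ ∀ J ⊆ Hs, (∀ x ∈ M, dg J x = ω x) → dg J u = 1 →
    dg J z = 1 → ¬ Cn (insert u (insert z M)) (insert s(u, z) (Hs \ J))

def Bad2 (M : Finset V) (u z : V) (Hs : Finset (Sym2 V)) (ω : V → ZMod 2) : Prop :=
  ∀ J ⊆ Hs, (∀ x ∈ M, dg J x = ω x) → ¬ Cn (insert u (insert z M)) (Hs \ J)

theorem Bad1.symm {M : Finset V} {u z : V} {Hs : Finset (Sym2 V)} {ω : V → ZMod 2}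
    (h : Bad1 M u z Hs ω) : Bad1 M z u Hs ω := by
  obtain ⟨h1, h2, h3, h4⟩ := h
  refine ⟨h2, h1, h3, fun J hJ k1 k2 k3 k4 => h4 J hJ k1 k3 k2 ?_⟩
  rwa [Finset.insert_comm, Sym2.eq_swap]

theorem Bad2.symm {M : Finset V} {u z : V} {Hs : Finset (Sym2 V)} {ω : V → ZMod 2}
    (h : Bad2 M u z Hs ω) : Bad2 M z u Hs ω := by
  intro J hJ k1 k2
  refine h J hJ k1 ?_
  rwa [Finset.insert_comm]

theorem Sd.root_ne {A : Finset V} {T : Finset (Sym2 V)} {u c : V} {C : Finset V}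
    (hC : Sd A T s(u, c) C) : u ≠ c := by
  rintro rfl
  exact hC.2.1.nd (by simp)

theorem mem_of_insert {M : Finset V} {u c : V} (h : c ∈ insert u M) (hne : u ≠ c) : c ∈ M := by
  rw [Finset.mem_insert] at h
  rcases h with rfl | h
  · exact absurd rfl hne
  · exact h

theorem sum_add_dl (ω : V → ZMod 2) (D : Finset V) (c : V) :
    ∑ x ∈ D, (ω x + dl c x) = ∑ x ∈ D, ω x + if c ∈ D then 1 else 0 := by
  rw [Finset.sum_add_distrib, sum_dl]

theorem key1 {M : Finset V} {u z : V} {Hs : Finset (Sym2 V)} {ω : V → ZMod 2}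
    (huz : u ≠ z) (huM : u ∉ M) (hzM : z ∉ M) (hb : Bad1 M u z Hs ω) {T₁ T₂ : Finset (Sym2 V)}
    (H : Dec (insert u M) (insert z M) Hs T₁ T₂) {c : V} {C D : Finset V} {g : Sym2 V}
    (hc : s(u, c) ∈ T₁) (hC : Sd (insert u M) T₁ s(u, c) C) (huC : u ∉ C) (hg : g ∈ T₂)
    (hCg : cr C g) (hD : Sd (insert z M) T₂ g D)
    (hs : ∑ x ∈ D, (ω x + dl c x) = 0) : False := by
  obtain ⟨hωu, hωz, hωM, hb⟩ := hb
  have huc : u ≠ c := hC.root_ne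
  have hcM : c ∈ M := mem_of_insert (H.t1.wi _ hc c (by simp)) huc
  have hzN : z ∉ insert u M := by simp [huz.symm, hzM]
  have huN : u ∉ insert z M := by simp [huz, huM]
  have hzc : z ≠ c := by rintro rfl; exact hzM hcM
  obtain ⟨J', hJ', hJd⟩ := H.t2.join (fun x => ω x + dl c x) (by
    rw [Finset.sum_insert hzM, sum_add_dl, hωz, hωM]
    simp [dl, hzc, hcM]
    exact z2 1)
  have hgJ : g ∉ J' := by
    intro hh
    have := join_side H.t2 hD hJ' hJd
    rw [hs] at this
    simp [hh] at this
  have hucJ : s(u, c) ∉ J' := fun hh => Finset.disjoint_left.1 H.dj hc (hJ' hh)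
  have hJu : dg J' u = 0 := dg_zero fun e he hue => huN (H.t2.wi e (hJ' he) u hue)
  have hd : ∀ x, dg (insert s(u, c) J') x = dl u x + dl c x + dg J' x := by
    intro x
    rw [dg_insert hucJ, dg_mk huc]
  have hJs : insert s(u, c) J' ⊆ Hs := by
    intro e he
    rw [Finset.mem_insert] at he
    rcases he with rfl | he
    · exact H.sub1 hc
    · exact H.sub2 (hJ' he)
  refine hb (insert s(u, c) J') hJs ?_ ?_ ?_ ?_
  · intro x hx
    have hxu : x ≠ u := by rintro rfl; exact huM hx
    rw [hd, hJd x (by simp [hx])]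
    have : dl u x = 0 := by simp [dl, hxu]
    rw [this]
    linear_combination z2 (dl c x)
  · rw [hd, hJu]
    simp [dl, huc]
  · rw [hd, hJd z (by simp), hωz]
    simp [dl, hzc, huz.symm]
  · have ht := H.t1.addLeaf hzN (c := u) (by simp)
    have hne : s(u, c) ∈ insert s(z, u) T₁ := by simp [hc]
    have hgw : ∀ x ∈ g, x ∈ insert z (insert u M) := by
      intro x hx
      have := H.t2.wi g hg x hx
      simp only [Finset.mem_insert] at this ⊢
      tauto
    have hx := (ht.exchange hne (hC.leaf_out hzN huC) hgw hCg).cn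
    rw [Finset.insert_comm]
    refine hx.mono ?_
    intro e he
    rw [Finset.mem_insert, Finset.mem_erase, Finset.mem_insert] at he
    rw [Finset.mem_insert, Finset.mem_sdiff, Finset.mem_insert]
    rcases he with rfl | ⟨he1, rfl | he⟩
    · refine Or.inr ⟨H.sub2 hg, ?_⟩
      rintro (k | k)
      · rw [k] at hg
        exact Finset.disjoint_left.1 H.dj hc hg
      · exact hgJ k
    · exact Or.inl Sym2.eq_swap
    · refine Or.inr ⟨H.sub1 he, ?_⟩
      rintro (k | k)
      · exact he1 k
      · exact Finset.disjoint_left.1 H.dj he (hJ' k)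

theorem ns_i {M : Finset V} {u z : V} {Hs : Finset (Sym2 V)} {ω : V → ZMod 2}
    (huz : u ≠ z) (huM : u ∉ M) (hzM : z ∉ M) (hb : Bad1 M u z Hs ω) :
    NS (insert u M) (insert z M) Hs u := by
  intro T₁ T₂ H c₁ c₂ C₁ C₂ g D hne hc₁ hc₂ hC₁ hu₁ hC₂ hu₂ hg hg1 hg2 hD hc₁D
  by_contra hc₂D
  rcases z2or (∑ x ∈ D, ω x) with h0 | h0
  · exact key1 huz huM hzM hb H hc₂ hC₂ hu₂ hg hg2 hD (by rw [sum_add_dl, h0]; simp [hc₂D])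
  · exact key1 huz huM hzM hb H hc₁ hC₁ hu₁ hg hg1 hD
      (by rw [sum_add_dl, h0]; simp [hc₁D]; exact z2 1)

theorem sit_i {M : Finset V} {u z : V} {Hs : Finset (Sym2 V)} {ω : V → ZMod 2}
    (huz : u ≠ z) (huM : u ∉ M) (hzM : z ∉ M) (hb : Bad1 M u z Hs ω) : Sit M u z Hs ω 0 := by
  refine ⟨ns_i huz huM hzM hb, ns_i huz.symm hzM huM hb.symm, ?_, ?_⟩
  · intro T₁ T₂ H s D hus hzs hD hzD
    obtain ⟨C, hC, huC⟩ := H.t1.side hus u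
    have hsC := hC.mem_root huC
    have hzC : z ∉ C := by
      intro k
      have := hC.1 k
      simp [huz.symm, hzM] at this
    rcases z2or (∑ x ∈ D, ω x) with h0 | h0
    · exact h0
    · exact (key1 huz huM hzM hb H hus hC huC hzs (by rw [cr_mk]; tauto) hD
        (by rw [sum_add_dl, h0]; simp [hD.mem_root hzD]; exact z2 1)).elim
  · intro T₁ T₂ H c C h D' hc _ hC huC hh _ hCh hD' _ hcD' h0
    exact key1 huz huM hzM hb H hc hC huC hh hCh hD' (by rw [sum_add_dl, h0]; simp [hcD'])

/-- join with free value at the root -/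
theorem Tr.joinFree {M : Finset V} {T : Finset (Sym2 V)} {u : V} (h : Tr (insert u M) T)
    (huM : u ∉ M) (ω : V → ZMod 2) : ∃ J ⊆ T, (∀ x ∈ M, dg J x = ω x) ∧
      ∀ g D, Sd (insert u M) T g D → u ∉ D → ∑ x ∈ D, ω x = 0 → g ∉ J := by
  set ω' : V → ZMod 2 := fun x => if x = u then ∑ y ∈ M, ω y else ω x with hω'
  have hag : ∀ D : Finset V, u ∉ D → ∑ x ∈ D, ω' x = ∑ x ∈ D, ω x := by
    intro D hD
    refine Finset.sum_congr rfl fun x hx => ?_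
    have : x ≠ u := by rintro rfl; exact hD hx
    simp [hω', this]
  obtain ⟨J, hJ, hJd⟩ := h.join ω' (by
    rw [Finset.sum_insert huM, hag M huM]
    simp only [hω', if_true]
    exact z2 _)
  refine ⟨J, hJ, ?_, ?_⟩
  · intro x hx
    have : x ≠ u := by rintro rfl; exact huM hx
    rw [hJd x (by simp [hx])]
    simp [hω', this]
  · intro g D hD huD h0 hgJ
    have := join_side h hD hJ hJd
    rw [hag D huD, h0] at this
    simp [hgJ] at this

theorem sum_ii {M : Finset V} {u z : V} {Hs : Finset (Sym2 V)} {ω : V → ZMod 2}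
    (huz : u ≠ z) (huM : u ∉ M) (hb : Bad2 M u z Hs ω) {T₁ T₂ : Finset (Sym2 V)}
    (H : Dec (insert u M) (insert z M) Hs T₁ T₂) {c : V} {C : Finset V}
    (hc : s(u, c) ∈ T₁) (hC : Sd (insert u M) T₁ s(u, c) C) (huC : u ∉ C) :
    ∑ x ∈ C, ω x = 1 := by
  rcases z2or (∑ x ∈ C, ω x) with h0 | h0
  swap
  · exact h0
  exfalso
  have huc : u ≠ c := hC.root_ne
  have hcM : c ∈ M := mem_of_insert (H.t1.wi _ hc c (by simp)) huc
  have huN : u ∉ insert z M := by simp [huz, huM]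
  obtain ⟨J, hJ, hJd, hJn⟩ := H.t1.joinFree huM ω
  refine hb J (hJ.trans H.sub1) hJd ((H.t2.addLeaf huN (c := c) (by simp [hcM])).cn.mono ?_)
  intro e he
  rw [Finset.mem_insert] at he
  rw [Finset.mem_sdiff]
  rcases he with rfl | he
  · exact ⟨H.sub1 hc, hJn _ _ hC huC h0⟩
  · exact ⟨H.sub2 he, fun k => Finset.disjoint_left.1 H.dj (hJ k) he⟩

theorem cr_two {C₁ C₂ : Finset V} {g : Sym2 V} (hd : C₁ ∩ C₂ = ∅) (h1 : cr C₁ g) (h2 : cr C₂ g) :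
    ∀ x ∈ g, x ∈ C₁ ∨ x ∈ C₂ := by
  have hd' : ∀ x, x ∈ C₁ → x ∈ C₂ → False := by
    intro x k1 k2
    have : x ∈ C₁ ∩ C₂ := by simp [k1, k2]
    rw [hd] at this
    simp at this
  induction g using Sym2.ind with
  | _ a b =>
    rw [cr_mk] at h1 h2
    have ha := hd' a
    have hb := hd' b
    intro x hx
    rw [Sym2.mem_iff] at hx
    rcases hx with rfl | rfl
    · tauto
    · tauto

theorem ns_ii {M : Finset V} {u z : V} {Hs : Finset (Sym2 V)} {ω : V → ZMod 2}
    (huz : u ≠ z) (huM : u ∉ M) (hb : Bad2 M u z Hs ω) :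
    NS (insert u M) (insert z M) Hs u := by
  intro T₁ T₂ H c₁ c₂ C₁ C₂ g D hne hc₁ hc₂ hC₁ hu₁ hC₂ hu₂ hg hg1 hg2 hD hc₁D
  by_contra hc₂D
  have huN : u ∉ insert z M := by simp [huz, huM]
  have hug : u ∉ g := fun k => huN (H.t2.wi g hg u k)
  have huD : u ∉ D := fun k => huN (hD.1 k)
  have hdis := root_disj H.t1 hc₁ hc₂ hC₁ hC₂ hu₁ hu₂ hne
  have hgw : ∀ x ∈ g, x ∈ insert u M := by
    intro x hx
    rcases cr_two hdis hg1 hg2 x hx with k | k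
    · exact hC₁.1 k
    · exact hC₂.1 k
  have hc₁M : c₁ ∈ M := mem_of_insert (H.t1.wi _ hc₁ c₁ (by simp)) hC₁.root_ne
  have hc₂M : c₂ ∈ M := mem_of_insert (H.t1.wi _ hc₂ c₂ (by simp)) hC₂.root_ne
  have ht := H.t1.exchange hc₁ hC₁ hgw hg1
  have hnew := hC₂.exch_yes hc₂ (s_ne hne.symm) hC₁ hg2 hg1
  obtain ⟨J, hJ, hJd, hJn⟩ := ht.joinFree huM ω
  have hJc₂ := hJn _ _ hnew (by simp [Finset.mem_symmDiff, hu₁, hu₂]) (by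
    rw [sum_symm, sum_ii huz huM hb H hc₁ hC₁ hu₁, sum_ii huz huM hb H hc₂ hC₂ hu₂]
    exact z2 1)
  have hx := ((H.t2.addLeaf huN (c := c₁) (by simp [hc₁M])).exchange (g := g) (f := s(u, c₂))
    (by simp [hg]) (hD.leaf_in H.t2.wi hg huN hc₁D) (by
      intro x hx
      rw [Sym2.mem_iff] at hx
      rcases hx with rfl | rfl
      · simp
      · simp [hc₂M]) (by
      rw [cr_mk]
      refine Or.inl ⟨by simp, ?_⟩
      rw [Finset.mem_insert]
      rintro (k | k)
      · exact hC₂.root_ne k.symm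
      · exact hc₂D k)).cn
  have hJm : ∀ e ∈ J, e = g ∨ (e ≠ s(u, c₁) ∧ e ∈ T₁) := by
    intro e he
    have := hJ he
    rwa [Finset.mem_insert, Finset.mem_erase] at this
  refine hb J ?_ hJd (hx.mono ?_)
  · intro e he
    rcases hJm e he with rfl | k
    · exact H.sub2 hg
    · exact H.sub1 k.2
  · intro e he
    rw [Finset.mem_insert, Finset.mem_erase, Finset.mem_insert] at he
    rw [Finset.mem_sdiff]
    rcases he with rfl | ⟨he1, rfl | he⟩
    · exact ⟨H.sub1 hc₂, hJc₂⟩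
    · refine ⟨H.sub1 hc₁, fun k => ?_⟩
      rcases hJm _ k with k | k
      · rw [← k] at hug
        simp at hug
      · exact k.1 rfl
    · refine ⟨H.sub2 he, fun k => ?_⟩
      rcases hJm _ k with k | k
      · exact he1 k
      · exact Finset.disjoint_left.1 H.dj k.2 he

theorem sit_ii {M : Finset V} {u z : V} {Hs : Finset (Sym2 V)} {ω : V → ZMod 2}
    (huz : u ≠ z) (huM : u ∉ M) (hzM : z ∉ M) (hb : Bad2 M u z Hs ω) : Sit M u z Hs ω 1 := by
  refine ⟨ns_ii huz huM hb, ns_ii huz.symm hzM hb.symm, ?_, ?_⟩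
  · intro T₁ T₂ H s D hus hzs hD hzD
    exact sum_ii huz.symm hzM hb.symm H.symm hzs hD hzD
  · intro T₁ T₂ H c C h D' hc hzc hC huC hh hzh hCh hD' hzD' hcD' h0
    have huc : u ≠ c := hC.root_ne
    have hcM : c ∈ M := mem_of_insert (H.t1.wi _ hc c (by simp)) huc
    have hzN : z ∉ insert u M := by simp [huz.symm, hzM]
    obtain ⟨D, hD, hzD⟩ := H.t2.side hzc z
    obtain ⟨J', hJ', hJd, hJn⟩ := H.t2.joinFree hzM (fun x => ω x + dl c x)
    have hhJ := hJn h D' hD' hzD' (by rw [sum_add_dl, h0]; simp [hcD'])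
    have hzJ := hJn _ D hD hzD (by
      rw [sum_add_dl, sum_ii huz.symm hzM hb.symm H.symm hzc hD hzD]
      simp [hD.mem_root hzD]
      exact z2 1)
    have hucJ : s(u, c) ∉ J' := fun hh => Finset.disjoint_left.1 H.dj hc (hJ' hh)
    have hgw : ∀ x ∈ h, x ∈ insert u M := by
      intro x hx
      rw [Finset.mem_insert]
      refine Or.inr (mem_of_insert (H.t2.wi h hh x hx) ?_)
      rintro rfl
      exact hzh hx
    have hcon := ((H.t1.exchange hc hC hgw hCh).addLeaf hzN (c := c) (by simp [hcM])).cn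
    rw [Finset.insert_comm] at hcon
    refine hb (insert s(u, c) J') ?_ ?_ (hcon.mono ?_)
    · intro e he
      rw [Finset.mem_insert] at he
      rcases he with rfl | he
      · exact H.sub1 hc
      · exact H.sub2 (hJ' he)
    · intro x hx
      have hxu : x ≠ u := by rintro rfl; exact huM hx
      rw [dg_insert hucJ, dg_mk huc, hJd x hx]
      have : dl u x = 0 := by simp [dl, hxu]
      rw [this]
      linear_combination z2 (dl c x)
    · intro e he
      rw [Finset.mem_insert, Finset.mem_insert, Finset.mem_erase] at he
      rw [Finset.mem_sdiff, Finset.mem_insert]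
      have hdj := @Finset.disjoint_left _ _ _ |>.1 H.dj
      rcases he with rfl | rfl | ⟨he1, he⟩
      · refine ⟨H.sub2 hzc, ?_⟩
        rintro (k | k)
        · rw [k] at hzc
          exact hdj hc hzc
        · exact hzJ k
      · refine ⟨H.sub2 hh, ?_⟩
        rintro (k | k)
        · rw [k] at hh
          exact hdj hc hh
        · exact hhJ k
      · refine ⟨H.sub1 he, ?_⟩
        rintro (k | k)
        · exact he1 k
        · exact hdj he (hJ' k)

end MG
namespace MG

variable {V : Type}

theorem cn_leaf {A : Finset V} {F : Finset (Sym2 V)} {a c : V} (h : Wi A F ∧ Cn A F) (hc : c ∈ A) :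
    Wi (insert a A) (insert s(a, c) F) ∧ Cn (insert a A) (insert s(a, c) F) := by
  obtain ⟨hw, hcn⟩ := h
  constructor
  · intro e he x hx
    rw [Finset.mem_insert] at he
    rcases he with rfl | he
    · rw [Sym2.mem_iff] at hx
      rcases hx with rfl | rfl
      · simp
      · simp [hc]
    · simp [hw e he x hx]
  · intro B hB hn hne
    by_cases hac : cr B s(a, c)
    · exact ⟨_, by simp, hac⟩
    rw [cr_mk] at hac
    have hiff : a ∈ B ↔ c ∈ B := by tauto
    obtain ⟨e, he, hce⟩ := hcn (B ∩ A) Finset.inter_subset_right (by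
      obtain ⟨x, hx⟩ := hn
      have := hB hx
      rw [Finset.mem_insert] at this
      rcases this with rfl | this
      · exact ⟨c, by simp [hc, hiff.1 hx]⟩
      · exact ⟨x, by simp [hx, this]⟩) (by
      intro h
      apply hne
      apply Finset.Subset.antisymm hB
      have hAB : A ⊆ B := Finset.inter_eq_right.1 h
      exact Finset.insert_subset (hiff.2 (hAB hc)) hAB)
    refine ⟨e, by simp [he], ?_⟩
    rcases cr_inter hce with k | k
    · exact k
    · obtain ⟨x, hx, y, hy, rfl⟩ := k
      exact absurd (hw _ he y (by simp)) hy

theorem cn_cycle {A : Finset V} {F : Finset (Sym2 V)} {u z v w : V} (hw : Wi A F)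
    (hcn : Cn A (insert s(u, z) F)) (hu : u ∈ A) (hz : z ∈ A) {F' : Finset (Sym2 V)} (hF : F ⊆ F')
    (h1 : s(u, v) ∈ F') (h2 : s(v, z) ∈ F') (h3 : s(z, w) ∈ F') :
    Cn (insert v (insert w A)) F' := by
  intro B hB hn hne
  by_contra hno
  push Not at hno
  have k1 := hno _ h1
  have k2 := hno _ h2
  have k3 := hno _ h3
  rw [cr_mk] at k1 k2 k3
  have i1 : u ∈ B ↔ v ∈ B := by clear k2 k3; tauto
  have i2 : v ∈ B ↔ z ∈ B := by clear k1 k3; tauto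
  have i3 : z ∈ B ↔ w ∈ B := by clear k1 k2; tauto
  obtain ⟨e, he, hce⟩ := hcn (B ∩ A) Finset.inter_subset_right (by
    obtain ⟨x, hx⟩ := hn
    have := hB hx
    simp only [Finset.mem_insert] at this
    rcases this with rfl | rfl | this
    · exact ⟨u, by simp [hu, i1, hx]⟩
    · exact ⟨z, by simp [hz, i3, hx]⟩
    · exact ⟨x, by simp [hx, this]⟩) (by
    intro h
    apply hne
    apply Finset.Subset.antisymm hB
    have hAB : A ⊆ B := Finset.inter_eq_right.1 h
    exact Finset.insert_subset (i1.1 (hAB hu)) (Finset.insert_subset (i3.1 (hAB hz)) hAB))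
  rw [Finset.mem_insert] at he
  rcases he with rfl | he
  · rw [cr_mk, Finset.mem_inter, Finset.mem_inter] at hce
    have : u ∈ B ↔ z ∈ B := i1.trans i2
    tauto
  · rcases cr_inter hce with k | k
    · exact hno e (hF he) k
    · obtain ⟨x, hx, y, hy, rfl⟩ := k
      exact absurd (hw _ he y (by simp)) hy

/-- setting of theorem 2 -/
structure Cyc (M : Finset V) (u v z w : V) (F Hs : Finset (Sym2 V)) : Prop where
  uv : u ≠ v
  uz : u ≠ z
  uw : u ≠ w
  vz : v ≠ z
  vw : v ≠ w
  zw : z ≠ w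
  uM : u ∉ M
  vM : v ∉ M
  zM : z ∉ M
  wM : w ∉ M
  hs : Hs ⊆ F
  e1 : s(u, v) ∈ F
  e2 : s(v, z) ∈ F
  e3 : s(z, w) ∈ F
  e4 : s(w, u) ∈ F

theorem Cyc.flip {M : Finset V} {u v z w : V} {F Hs : Finset (Sym2 V)} (h : Cyc M u v z w F Hs) :
    Cyc M u w z v F Hs :=
  ⟨h.uw, h.uz, h.uv, h.zw.symm, h.vw.symm, h.vz.symm, h.uM, h.wM, h.zM, h.vM, h.hs,
    by rw [Sym2.eq_swap]; exact h.e4, by rw [Sym2.eq_swap]; exact h.e3,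
    by rw [Sym2.eq_swap]; exact h.e2, by rw [Sym2.eq_swap]; exact h.e1⟩

theorem Cyc.rot {M : Finset V} {u v z w : V} {F Hs : Finset (Sym2 V)} (h : Cyc M u v z w F Hs) :
    Cyc M z v u w F Hs :=
  ⟨h.vz.symm, h.uz.symm, h.zw, h.uv.symm, h.vw, h.uw, h.zM, h.vM, h.uM, h.wM, h.hs,
    by rw [Sym2.eq_swap]; exact h.e2, by rw [Sym2.eq_swap]; exact h.e1,
    by rw [Sym2.eq_swap]; exact h.e4, by rw [Sym2.eq_swap]; exact h.e3⟩

theorem e_notin {A : Finset V} {T : Finset (Sym2 V)} (h : Wi A T) {v : V} (hv : v ∉ A) {e : Sym2 V}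
    (he : v ∈ e) : e ∉ T := fun k => hv (h e k v he)

theorem sub_cyc {F T J : Finset (Sym2 V)} (h : ∀ e ∈ T, e ∈ F ∧ e ∉ J) : T ⊆ F \ J :=
  fun e he => Finset.mem_sdiff.2 (h e he)

theorem bad_mix {M : Finset V} {u v z w : V} {F Hs : Finset (Sym2 V)} (h : Cyc M u v z w F Hs)
    {T₁ T₂ : Finset (Sym2 V)} (H : Dec (insert u M) (insert z M) Hs T₁ T₂) {ω : V → ZMod 2}
    (hsum : ω v + (ω w + (ω u + (ω z + ∑ x ∈ M, ω x))) = 0)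
    (hb : ∀ J ⊆ F, (∀ x ∈ insert v (insert w (insert u (insert z M))), dg J x = ω x) →
      ¬ Cn (insert v (insert w (insert u (insert z M)))) (F \ J))
    (hv : ω v = 1) (hw : ω w = 0) : False := by
  have huN : u ∉ insert z M := by simp [h.uz, h.uM]
  have hvN : v ∉ insert z M := by simp [h.vz, h.vM]
  have hwN : w ∉ insert z M := by simp [h.zw.symm, h.wM]
  have hwN1 : w ∉ insert u M := by simp [h.uw.symm, h.wM]
  have hvN1 : v ∉ insert u M := by simp [h.uv.symm, h.vM]
  have hT : ∀ a c, c ∈ insert z (insert w (insert u M)) → Cn (insert a (insert z (insert w (insert u M))))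
      (insert s(a, c) (insert s(z, w) (insert s(w, u) T₁))) := by
    intro a c hc
    exact (cn_leaf (cn_leaf (cn_leaf ⟨H.t1.wi, H.t1.cn⟩ (by simp)) (by simp)) hc).2
  have hset : insert v (insert z (insert w (insert u M))) =
      insert v (insert w (insert u (insert z M))) := by
    ext x; simp only [Finset.mem_insert]; tauto
  have hd : ∀ J' ⊆ T₂, dg J' u = 0 ∧ dg J' v = 0 ∧ dg J' w = 0 := fun J' hJ' =>
    ⟨dg_zero fun e he k => huN (H.t2.wi e (hJ' he) _ k),
     dg_zero fun e he k => hvN (H.t2.wi e (hJ' he) _ k),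
     dg_zero fun e he k => hwN (H.t2.wi e (hJ' he) _ k)⟩
  have hne : ∀ x ∈ M, x ≠ u ∧ x ≠ v ∧ x ≠ z ∧ x ≠ w := by
    intro x hx
    refine ⟨?_, ?_, ?_, ?_⟩
    · rintro rfl; exact h.uM hx
    · rintro rfl; exact h.vM hx
    · rintro rfl; exact h.zM hx
    · rintro rfl; exact h.wM hx
  have hdj := Finset.disjoint_left.1 H.dj
  have hwT1 : ∀ e ∈ T₁, w ∉ e := fun e he k => hwN1 (H.t1.wi e he w k)
  have hvT1 : ∀ e ∈ T₁, v ∉ e := fun e he k => hvN1 (H.t1.wi e he v k)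
  have hwT2 : ∀ e ∈ T₂, w ∉ e := fun e he k => hwN (H.t2.wi e he w k)
  have hvT2 : ∀ e ∈ T₂, v ∉ e := fun e he k => hvN (H.t2.wi e he v k)
  rcases z2or (ω u) with hu | hu
  · obtain ⟨J', hJ', hJd⟩ := H.t2.join (fun x => ω x + dl z x) (by
      rw [Finset.sum_insert h.zM, sum_add_dl]
      simp only [h.zM, if_false, dl, if_true]
      rw [hv, hw, hu] at hsum
      linear_combination hsum)
    obtain ⟨d1, d2, d3⟩ := hd J' hJ'
    have hn : s(v, z) ∉ J' := fun k => hvT2 _ (hJ' k) (by simp)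
    have hnv := dg_insert hn
    simp only [dg_mk h.vz] at hnv
    refine hb (insert s(v, z) J') ?_ ?_ ?_
    · exact Finset.insert_subset h.e2 (hJ'.trans (H.sub2.trans h.hs))
    · intro x hx
      simp only [Finset.mem_insert] at hx
      rw [hnv]
      rcases hx with rfl | rfl | rfl | rfl | hx
      · rw [d2, hv]; simp [dl, h.vz]
      · rw [d3, hw]; simp [dl, h.vw.symm, h.zw.symm]
      · rw [d1, hu]; simp [dl, h.uv, h.uz]
      · rw [hJd _ (by simp)]; simp [dl, h.vz.symm]
        linear_combination z2 1
      · rw [hJd _ (by simp [hx])]; simp [dl, hne x hx]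
    · have := hT v u (by simp)
      rw [hset] at this
      refine this.mono (sub_cyc ?_)
      intro e he
      simp only [Finset.mem_insert] at he ⊢
      rcases he with rfl | rfl | rfl | he
      · refine ⟨by rw [Sym2.eq_swap]; exact h.e1, ?_⟩
        rintro (k | k)
        · rw [Sym2.congr_right] at k; exact h.uz k
        · exact hvT2 _ (hJ' k) (by simp)
      · refine ⟨h.e3, ?_⟩
        rintro (k | k)
        · have : w ∈ s(v, z) := by rw [← k]; simp
          simp [h.vw.symm, h.zw.symm] at this
        · exact hwT2 _ (hJ' k) (by simp)
      · refine ⟨h.e4, ?_⟩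
        rintro (k | k)
        · have : w ∈ s(v, z) := by rw [← k]; simp
          simp [h.vw.symm, h.zw.symm] at this
        · exact hwT2 _ (hJ' k) (by simp)
      · refine ⟨h.hs (H.sub1 he), ?_⟩
        rintro (k | k)
        · exact hvT1 e he (by simp [k])
        · exact hdj he (hJ' k)
  · obtain ⟨J', hJ', hJd⟩ := H.t2.join ω (by
      rw [Finset.sum_insert h.zM]
      rw [hv, hw, hu] at hsum
      linear_combination hsum - z2 1)
    obtain ⟨d1, d2, d3⟩ := hd J' hJ'
    have hn : s(u, v) ∉ J' := fun k => hvT2 _ (hJ' k) (by simp)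
    have hnv := dg_insert hn
    simp only [dg_mk h.uv] at hnv
    refine hb (insert s(u, v) J') ?_ ?_ ?_
    · exact Finset.insert_subset h.e1 (hJ'.trans (H.sub2.trans h.hs))
    · intro x hx
      simp only [Finset.mem_insert] at hx
      rw [hnv]
      rcases hx with rfl | rfl | rfl | rfl | hx
      · rw [d2, hv]; simp [dl, h.uv.symm]
      · rw [d3, hw]; simp [dl, h.vw.symm, h.uw.symm]
      · rw [d1, hu]; simp [dl, h.uv]
      · rw [hJd _ (by simp)]; simp [dl, h.vz.symm, h.uz.symm]
      · rw [hJd _ (by simp [hx])]; simp [dl, hne x hx]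
    · have := hT v z (by simp)
      rw [hset] at this
      refine this.mono (sub_cyc ?_)
      intro e he
      simp only [Finset.mem_insert] at he ⊢
      rcases he with rfl | rfl | rfl | he
      · refine ⟨h.e2, ?_⟩
        rintro (k | k)
        · rw [Sym2.eq_swap, Sym2.congr_left] at k; exact h.uz k.symm
        · exact hvT2 _ (hJ' k) (by simp)
      · refine ⟨h.e3, ?_⟩
        rintro (k | k)
        · have : w ∈ s(u, v) := by rw [← k]; simp
          simp [h.vw.symm, h.uw.symm] at this
        · exact hwT2 _ (hJ' k) (by simp)
      · refine ⟨h.e4, ?_⟩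
        rintro (k | k)
        · have : w ∈ s(u, v) := by rw [← k]; simp
          simp [h.vw.symm, h.uw.symm] at this
        · exact hwT2 _ (hJ' k) (by simp)
      · refine ⟨h.hs (H.sub1 he), ?_⟩
        rintro (k | k)
        · exact hvT1 e he (by simp [k])
        · exact hdj he (hJ' k)

/-- both zero: value at `u` is one -/
theorem bad_zero {M : Finset V} {u v z w : V} {F Hs : Finset (Sym2 V)} (h : Cyc M u v z w F Hs)
    {T₁ T₂ : Finset (Sym2 V)} (H : Dec (insert u M) (insert z M) Hs T₁ T₂) {ω : V → ZMod 2}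
    (hsum : ω v + (ω w + (ω u + (ω z + ∑ x ∈ M, ω x))) = 0)
    (hb : ∀ J ⊆ F, (∀ x ∈ insert v (insert w (insert u (insert z M))), dg J x = ω x) →
      ¬ Cn (insert v (insert w (insert u (insert z M)))) (F \ J))
    (hv : ω v = 0) (hw : ω w = 0) : ω u = 1 := by
  rcases z2or (ω u) with hu | hu
  swap
  · exact hu
  exfalso
  have huN : u ∉ insert z M := by simp [h.uz, h.uM]
  have hvN : v ∉ insert z M := by simp [h.vz, h.vM]
  have hwN : w ∉ insert z M := by simp [h.zw.symm, h.wM]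
  obtain ⟨J', hJ', hJd⟩ := H.t2.join ω (by
      rw [Finset.sum_insert h.zM]
      rw [hv, hw, hu] at hsum
      linear_combination hsum)
  have hwT2 : ∀ e ∈ T₂, w ∉ e := fun e he k => hwN (H.t2.wi e he w k)
  have hvT2 : ∀ e ∈ T₂, v ∉ e := fun e he k => hvN (H.t2.wi e he v k)
  refine hb J' (hJ'.trans (H.sub2.trans h.hs)) ?_ ?_
  · intro x hx
    rw [Finset.mem_insert, Finset.mem_insert, Finset.mem_insert] at hx
    rcases hx with rfl | rfl | rfl | hx
    · rw [hv]; exact dg_zero fun e he k => hvN (H.t2.wi e (hJ' he) _ k)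
    · rw [hw]; exact dg_zero fun e he k => hwN (H.t2.wi e (hJ' he) _ k)
    · rw [hu]; exact dg_zero fun e he k => huN (H.t2.wi e (hJ' he) _ k)
    · exact hJd x hx
  · have := (cn_leaf (a := v) (c := u) (cn_leaf (a := z) (c := w) (cn_leaf (a := w) (c := u)
      ⟨H.t1.wi, H.t1.cn⟩ (by simp)) (by simp)) (by simp)).2
    have hset : insert v (insert z (insert w (insert u M))) =
      insert v (insert w (insert u (insert z M))) := by
      ext x; simp only [Finset.mem_insert]; tauto
    rw [hset] at this
    refine this.mono (sub_cyc ?_)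
    intro e he
    simp only [Finset.mem_insert] at he
    rcases he with rfl | rfl | rfl | he
    · exact ⟨by rw [Sym2.eq_swap]; exact h.e1, fun k => hvT2 _ (hJ' k) (by simp)⟩
    · exact ⟨h.e3, fun k => hwT2 _ (hJ' k) (by simp)⟩
    · exact ⟨h.e4, fun k => hwT2 _ (hJ' k) (by simp)⟩
    · exact ⟨h.hs (H.sub1 he), fun k => Finset.disjoint_left.1 H.dj he (hJ' k)⟩

theorem bad_i {M : Finset V} {u v z w : V} {F Hs : Finset (Sym2 V)} (h : Cyc M u v z w F Hs)
    {T₁ T₂ : Finset (Sym2 V)} (H : Dec (insert u M) (insert z M) Hs T₁ T₂) {ω : V → ZMod 2}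
    (hsum : ω v + (ω w + (ω u + (ω z + ∑ x ∈ M, ω x))) = 0)
    (hb : ∀ J ⊆ F, (∀ x ∈ insert v (insert w (insert u (insert z M))), dg J x = ω x) →
      ¬ Cn (insert v (insert w (insert u (insert z M)))) (F \ J))
    (hW : Wi (insert u (insert z M)) Hs)
    (hv : ω v = 0) (hw : ω w = 0) : Bad1 M u z Hs ω := by
  have hu := bad_zero h H hsum hb hv hw
  have hz := bad_zero h.rot H.symm (ω := ω) (by linear_combination hsum)
    (by rw [Finset.insert_comm z u]; exact hb) hv hw
  refine ⟨hu, hz, ?_, ?_⟩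
  · rw [hu, hz, hv, hw] at hsum
    linear_combination hsum - z2 1
  · intro J hJ hJM hJu hJz hcn
    have hvA : v ∉ insert u (insert z M) := by simp [h.uv.symm, h.vz, h.vM]
    have hwA : w ∉ insert u (insert z M) := by simp [h.uw.symm, h.zw.symm, h.wM]
    refine hb J (hJ.trans h.hs) ?_ ?_
    · intro x hx
      simp only [Finset.mem_insert] at hx
      rcases hx with rfl | rfl | rfl | rfl | hx
      · rw [hv]; exact dg_zero fun e he k => hvA (hW e (hJ he) _ k)
      · rw [hw]; exact dg_zero fun e he k => hwA (hW e (hJ he) _ k)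
      · rw [hu, hJu]
      · rw [hz, hJz]
      · exact hJM x hx
    · refine cn_cycle (F := Hs \ J) (fun e he => hW e (Finset.mem_sdiff.1 he).1) hcn (by simp)
        (by simp) ?_ ?_ ?_ ?_
      · exact Finset.sdiff_subset_sdiff h.hs (Finset.Subset.refl _)
      · exact Finset.mem_sdiff.2 ⟨h.e1, fun k => e_notin hW hvA (by simp) (hJ k)⟩
      · exact Finset.mem_sdiff.2 ⟨h.e2, fun k => e_notin hW hvA (by simp) (hJ k)⟩
      · exact Finset.mem_sdiff.2 ⟨h.e3, fun k => e_notin hW hwA (by simp) (hJ k)⟩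

theorem bad_ii {M : Finset V} {u v z w : V} {F Hs : Finset (Sym2 V)} (h : Cyc M u v z w F Hs)
    {ω : V → ZMod 2}
    (hsum : ω v + (ω w + (ω u + (ω z + ∑ x ∈ M, ω x))) = 0)
    (hb : ∀ J ⊆ F, (∀ x ∈ insert v (insert w (insert u (insert z M))), dg J x = ω x) →
      ¬ Cn (insert v (insert w (insert u (insert z M)))) (F \ J))
    (hW : Wi (insert u (insert z M)) Hs) (hnd : Nd Hs)
    (hv : ω v = 1) (hw : ω w = 1) : Bad2 M u z Hs ω := by
  intro J hJ hJM hcn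
  have hvA : v ∉ insert u (insert z M) := by simp [h.uv.symm, h.vz, h.vM]
  have hwA : w ∉ insert u (insert z M) := by simp [h.uw.symm, h.zw.symm, h.wM]
  have huN : u ∉ insert z M := by simp [h.uz, h.uM]
  have hdv : dg J v = 0 := dg_zero fun e he k => hvA (hW e (hJ he) _ k)
  have hdw : dg J w = 0 := dg_zero fun e he k => hwA (hW e (hJ he) _ k)
  have htot : dg J u + (dg J z + ∑ x ∈ M, ω x) = 0 := by
    have h1 := dg_sum (fun e he => hnd e (hJ he)) (insert u (insert z M))
    rw [Finset.sum_insert huN, Finset.sum_insert h.zM, Finset.sum_congr rfl hJM] at h1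
    rw [h1]
    apply Finset.sum_eq_zero
    intro e he
    rw [if_neg]
    rintro ⟨a, ha, b, hb, rfl⟩
    exact hb (hW _ (hJ he) b (by simp))
  have hne : ∀ x ∈ M, x ≠ u ∧ x ≠ v ∧ x ≠ z ∧ x ≠ w := by
    intro x hx
    refine ⟨?_, ?_, ?_, ?_⟩
    · rintro rfl; exact h.uM hx
    · rintro rfl; exact h.vM hx
    · rintro rfl; exact h.zM hx
    · rintro rfl; exact h.wM hx
  rw [hv, hw] at hsum
  have hWJ : Wi (insert u (insert z M)) (Hs \ J) := fun e he => hW e (Finset.mem_sdiff.1 he).1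
  have hvJ : ∀ c, s(v, c) ∉ Hs := fun c => e_notin hW hvA (by simp)
  have hwJ : ∀ c, s(w, c) ∉ Hs := fun c => e_notin hW hwA (by simp)
  have hvw : ∀ c d, d ≠ v → s(v, c) ≠ s(w, d) := by
    intro c d hd k
    have : v ∈ s(w, d) := by rw [← k]; simp
    rw [Sym2.mem_iff] at this
    rcases this with k | k
    · exact h.vw k
    · exact hd k.symm
  have e1 : s(v, u) ∈ F := by rw [Sym2.eq_swap]; exact h.e1
  have e3 : s(w, z) ∈ F := by rw [Sym2.eq_swap]; exact h.e3
  -- general step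
  have gen : ∀ d d', (d = u ∨ d = z) → (d' = u ∨ d' = z) → s(w, d) ∈ F → s(w, d') ∈ F → d ≠ d' →
      (∀ x ∈ insert u (insert z M), dl u x + dl d x + dg J x = ω x) → False := by
    intro d d' hd hd' hdF hdF' hdd hx
    have hdv' : d ≠ v := by rcases hd with rfl | rfl; exacts [h.uv, h.vz.symm]
    have hdvpp : d' ≠ v := by rcases hd' with rfl | rfl; exacts [h.uv, h.vz.symm]
    have hdw' : d ≠ w := by rcases hd with rfl | rfl; exacts [h.uw, h.zw]
    have n1 : s(w, d) ∉ J := fun k => hwJ d (hJ k)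
    have n2 : s(v, u) ∉ insert s(w, d) J := by
      rw [Finset.mem_insert]
      rintro (k | k)
      · exact hvw _ _ hdv' k
      · exact hvJ _ (hJ k)
    have hdeg : ∀ x, dg (insert s(v, u) (insert s(w, d) J)) x =
        dl v x + dl u x + (dl w x + dl d x + dg J x) := by
      intro x
      rw [dg_insert n2, dg_insert n1, dg_mk h.uv.symm, dg_mk hdw'.symm]
    refine hb (insert s(v, u) (insert s(w, d) J)) ?_ ?_ ?_
    · exact Finset.insert_subset e1 (Finset.insert_subset hdF (hJ.trans h.hs))
    · intro x hxA
      rw [hdeg]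
      rw [Finset.mem_insert, Finset.mem_insert] at hxA
      rcases hxA with rfl | rfl | hxA
      · rw [hdv, hv]; simp [dl, h.uv.symm, h.vw, hdv'.symm]
      · rw [hdw, hw]; simp [dl, h.uw.symm, h.vw.symm, hdw'.symm]
      · have a1 : dl v x = 0 := by
          have : x ≠ v := by rintro rfl; exact hvA hxA
          simp [dl, this]
        have a2 : dl w x = 0 := by
          have : x ≠ w := by rintro rfl; exact hwA hxA
          simp [dl, this]
        rw [← hx x hxA, a1, a2]
        ring
    · have := (cn_leaf (a := v) (c := z) (cn_leaf (a := w) (c := d') ⟨hWJ, hcn⟩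
        (by rcases hd' with rfl | rfl <;> simp)) (by simp)).2
      refine this.mono (sub_cyc ?_)
      intro e he
      simp only [Finset.mem_insert, Finset.mem_sdiff] at he ⊢
      rcases he with rfl | rfl | he
      · refine ⟨h.e2, ?_⟩
        rintro (k | k | k)
        · rw [Sym2.congr_right] at k; exact h.uz k.symm
        · exact hvw _ _ hdv' k
        · exact hvJ _ (hJ k)
      · refine ⟨hdF', ?_⟩
        rintro (k | k | k)
        · exact hvw _ _ hdvpp k.symm
        · rw [Sym2.congr_right] at k; exact hdd k.symm
        · exact hwJ _ (hJ k)
      · refine ⟨h.hs he.1, ?_⟩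
        rintro (rfl | rfl | k)
        · exact hvJ _ he.1
        · exact hwJ _ he.1
        · exact he.2 k
  by_cases hcase : dg J u = ω u
  · refine gen u z (Or.inl rfl) (Or.inr rfl) h.e4 e3 h.uz ?_
    intro x hx
    rw [z2, zero_add]
    simp only [Finset.mem_insert] at hx
    rcases hx with rfl | rfl | hx
    · exact hcase
    · rw [hcase] at htot
      linear_combination htot - hsum + z2 1
    · exact hJM x hx
  · have hcase' : dg J u = ω u + 1 := by
      clear hJM hcn gen htot hsum
      generalize dg J u = p at *
      generalize ω u = q at *
      revert p q
      decide
    refine gen z u (Or.inr rfl) (Or.inl rfl) e3 h.e4 h.uz.symm ?_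
    intro x hx
    simp only [Finset.mem_insert] at hx
    rcases hx with rfl | rfl | hx
    · rw [hcase']; simp [dl, h.uz]; linear_combination z2 1
    · rw [hcase'] at htot
      simp [dl, h.uz.symm]
      linear_combination htot - hsum + z2 1
    · rw [hJM x hx]; simp [dl, hne x hx]

theorem thm2 {E : Finset (Sym2 V)} (hE : Red E) {u v z w : V} (n : ℕ) :
    ∀ M : Finset V, M.card = n → Cyc M u v z w E ∅ → Stars E u z M := by
  induction n using Nat.strong_induction_on with
  | _ n ih =>
    intro M hMn hcyc T₁ T₂ h1 h2 hd hs1 hs2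
    rcases Nat.lt_or_ge M.card 2 with hlt | hge
    · intro s hs
      obtain ⟨x, rfl⟩ : ∃ x, M = {x} := by
        rw [← Finset.card_eq_one]
        have := Finset.card_pos.2 ⟨s, hs⟩
        omega
      obtain ⟨c, hc, k, -⟩ := h1.rootSide hcyc.uM hs
      obtain ⟨c', hc', k', -⟩ := h2.rootSide hcyc.zM hs
      simp only [Finset.mem_singleton] at hs hc hc'
      subst hs hc
      subst hc'
      exact ⟨k, k'⟩
    · set Hs := T₁ ∪ T₂ with hHs
      have H : Dec (insert u M) (insert z M) Hs T₁ T₂ := ⟨h1, h2, hd, rfl⟩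
      have hHsE : Hs ⊆ E := Finset.union_subset hs1 hs2
      have hnd : Nd Hs := by
        intro e he
        rw [hHs, Finset.mem_union] at he
        rcases he with he | he
        · exact h1.nd e he
        · exact h2.nd e he
      have hW : Wi (insert u (insert z M)) Hs := by
        intro e he x hx
        rw [hHs, Finset.mem_union] at he
        rcases he with he | he
        · have := h1.wi e he x hx
          simp only [Finset.mem_insert] at this ⊢
          tauto
        · have := h2.wi e he x hx
          simp only [Finset.mem_insert] at this ⊢
          tauto
      have IH : ∀ M', M' ⊆ M → M'.card < M.card → Stars E u z M' := by
        intro M' hM' hlt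
        exact ih M'.card (by omega) M' rfl ⟨hcyc.uv, hcyc.uz, hcyc.uw, hcyc.vz, hcyc.vw, hcyc.zw,
          fun k => hcyc.uM (hM' k), fun k => hcyc.vM (hM' k), fun k => hcyc.zM (hM' k),
          fun k => hcyc.wM (hM' k), hcyc.hs, hcyc.e1, hcyc.e2, hcyc.e3, hcyc.e4⟩
      set F := Hs ∪ {s(u, v), s(v, z), s(z, w), s(w, u)} with hF
      have hcF : Cyc M u v z w F Hs := ⟨hcyc.uv, hcyc.uz, hcyc.uw, hcyc.vz, hcyc.vw, hcyc.zw,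
        hcyc.uM, hcyc.vM, hcyc.zM, hcyc.wM, Finset.subset_union_left, by simp [hF], by simp [hF],
        by simp [hF], by simp [hF]⟩
      have hFE : F ⊆ E := by
        apply Finset.union_subset hHsE
        intro e he
        simp only [Finset.mem_insert, Finset.mem_singleton] at he
        rcases he with rfl | rfl | rfl | rfl
        exacts [hcyc.e1, hcyc.e2, hcyc.e3, hcyc.e4]
      have hFW : Wi (insert v (insert w (insert u (insert z M)))) F := by
        intro e he x hx
        rw [hF, Finset.mem_union] at he
        rcases he with he | he
        · have := hW e he x hx
          simp only [Finset.mem_insert] at this ⊢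
          tauto
        · simp only [Finset.mem_insert, Finset.mem_singleton] at he ⊢
          rcases he with rfl | rfl | rfl | rfl <;> rw [Sym2.mem_iff] at hx <;> tauto
      have hnc := hE _ F hFE hFW (hge.trans (Finset.card_le_card (by
        intro x hx; simp [hx])))
      unfold Coll at hnc
      push Not at hnc
      obtain ⟨ω, hsum, hb⟩ := hnc
      rw [Finset.sum_insert (by simp [hcyc.vw, hcyc.uv.symm, hcyc.vz, hcyc.vM]),
        Finset.sum_insert (by simp [hcyc.uw.symm, hcyc.zw.symm, hcyc.wM]),
        Finset.sum_insert (by simp [hcyc.uz, hcyc.uM]), Finset.sum_insert hcyc.zM] at hsum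
      rcases z2or (ω v) with hv | hv <;> rcases z2or (ω w) with hw | hw
      · exact core hE hcyc.uz hcyc.uM hcyc.zM hge hHsE
          (sit_i hcyc.uz hcyc.uM hcyc.zM (bad_i hcF H hsum hb hW hv hw)) IH H
      · exact (bad_mix hcF.flip H (ω := ω) (by linear_combination hsum)
          (by rw [Finset.insert_comm w v]; exact hb) hw hv).elim
      · exact (bad_mix hcF H hsum hb hv hw).elim
      · exact core hE hcyc.uz hcyc.uM hcyc.zM hge hHsE
          (sit_ii hcyc.uz hcyc.uM hcyc.zM (bad_ii hcF hsum hb hW hnd hv hw)) IH H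

end MG
namespace MG

variable {V : Type}

theorem connOn_of_Cn {A : Finset V} {F : Finset (Sym2 V)} (hW : Wi A F) (hA : A.Nonempty)
    (hC : Cn A F) : Multigraph.ConnOn (↑A : Set V) F.val := by
  refine ⟨by simpa using hA, fun e he x hx => by simpa using hW e he x hx, ?_⟩
  intro a ha b hb
  by_contra hn
  set P : Finset V :=
    A.filter (fun x => Relation.ReflTransGen (fun a b => s(a, b) ∈ F.val) a x) with hP
  have hPA : P ≠ A := by
    intro h
    have : b ∈ P := by rw [h]; simpa using hb
    exact hn (Finset.mem_filter.1 this).2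
  have haP : a ∈ P := Finset.mem_filter.2 ⟨by simpa using ha, Relation.ReflTransGen.refl⟩
  obtain ⟨e, he, c, hc, d, hd, rfl⟩ := hC P (Finset.filter_subset _ _) ⟨a, haP⟩ hPA
  apply hd
  refine Finset.mem_filter.2 ⟨hW _ he d (by simp), ?_⟩
  exact (Finset.mem_filter.1 hc).2.tail he

theorem degIn_cast (F : Finset (Sym2 V)) (x : V) :
    ((Multigraph.degIn F.val x : ℕ) : ZMod 2) = dg F x := by
  unfold dg
  rw [Finset.sum_boole]
  rfl

theorem coll_pair {A : Finset V} {F : Finset (Sym2 V)} (hW : Wi A F) (hN : Nd F)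
    (hA : A.Nonempty) (hC : Coll A F) : Multigraph.CollapsiblePair (↑A : Set V) F.val := by
  refine ⟨by simpa using hA, fun e he x hx => by simpa using hW e he x hx, ?_⟩
  intro R hR hfin hev
  have hs1 : ∑ x ∈ A, dg F x = 0 := by
    rw [dg_sum hN]
    refine Finset.sum_eq_zero fun e he => if_neg ?_
    rintro ⟨a, ha, b, hb, rfl⟩
    exact hb (hW _ he b (by simp))
  have hs2 : ∑ x ∈ A, (if x ∈ R then (1 : ZMod 2) else 0) = 0 := by
    rw [Finset.sum_boole, ZMod.natCast_eq_zero_iff_even]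
    have : ((A.filter (fun x => x ∈ R) : Finset V) : Set V) = R := by
      ext x
      simp only [Finset.coe_filter, Set.mem_ofPred_eq]
      exact ⟨fun h => h.2, fun h => ⟨by simpa using hR h, h⟩⟩
    rw [← Set.ncard_coe_finset, this]
    exact hev
  obtain ⟨J, hJ, hd, hc⟩ := hC (fun x => (if x ∈ R then (1 : ZMod 2) else 0) + dg F x)
    (by rw [Finset.sum_add_distrib, hs1, hs2, add_zero])
  refine ⟨(F \ J).val, Finset.val_le_iff.2 Finset.sdiff_subset,
    connOn_of_Cn (fun e he => hW e (Finset.mem_sdiff.1 he).1) hA hc, ?_⟩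
  intro x hx
  have h1 := hd x (by simpa using hx)
  have h2 : dg F x = dg (F \ J) x + dg J x := by
    rw [← dg_union Finset.sdiff_disjoint, Finset.sdiff_union_of_subset hJ]
  rw [← ZMod.natCast_eq_one_iff_odd, degIn_cast]
  have h3 : dg (F \ J) x = if x ∈ R then 1 else 0 := by
    have h4 := z2 (dg F x)
    have h5 := z2 (dg J x)
    have : dg (F \ J) x = dg F x + dg J x := by rw [h2, add_assoc, h5, add_zero]
    rw [this, h1, add_comm, add_assoc, h4, add_zero]
  rw [h3]
  by_cases h : x ∈ R <;> simp [h]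

theorem nodup_of_reduced {G : Multigraph V} (hG : G.Reduced) : G.edges.Nodup := by
  rw [Multiset.nodup_iff_le]
  intro e hle
  have hel : e ∈ G.edges := Multiset.mem_of_le hle (by simp)
  have hdiag := G.loopless e hel
  induction e with
  | _ a b =>
  have hab : a ≠ b := by simpa using hdiag
  have hWi : ∀ E : Multiset (Sym2 V), (∀ e ∈ E, e = s(a, b)) →
      Multigraph.Within ({a, b} : Set V) E := by
    intro E hE e he x hx
    rw [hE e he] at hx
    simpa using hx
  have hCo : ∀ E : Multiset (Sym2 V), (∀ e ∈ E, e = s(a, b)) → s(a, b) ∈ E →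
      Multigraph.ConnOn ({a, b} : Set V) E := by
    intro E hE hm
    refine ⟨⟨a, by simp⟩, hWi E hE, ?_⟩
    have hm' : s(b, a) ∈ E := by rwa [Sym2.eq_swap]
    rintro x (rfl | rfl) y (rfl | rfl)
    · exact Relation.ReflTransGen.refl
    · exact Relation.ReflTransGen.single hm
    · exact Relation.ReflTransGen.single hm'
    · exact Relation.ReflTransGen.refl
  have hcard : ({a, b} : Set V).ncard = 2 := Set.ncard_pair hab
  have := hG ({a, b} : Set V) (s(a, b) ::ₘ s(a, b) ::ₘ 0) ⟨hle, hWi _ (by simp)⟩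
    ⟨⟨a, by simp⟩, hWi _ (by simp), ?_⟩
  · omega
  intro R hR hfin hev
  by_cases hR0 : R = ∅
  · refine ⟨_, le_rfl, hCo _ (by simp) (by simp), ?_⟩
    intro x hx
    have : x = a ∨ x = b := by simpa using hx
    have h2 : Multigraph.degIn (s(a, b) ::ₘ s(a, b) ::ₘ 0) x = 2 := by
      unfold Multigraph.degIn
      rw [Multiset.filter_eq_self.2] <;> simp [this]
    rw [h2, hR0]
    simp
  · have hRe : R = {a, b} := by
      have hfin2 : ({a, b} : Set V).Finite := by simp
      have h1 := Set.ncard_le_ncard hR hfin2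
      have h2 : 0 < R.ncard := (Set.ncard_pos hfin).2 (Set.nonempty_iff_ne_empty.2 hR0)
      refine Set.eq_of_subset_of_ncard_le hR ?_ hfin2
      rcases hev with ⟨k, hk⟩
      omega
    refine ⟨s(a, b) ::ₘ 0, Multiset.le_cons_self _ _, hCo _ (by simp) (by simp), ?_⟩
    intro x hx
    have : x = a ∨ x = b := by simpa using hx
    have h2 : Multigraph.degIn (s(a, b) ::ₘ 0) x = 1 := by
      unfold Multigraph.degIn
      rw [Multiset.filter_eq_self.2] <;> simp [this]
    rw [h2, hRe]
    simpa using this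

theorem red_of_reduced {G : Multigraph V} (hG : G.Reduced) : Red G.edges.toFinset := by
  intro A F hF hW hA hC
  have hA' : A.Nonempty := Finset.card_pos.1 (by omega)
  have hle : F.val ≤ G.edges :=
    (Multiset.le_iff_subset F.nodup).2 fun e he => Multiset.mem_toFinset.1 (hF he)
  have hN : Nd F := fun e he => G.loopless e (Multiset.mem_of_le hle he)
  have := hG (↑A) F.val ⟨hle, fun e he x hx => by simpa using hW e he x hx⟩
    (coll_pair hW hN hA' hC)
  rw [Set.ncard_coe_finset] at this
  omega

theorem nd_edges (G : Multigraph V) : Nd G.edges.toFinset :=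
  fun e he => G.loopless e (Multiset.mem_toFinset.1 he)

/-- Every vertex of a nontrivial collapsible pair is on an edge. -/
theorem on_edge {S : Set V} {E : Multiset (Sym2 V)} (hC : Multigraph.CollapsiblePair S E)
    (hS : 1 < S.ncard) {x : V} (hx : x ∈ S) : ∃ e ∈ E, x ∈ e := by
  obtain ⟨E', hle, hco, -⟩ := hC.2.2 ∅ (by simp) (by simp) (by simp)
  have hfin : S.Finite := Set.finite_of_ncard_ne_zero (by omega)
  obtain ⟨y, hy, hne⟩ := Set.exists_ne_of_one_lt_ncard hS x
  rcases Relation.ReflTransGen.cases_head (hco.2.2 x hx y hy) with h | ⟨c, h, -⟩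
  · exact absurd h.symm hne
  · exact ⟨_, Multiset.mem_of_le hle h, by simp⟩

/-- All ends of `e` lie in `S`. -/
def Pin (S : Finset V) (e : Sym2 V) : Prop := ∀ x ∈ e, x ∈ S

/-- The identification map. -/
noncomputable def rho (u v z w : V) : V → V := fun a => if a = z then u else if a = w then v else a

/-- The edges that end up in `S`. -/
noncomputable def QQ (E : Finset (Sym2 V)) (S : Finset V) (u v z w : V) : Finset (Sym2 V) :=
  (E \ {s(u, v), s(v, z), s(z, w), s(w, u)}).filter
    (fun e => Pin S (Sym2.map (rho u v z w) e))

theorem piEdges_eq {G : Multigraph V} (hG : G.Reduced) {u v z w : V}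
    (huv : u ≠ v) (huz : u ≠ z) (huw : u ≠ w) (hvz : v ≠ z) (hvw : v ≠ w) (hzw : z ≠ w) :
    G.piEdges u v z w =
      (G.edges.toFinset \ {s(u, v), s(v, z), s(z, w), s(w, u)}).val.map
        (Sym2.map (rho u v z w)) + {s(u, v)} := by
  have hnd := nodup_of_reduced hG
  unfold Multigraph.piEdges
  congr 2
  rw [Finset.sdiff_val, Multiset.toFinset_val, hnd.dedup]
  congr 1
  rw [Finset.insert_val_of_notMem, Finset.insert_val_of_notMem, Finset.insert_val_of_notMem]
  · rfl
  · simp; grind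
  · simp; grind
  · simp; grind

theorem E0_le {G : Multigraph V} (hG : G.Reduced) {u v z w : V}
    (huv : u ≠ v) (huz : u ≠ z) (huw : u ≠ w) (hvz : v ≠ z) (hvw : v ≠ w) (hzw : z ≠ w)
    {S : Finset V} {E₀ : Multiset (Sym2 V)} (hle : E₀ ≤ G.piEdges u v z w)
    (hW : ∀ e ∈ E₀, Pin S e) :
    E₀ ≤ (QQ G.edges.toFinset S u v z w).val.map (Sym2.map (rho u v z w)) +
      (if u ∈ S ∧ v ∈ S then {s(u, v)} else 0) := by
  rw [piEdges_eq hG huv huz huw hvz hvw hzw] at hle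
  have h := Multiset.le_filter.2 ⟨hle, hW⟩
  rw [Multiset.filter_add, Multiset.filter_map, Multiset.filter_singleton] at h
  refine h.trans (add_le_add (le_of_eq ?_) (le_of_eq ?_))
  · rfl
  · have : Pin S s(u, v) ↔ u ∈ S ∧ v ∈ S := by simp [Pin]
    simp only [this]
    rfl


theorem phi_eq {u v z w : V} (huz : u ≠ z) (huw : u ≠ w) {M : Finset V} (hu : u ∉ M) (hz : z ∉ M)
    (hw : w ∉ M) {Q : Finset (Sym2 V)} (hc : Q.card = 2 * M.card)
    (h1 : ∀ s ∈ M, s(u, s) ∈ Q) (h2 : ∀ s ∈ M, s(z, s) ∈ Q) :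
    Q.val.map (Sym2.map (rho u v z w)) =
      M.val.map (fun a => s(u, a)) + M.val.map (fun a => s(u, a)) := by
  have hnd : (M.val.map (fun a => s(u, a)) + M.val.map (fun a => s(z, a))).Nodup := by
    rw [Multiset.nodup_add]
    refine ⟨?_, ?_, ?_⟩
    · exact M.nodup.map (fun a b h => by simp at h; grind)
    · exact M.nodup.map (fun a b h => by simp at h; grind)
    · rw [Multiset.disjoint_left]
      intro e he he'
      obtain ⟨a, ha, rfl⟩ := Multiset.mem_map.1 he
      obtain ⟨b, hb, hab⟩ := Multiset.mem_map.1 he'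
      have ha' : a ∈ M := ha
      have hb' : b ∈ M := hb
      simp only [Sym2.eq_iff] at hab
      rcases hab with ⟨h, _⟩ | ⟨h, _⟩
      · exact huz h.symm
      · exact hz (h ▸ ha')
  have hle : M.val.map (fun a => s(u, a)) + M.val.map (fun a => s(z, a)) ≤ Q.val := by
    rw [Multiset.le_iff_subset hnd]
    intro e he
    rcases Multiset.mem_add.1 he with h | h
    · obtain ⟨a, ha, rfl⟩ := Multiset.mem_map.1 h
      exact h1 a ha
    · obtain ⟨a, ha, rfl⟩ := Multiset.mem_map.1 h
      exact h2 a ha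
  have heq := Multiset.eq_of_le_of_card_le hle (by
    simp only [Finset.card_val, Multiset.card_add, Multiset.card_map]; omega)
  have hr : ∀ a ∈ M, rho u v z w a = a := by
    intro a ha
    unfold rho
    rw [if_neg (fun h : a = z => hz (h ▸ ha)), if_neg (fun h : a = w => hw (h ▸ ha))]
  have hru : rho u v z w u = u := by
    unfold rho
    rw [if_neg huz, if_neg huw]
  have hrz : rho u v z w z = u := by
    unfold rho
    rw [if_pos rfl]
  rw [← heq, Multiset.map_add, Multiset.map_map, Multiset.map_map]
  congr 1
  · refine Multiset.map_congr rfl fun a ha => ?_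
    simp only [Function.comp, Sym2.map_mk]
    rw [hr a ha, hru]
  · refine Multiset.map_congr rfl fun a ha => ?_
    simp only [Function.comp, Sym2.map_mk]
    rw [hr a ha, hrz]

theorem side [Fintype V] {G : Multigraph V} (hG : G.Reduced) {u v z w : V}
    (huv : u ≠ v) (huz : u ≠ z) (huw : u ≠ w) (hvz : v ≠ z) (hvw : v ≠ w) (hzw : z ≠ w)
    (e₁ : s(u, v) ∈ G.edges) (e₂ : s(v, z) ∈ G.edges)
    (e₃ : s(z, w) ∈ G.edges) (e₄ : s(w, u) ∈ G.edges)
    (hind₁ : s(u, z) ∉ G.edges)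
    {S : Finset V} {E₀ : Multiset (Sym2 V)} (hle : E₀ ≤ G.piEdges u v z w)
    (hW : ∀ e ∈ E₀, Pin S e) (hzS : z ∉ S) (hwS : w ∉ S) (huS : u ∈ S) (hvS : v ∉ S)
    (hS : 2 ≤ S.card) :
    (Multigraph.IsPhi (↑S : Set V) E₀ u (S.card - 1) ∧ 2 * S.card = Multiset.card E₀ + 2) ∨
      Multiset.card E₀ + 3 ≤ 2 * S.card := by
  have h0 := E0_le hG huv huz huw hvz hvw hzw hle hW
  rw [if_neg (fun h => hvS h.2), add_zero] at h0
  set Q := QQ G.edges.toFinset S u v z w with hQ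
  set M := S.erase u with hM
  have hMc : M.card + 1 = S.card := Finset.card_erase_add_one huS
  have huM : u ∉ M := by simp [hM]
  have hzM : z ∉ M := by simp [hM, hzS]
  have hwM : w ∉ M := by simp [hM, hwS]
  have hvM : v ∉ M := by simp [hM, hvS]
  have hQr : Q ⊆ res (insert u (insert z M)) G.edges.toFinset := by
    intro e he
    obtain ⟨he1, he2⟩ := Finset.mem_filter.1 he
    refine mem_res.2 ⟨(Finset.mem_sdiff.1 he1).1, fun x hx => ?_⟩
    have h3 : rho u v z w x ∈ S := he2 _ (Sym2.mem_map.2 ⟨x, hx, rfl⟩)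
    unfold rho at h3
    by_cases hxz : x = z
    · simp [hxz]
    · rw [if_neg hxz] at h3
      by_cases hxw : x = w
      · rw [if_pos hxw] at h3
        exact absurd h3 hvS
      · rw [if_neg hxw] at h3
        by_cases hxu : x = u
        · simp [hxu]
        · simp [hM, hxu, h3]
  have hRed := red_of_reduced hG
  have hNd := nd_edges G
  have hcA : (insert u (insert z M)).card = M.card + 2 := by
    rw [Finset.card_insert_of_notMem (by simp [huz, huM]), Finset.card_insert_of_notMem hzM]
  have hec := (ec_all hRed hNd (insert u (insert z M))).2.2 (by omega)
  have hcQ := Finset.card_le_card hQr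
  have hcE := Multiset.card_le_card h0
  rw [Multiset.card_map, Finset.card_val] at hcE
  by_cases hlt : Multiset.card E₀ + 3 ≤ 2 * S.card
  · exact Or.inr hlt
  left
  have hQe : Q = res (insert u (insert z M)) G.edges.toFinset :=
    Finset.eq_of_subset_of_card_le hQr (by omega)
  have hE : E₀ = Q.val.map (Sym2.map (rho u v z w)) :=
    Multiset.eq_of_le_of_card_le h0 (by rw [Multiset.card_map, Finset.card_val]; omega)
  have hMne : M.Nonempty := Finset.card_pos.1 (by omega)
  obtain ⟨T₁, T₂, hD⟩ := dec_two hRed hNd huz huM hzM hMne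
    (by simpa using hind₁) (by omega)
  have hst := thm2 hRed M.card M rfl (u := u) (v := v) (z := z) (w := w)
    ⟨huv, huz, huw, hvz, hvw, hzw, huM, hvM, hzM, hwM, by simp, by simpa using e₁,
      by simpa using e₂, by simpa using e₃, by simpa using e₄⟩
    T₁ T₂ hD.t1 hD.t2 hD.dj (hD.sub1.trans res_sub) (hD.sub2.trans res_sub)
  have hphi := phi_eq (v := v) huz huw huM hzM hwM (Q := Q) (by omega)
    (fun s hs => hQe ▸ hD.sub1 (hst s hs).1) (fun s hs => hQe ▸ hD.sub2 (hst s hs).2)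
  refine ⟨⟨M, huM, by omega, ?_, by rw [hE, hphi]⟩, by omega⟩
  rw [← Finset.coe_insert, Finset.insert_erase huS]

theorem both [Fintype V] {G : Multigraph V} (hG : G.Reduced) {u v z w : V}
    (huv : u ≠ v) (huz : u ≠ z) (huw : u ≠ w) (hvz : v ≠ z) (hvw : v ≠ w) (hzw : z ≠ w)
    (e₁ : s(u, v) ∈ G.edges) (e₂ : s(v, z) ∈ G.edges)
    (e₃ : s(z, w) ∈ G.edges) (e₄ : s(w, u) ∈ G.edges)
    {S : Finset V} {E₀ : Multiset (Sym2 V)} (hle : E₀ ≤ G.piEdges u v z w)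
    (hW : ∀ e ∈ E₀, Pin S e) (hzS : z ∉ S) (hwS : w ∉ S) (huS : u ∈ S) (hvS : v ∈ S) :
      Multiset.card E₀ + 3 ≤ 2 * S.card := by
  have h0 := E0_le hG huv huz huw hvz hvw hzw hle hW
  rw [if_pos ⟨huS, hvS⟩] at h0
  have hcE := Multiset.card_le_card h0
  rw [Multiset.card_add, Multiset.card_map, Finset.card_val, Multiset.card_singleton] at hcE
  set Q := QQ G.edges.toFinset S u v z w with hQ
  have hsub : Q ∪ {s(u, v), s(v, z), s(z, w), s(w, u)} ⊆
      res (insert z (insert w S)) G.edges.toFinset := by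
    intro e he
    rcases Finset.mem_union.1 he with he | he
    · obtain ⟨he1, he2⟩ := Finset.mem_filter.1 he
      refine mem_res.2 ⟨(Finset.mem_sdiff.1 he1).1, fun x hx => ?_⟩
      have h3 : rho u v z w x ∈ S := he2 _ (Sym2.mem_map.2 ⟨x, hx, rfl⟩)
      unfold rho at h3
      by_cases hxz : x = z
      · simp [hxz]
      · rw [if_neg hxz] at h3
        by_cases hxw : x = w
        · simp [hxw]
        · rw [if_neg hxw] at h3
          simp [h3]
    · simp only [Finset.mem_insert, Finset.mem_singleton] at he
      rcases he with rfl | rfl | rfl | rfl <;> refine mem_res.2 ⟨by simpa, fun x hx => ?_⟩ <;>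
        simp only [Sym2.mem_iff] at hx <;> rcases hx with rfl | rfl <;> simp [huS, hvS]
  have hdis : Disjoint Q {s(u, v), s(v, z), s(z, w), s(w, u)} :=
    Finset.disjoint_of_subset_left (Finset.filter_subset _ _) Finset.sdiff_disjoint
  have h4 : ({s(u, v), s(v, z), s(z, w), s(w, u)} : Finset (Sym2 V)).card = 4 := by
    rw [Finset.card_insert_of_notMem, Finset.card_insert_of_notMem, Finset.card_insert_of_notMem,
      Finset.card_singleton]
    · simp; grind
    · simp; grind
    · simp; grind
  have hc := Finset.card_le_card hsub
  rw [Finset.card_union_of_disjoint hdis, h4] at hc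
  have hcA : (insert z (insert w S)).card = S.card + 2 := by
    rw [Finset.card_insert_of_notMem (by simp [hzw, hzS]), Finset.card_insert_of_notMem hwS]
  have hpos : 0 < S.card := Finset.card_pos.2 ⟨u, huS⟩
  have hec := (ec_all (red_of_reduced hG) (nd_edges G) (insert z (insert w S))).2.2 (by omega)
  omega

theorem neither {G : Multigraph V} (hG : G.Reduced) {u v z w : V}
    (huv : u ≠ v) (huz : u ≠ z) (huw : u ≠ w) (hvz : v ≠ z) (hvw : v ≠ w) (hzw : z ≠ w)
    {S : Finset V} {E₀ : Multiset (Sym2 V)} (hle : E₀ ≤ G.piEdges u v z w)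
    (hW : ∀ e ∈ E₀, Pin S e) (huS : u ∉ S) (hvS : v ∉ S) : E₀ ≤ G.edges := by
  have h0 := E0_le hG huv huz huw hvz hvw hzw hle hW
  rw [if_neg (fun h => hvS h.2), add_zero] at h0
  have : (QQ G.edges.toFinset S u v z w).val.map (Sym2.map (rho u v z w)) =
      (QQ G.edges.toFinset S u v z w).val := by
    conv_rhs => rw [← Multiset.map_id (QQ G.edges.toFinset S u v z w).val]
    refine Multiset.map_congr rfl fun e he => ?_
    obtain ⟨he1, he2⟩ := Finset.mem_filter.1 he
    conv_rhs => rw [← Sym2.map_id]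
    refine Sym2.map_congr fun x hx => ?_
    have h3 : rho u v z w x ∈ S := he2 _ (Sym2.mem_map.2 ⟨x, hx, rfl⟩)
    unfold rho at h3 ⊢
    by_cases hxz : x = z
    · rw [if_pos hxz] at h3
      exact absurd h3 huS
    · rw [if_neg hxz] at h3 ⊢
      by_cases hxw : x = w
      · rw [if_pos hxw] at h3
        exact absurd h3 hvS
      · rw [if_neg hxw]
        rfl
  rw [this] at h0
  refine h0.trans ((Multiset.le_iff_subset (Finset.nodup _)).2 fun e he => ?_)
  have h1 := (Finset.mem_filter.1 he).1
  exact Multiset.mem_toFinset.1 (Finset.mem_sdiff.1 h1).1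

theorem pi_swap (G : Multigraph V) {u v z w : V} (hzw : z ≠ w) :
    G.piEdges v u w z = G.piEdges u v z w := by
  unfold Multigraph.piEdges
  have h1 : ({s(v, u), s(u, w), s(w, z), s(z, v)} : Multiset (Sym2 V)) =
      {s(u, v), s(v, z), s(z, w), s(w, u)} := by
    rw [Sym2.eq_swap (a := v) (b := u), Sym2.eq_swap (a := u) (b := w),
      Sym2.eq_swap (a := w) (b := z), Sym2.eq_swap (a := z) (b := v)]
    simp only [Multiset.insert_eq_cons, ← Multiset.singleton_add]
    abel
  have h2 : (fun a => if a = w then v else if a = z then u else a) =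
      (fun a => if a = z then u else if a = w then v else a) := by
    funext a
    by_cases ha : a = z
    · subst ha
      simp [hzw]
    · simp [ha]
  rw [h1, h2, Sym2.eq_swap (a := v) (b := u)]

theorem not_mem_pi {G : Multigraph V} (hG : G.Reduced) {u v z w : V}
    (huv : u ≠ v) (huz : u ≠ z) (huw : u ≠ w) (hvz : v ≠ z) (hvw : v ≠ w) (hzw : z ≠ w)
    {e : Sym2 V} (he : e ∈ G.piEdges u v z w) : z ∉ e ∧ w ∉ e := by
  rw [piEdges_eq hG huv huz huw hvz hvw hzw] at he
  have hr : ∀ x, rho u v z w x ≠ z ∧ rho u v z w x ≠ w := by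
    intro x
    unfold rho
    by_cases hxz : x = z
    · rw [if_pos hxz]
      exact ⟨huz, huw⟩
    · rw [if_neg hxz]
      by_cases hxw : x = w
      · rw [if_pos hxw]
        exact ⟨hvz, hvw⟩
      · rw [if_neg hxw]
        exact ⟨hxz, hxw⟩
  rcases Multiset.mem_add.1 he with he | he
  · obtain ⟨f, hf, rfl⟩ := Multiset.mem_map.1 he
    refine ⟨fun h => ?_, fun h => ?_⟩ <;> obtain ⟨x, hx, hxe⟩ := Sym2.mem_map.1 h
    · exact (hr x).1 hxe
    · exact (hr x).2 hxe
  · rw [Multiset.mem_singleton] at he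
    subst he
    simp only [Sym2.mem_iff, not_or]
    exact ⟨⟨huz.symm, hvz.symm⟩, huw.symm, hvw.symm⟩

end MG

/-- part of Lemma 2.1. Let `G` be a connected reduced graph with minimum
degree at least 3, let `u v z w u` be an (induced) 4-cycle of `G`, and let `G/π` be obtained
from `G` by the π-reduction on this 4-cycle, with new edge `e_π = xy` (`x = u`, `y = v`).
If `H₀ = (S, E)` is a nontrivial maximal collapsible subgraph of `G/π`, then either `H₀` is
`Φ(c, t)` for some `t ≥ 1` with `c ∈ {x, y}`, in which case `2|V(H₀)| − |E(H₀)| = 2`, or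
`2|V(H₀)| − |E(H₀)| ≥ 3`.  In particular, `2|V(H₀)| − |E(H₀)| ≥ 2`. -/
theorem statement1 {V : Type} [Fintype V] (G : Multigraph V)
    (hconn : G.Connected) (hred : G.Reduced) (hδ : ∀ x : V, 3 ≤ G.deg x)
    (u v z w : V)
    (huv : u ≠ v) (huz : u ≠ z) (huw : u ≠ w) (hvz : v ≠ z) (hvw : v ≠ w) (hzw : z ≠ w)
    (e₁ : s(u, v) ∈ G.edges) (e₂ : s(v, z) ∈ G.edges)
    (e₃ : s(z, w) ∈ G.edges) (e₄ : s(w, u) ∈ G.edges)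
    (hind₁ : s(u, z) ∉ G.edges) (hind₂ : s(v, w) ∉ G.edges)
    (Gπ : Multigraph V) (hGπ : Gπ.edges = G.piEdges u v z w) :
    ∀ S E, Gπ.NontrivMaxCollapsible S E →
      ((∃ t : ℕ, 1 ≤ t ∧ ∃ c, (c = u ∨ c = v) ∧ Multigraph.IsPhi S E c t ∧
            2 * S.ncard = Multiset.card E + 2) ∨
          Multiset.card E + 3 ≤ 2 * S.ncard) ∧
        Multiset.card E + 2 ≤ 2 * S.ncard := by
  intro S E ⟨⟨⟨hle, hW⟩, hcoll, _⟩, hcard⟩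
  rw [hGπ] at hle
  have hzS : z ∉ S := fun h => by
    obtain ⟨e, he, hze⟩ := MG.on_edge hcoll hcard h
    exact (MG.not_mem_pi hred huv huz huw hvz hvw hzw (Multiset.mem_of_le hle he)).1 hze
  have hwS : w ∉ S := fun h => by
    obtain ⟨e, he, hze⟩ := MG.on_edge hcoll hcard h
    exact (MG.not_mem_pi hred huv huz huw hvz hvw hzw (Multiset.mem_of_le hle he)).2 hze
  have hfirst : (∃ t : ℕ, 1 ≤ t ∧ ∃ c, (c = u ∨ c = v) ∧ Multigraph.IsPhi S E c t ∧
            2 * S.ncard = Multiset.card E + 2) ∨ Multiset.card E + 3 ≤ 2 * S.ncard := by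
    lift S to Finset V using S.toFinite
    have hP : ∀ e ∈ E, MG.Pin S e := fun e he x hx => by simpa using hW e he x hx
    rw [Finset.mem_coe] at hzS hwS
    by_cases huS : u ∈ S <;> by_cases hvS : v ∈ S
    · right
      rw [Set.ncard_coe_finset]
      exact MG.both hred huv huz huw hvz hvw hzw e₁ e₂ e₃ e₄ hle hP hzS hwS huS hvS
    · rw [Set.ncard_coe_finset] at hcard ⊢
      rcases MG.side hred huv huz huw hvz hvw hzw e₁ e₂ e₃ e₄ hind₁ hle hP hzS hwS huS hvS hcard
        with h | h
      · exact Or.inl ⟨S.card - 1, by omega, u, Or.inl rfl, h.1, h.2⟩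
      · exact Or.inr h
    · rw [Set.ncard_coe_finset] at hcard ⊢
      rw [← MG.pi_swap G hzw] at hle
      rw [Sym2.eq_swap] at e₁ e₂ e₃ e₄
      rcases MG.side hred huv.symm hvw hvz huw huz hzw.symm e₁ e₄ e₃ e₂ hind₂ hle hP hwS hzS
        hvS huS hcard with h | h
      · exact Or.inl ⟨S.card - 1, by omega, v, Or.inr rfl, h.1, h.2⟩
      · exact Or.inr h
    · have h1 := MG.neither hred huv huz huw hvz hvw hzw hle hP huS hvS
      have h2 := hred _ _ ⟨h1, hW⟩ hcoll
      omega
  refine ⟨hfirst, ?_⟩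
  rcases hfirst with ⟨t, _, c, _, _, h⟩ | h <;> omega
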